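/- arXiv:1706.01713 — 10 statements merged into one kernel-verified Lean document; each statement's English description precedes it below -/
import Mathlib

section
/- Let F|k be an extension of algebraically closed fields with trdeg(F|k) = 1 and let F'|k' be any extension of algebraically closed fields. For a field isomorphism σ : F' ≅ F with σ(k') = k, define Φ(σ) : G_{F|k} → G_{F'|k'} by Φ(σ)(τ) = σ⁻¹ ∘ τ ∘ σ. Then: (i) Φ(σ) is an isomorphism of topological groups; (ii) every isomorphism of topological groups λ : G_{F|k} ≅ G_{F'|k'} equals Φ(σ) for some field isomorphism σ : F' ≅ F with σ(k') = k; and (iii) Φ(σ₁) = Φ(σ₂) if and only if σ₁ and σ₂ are Frobenius twists of each other. Thus Φ induces a bijection from the set of isomorphisms F'|k' ≅ F|k taken up to Frobenius twists onto the set of topological group isomorphisms G_{F|k} ≅ G_{F'|k'}. -/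
/-- The topology of pointwise convergence on `Aut(F|k)`: the subspace topology induced
from the product topology on `F → F` with `F` discrete. -/
def autTop (k F : Type*) [Field k] [Field F] [Algebra k F] : TopologicalSpace (F ≃ₐ[k] F) :=
  TopologicalSpace.induced (fun σ => (σ : F → F))
    (@Pi.topologicalSpace F (fun _ => F) (fun _ => ⊥))

/-- Isomorphisms `F'|k' ≅ F|k`: field isomorphisms `σ : F' ≅ F` with `σ(k') = k`. -/
def ExtIso (k F k' F' : Type*) [Field k] [Field F] [Field k'] [Field F']
    [Algebra k F] [Algebra k' F'] : Type _ :=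
  {σ : F' ≃+* F //
    σ '' Set.range (algebraMap k' F') = Set.range (algebraMap k F)}

/-- Isomorphisms of topological groups `G_{F|k} ≅ G_{F'|k'}`. -/
def TopGrpIso (k F k' F' : Type*) [Field k] [Field F] [Field k'] [Field F']
    [Algebra k F] [Algebra k' F'] : Type _ :=
  {e : (F ≃ₐ[k] F) ≃* (F' ≃ₐ[k'] F') //
    @Continuous _ _ (autTop k F) (autTop k' F') e ∧
    @Continuous _ _ (autTop k' F') (autTop k F) e.symm}

/-- `σ₁` and `σ₂` are Frobenius twists of each other: `σ₂ = Frob^n ∘ σ₁` for some `n ∈ ℤ`,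
where `Frob x = x ^ p` with `p` the exponential characteristic of `F` (so in characteristic
zero, `p = 1` and the condition reads `σ₂ = σ₁`). -/
def FrobTwist {F F' : Type*} [Field F] [Field F'] (σ₁ σ₂ : F' ≃+* F) : Prop :=
  ∃ n : ℕ, (∀ x, σ₂ x = σ₁ x ^ ringExpChar F ^ n) ∨ (∀ x, σ₁ x = σ₂ x ^ ringExpChar F ^ n)

namespace CurveAut

open IntermediateField

section Automorphisms

variable {k F : Type*} [Field k] [Field F] [Algebra k F]

theorem exists_algEquiv_of_isTranscendenceBasis [IsAlgClosed F] {ι : Type*} {v v' : ι → F}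
    (hv : IsTranscendenceBasis k v) (hv' : IsTranscendenceBasis k v') :
    ∃ g : F ≃ₐ[k] F, ∀ i, g (v i) = v' i := by
  have := IsAlgClosed.isAlgClosure_of_transcendence_basis v hv
  have := IsAlgClosed.isAlgClosure_of_transcendence_basis v' hv'
  let e : Algebra.adjoin k (Set.range v) ≃ₐ[k] Algebra.adjoin k (Set.range v') :=
    hv.1.aevalEquiv.symm.trans hv'.1.aevalEquiv
  let g := IsAlgClosure.equivOfEquiv F F e.toRingEquiv
  have hg : ∀ a, g (algebraMap _ F a) = algebraMap _ F (e a) :=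
    IsAlgClosure.equivOfEquiv_algebraMap F F e.toRingEquiv
  refine ⟨AlgEquiv.ofRingEquiv (f := g) fun r ↦ ?_, fun i ↦ ?_⟩
  · have := hg (algebraMap k _ r)
    rwa [AlgEquiv.commutes, ← IsScalarTower.algebraMap_apply,
      ← IsScalarTower.algebraMap_apply] at this
  · have h1 : algebraMap (Algebra.adjoin k (Set.range v)) F (hv.1.aevalEquiv (MvPolynomial.X i))
        = v i := by simp
    have h2 : algebraMap (Algebra.adjoin k (Set.range v')) F
        (hv'.1.aevalEquiv (MvPolynomial.X i)) = v' i := by simp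
    have := hg (hv.1.aevalEquiv (MvPolynomial.X i))
    rw [h1] at this
    change g (v i) = v' i
    rw [this, ← h2]
    simp [e]

theorem isTranscendenceBasis_update_affine {ι : Type*} [DecidableEq ι] {v : ι → F}
    (hv : IsTranscendenceBasis k v) (i : ι) {a : k} (ha : a ≠ 0) (b : k) :
    IsTranscendenceBasis k
      (Function.update v i (algebraMap k F a * v i + algebraMap k F b)) := by
  let P (a b : k) : MvPolynomial ι k →ₐ[k] MvPolynomial ι k :=
    MvPolynomial.aeval (Function.update MvPolynomial.X i
      (MvPolynomial.C a * MvPolynomial.X i + MvPolynomial.C b))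
  have hP : ∀ a b c d, (P a b).comp (P c d) = P (c * a) (c * b + d) := by
    intro a b c d
    ext j : 1
    by_cases hj : j = i
    · subst hj
      simp [P, add_assoc, mul_add, mul_assoc]
    · simp [P, hj]
  have hP1 : P 1 0 = AlgHom.id k _ := by
    ext j : 1
    by_cases hj : j = i
    · subst hj; simp [P]
    · simp [P]
  let e : MvPolynomial ι k ≃ₐ[k] MvPolynomial ι k :=
    AlgEquiv.ofAlgHom (P a b) (P a⁻¹ (-(a⁻¹ * b)))
      (by rw [hP, ← hP1]; congr 1 <;> field_simp; simp)
      (by rw [hP, ← hP1]; congr 1 <;> field_simp; simp)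
  set v' := Function.update v i (algebraMap k F a * v i + algebraMap k F b) with hv'
  have hcomp : MvPolynomial.aeval v' = (MvPolynomial.aeval v).comp (e : _ →ₐ[k] _) := by
    ext j : 1
    by_cases hj : j = i
    · subst hj
      simp [e, P, v', Algebra.algebraMap_eq_smul_one]
    · simp [e, P, v', hj]
  rw [isTranscendenceBasis_iff_algebraicIndependent_isAlgebraic]
  constructor
  · rw [AlgebraicIndependent, hcomp]
    exact (show Function.Injective _ from hv.1).comp e.injective
  · have : Algebra.adjoin k (Set.range v') = Algebra.adjoin k (Set.range v) := by
      rw [Algebra.adjoin_range_eq_range_aeval, Algebra.adjoin_range_eq_range_aeval, hcomp]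
      apply SetLike.coe_injective
      simp only [AlgHom.coe_range, AlgHom.coe_comp]
      exact e.surjective.range_comp _
    rw [this]
    exact hv.isAlgebraic

open scoped algebraAdjoinAdjoin in
theorem trdeg_eq_one_of_isAlgebraic_adjoin {x : F} (hx : Transcendental k x)
    [Algebra.IsAlgebraic k⟮x⟯ F] : Algebra.trdeg k F = 1 := by
  have hi : AlgebraicIndependent k (fun y : ({x} : Set F) ↦ (y : F)) :=
    algebraicIndependent_unique_type_iff.2 hx
  have hb : IsTranscendenceBasis k (fun y : ({x} : Set F) ↦ (y : F)) := by
    rw [isTranscendenceBasis_iff_algebraicIndependent_isAlgebraic]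
    refine ⟨hi, ?_⟩
    rw [Subtype.range_coe]
    exact (IsFractionRing.comap_isAlgebraic_iff (K := k⟮x⟯)).2 ‹_›
  rw [← hb.cardinalMk_eq_trdeg, Cardinal.mk_singleton]

theorem isTranscendenceBasis_of_transcendental (h1 : Algebra.trdeg k F = 1) {x : F}
    (hx : Transcendental k x) : IsTranscendenceBasis k (fun _ : Unit ↦ x) := by
  have : AlgebraicIndependent k (fun _ : Unit ↦ x) :=
    (algebraicIndependent_unique_type_iff).2 hx
  exact this.isTranscendenceBasis_of_lift_trdeg_le_of_finite (by simp [h1])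

theorem exists_algEquiv_apply_eq [IsAlgClosed F] (h1 : Algebra.trdeg k F = 1) {x y : F}
    (hx : Transcendental k x) (hy : Transcendental k y) : ∃ g : F ≃ₐ[k] F, g x = y := by
  obtain ⟨g, hg⟩ := exists_algEquiv_of_isTranscendenceBasis
    (isTranscendenceBasis_of_transcendental h1 hx) (isTranscendenceBasis_of_transcendental h1 hy)
  exact ⟨g, hg ()⟩

theorem isAlgebraic_adjoin_simple (h1 : Algebra.trdeg k F = 1) {x : F}
    (hx : Transcendental k x) : Algebra.IsAlgebraic k⟮x⟯ F := by
  have := (isTranscendenceBasis_of_transcendental h1 hx).isAlgebraic_field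
  rwa [Set.range_const] at this

theorem apply_eq_of_mem_adjoin {S : Set F} {g : F ≃ₐ[k] F} (hg : ∀ s ∈ S, g s = s) {t : F}
    (ht : t ∈ adjoin k S) : g t = t := by
  induction ht using adjoin_induction with
  | mem x hx => exact hg x hx
  | algebraMap x => exact g.commutes x
  | add x y _ _ hx hy => rw [map_add, hx, hy]
  | inv x _ hx => rw [map_inv₀, hx]
  | mul x y _ _ hx hy => rw [map_mul, hx, hy]

theorem finite_orbit {S : Set F} {z : F} (hz : IsAlgebraic (adjoin k S) z) :
    {t | ∃ g : F ≃ₐ[k] F, (∀ s ∈ S, g s = s) ∧ g z = t}.Finite := by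
  refine ((minpoly (adjoin k S) z).rootSet_finite F).subset ?_
  rintro _ ⟨g, hg, rfl⟩
  let g' : F ≃ₐ[adjoin k S] F :=
    AlgEquiv.ofRingEquiv (f := g.toRingEquiv) fun r ↦ apply_eq_of_mem_adjoin hg r.2
  rw [Polynomial.mem_rootSet]
  refine ⟨minpoly.ne_zero hz.isIntegral, ?_⟩
  have := Polynomial.aeval_algHom_apply g' z (minpoly (adjoin k S) z)
  rwa [minpoly.aeval, map_zero] at this

theorem exists_pow_mem_adjoin [IsAlgClosed F] (q : ℕ) [ExpChar k q] {S : Set F}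
    [Algebra.IsAlgebraic (adjoin k S) F] {z : F}
    (hz : ∀ g : F ≃ₐ[k] F, (∀ s ∈ S, g s = s) → g z = z) :
    ∃ n : ℕ, z ^ q ^ n ∈ adjoin k S := by
  have : ExpChar (adjoin k S) q := expChar_of_injective_algebraMap (algebraMap k _).injective q
  have hzi : IsAlgebraic (adjoin k S) z := Algebra.IsAlgebraic.isAlgebraic z
  have hmem : z ∈ perfectClosure (adjoin k S) F := by
    classical
    rw [mem_perfectClosure_iff_natSepDegree_eq_one,
      Polynomial.natSepDegree_eq_of_isAlgClosed F, Finset.card_eq_one]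
    refine ⟨z, Finset.eq_singleton_iff_unique_mem.2 ⟨?_, fun y hy ↦ ?_⟩⟩
    · simp [minpoly.ne_zero hzi.isIntegral]
    · rw [Multiset.mem_toFinset, Polynomial.mem_aroots] at hy
      have : Normal (adjoin k S) F := normal_iff.2 fun t ↦
        ⟨(Algebra.IsAlgebraic.isAlgebraic t).isIntegral, IsAlgClosed.splits _⟩
      obtain ⟨σ, hσ⟩ := minpoly.exists_algEquiv_of_root hzi hy.2
      refine σ.injective (hσ.trans (Eq.symm ?_))
      exact hz (σ.restrictScalars k) fun s hs ↦
        σ.commutes ⟨s, subset_adjoin k S hs⟩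
  obtain ⟨n, y, hy⟩ := (mem_perfectClosure_iff_pow_mem q).1 hmem
  exact ⟨n, hy ▸ y.2⟩

end Automorphisms

section RationalFunctions

variable {k F : Type*} [Field k] [Field F] [Algebra k F]

theorem exists_ratFunc_algHom {w : F} (hw : Transcendental k w) :
    ∃ φ : RatFunc k →ₐ[k] F, φ RatFunc.X = w ∧
      ∀ E : IntermediateField k F, E ≤ k⟮w⟯ → (E.comap φ).map φ = E := by
  let φ := k⟮w⟯.val.comp (RatFunc.algEquivOfTranscendental w hw).toAlgHom
  have hX : φ RatFunc.X = w := RatFunc.algEquivOfTranscendental_X w hw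
  refine ⟨φ, hX, fun E hE ↦ ?_⟩
  ext t
  rw [IntermediateField.mem_map]
  constructor
  · rintro ⟨u, hu, rfl⟩
    exact hu
  · intro ht
    have h : φ ((RatFunc.algEquivOfTranscendental w hw).symm ⟨t, hE ht⟩) = t := by simp [φ]
    exact ⟨_, show φ _ ∈ E by rwa [h], h⟩

theorem exists_adjoin_eq_of_le {w m : F} (hw : Transcendental k w) {E : IntermediateField k F}
    (hE : E ≤ k⟮w⟯) (hm : m ∈ E) (hmt : Transcendental k m) :
    ∃ z, Transcendental k z ∧ E = k⟮z⟯ := by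
  obtain ⟨φ, -, hφ⟩ := exists_ratFunc_algHom hw
  have hne : E.comap φ ≠ ⊥ := by
    intro h
    have h2 := hφ E hE
    rw [h, IntermediateField.map_bot] at h2
    rw [← h2, IntermediateField.mem_bot] at hm
    obtain ⟨c, rfl⟩ := hm
    exact hmt (isAlgebraic_algebraMap c)
  refine ⟨φ (RatFunc.Luroth.generator (E.comap φ)), ?_, ?_⟩
  · exact mt (isAlgebraic_algHom_iff φ φ.injective).1
      (RatFunc.Luroth.transcendental_generator hne)
  · conv_lhs => rw [← hφ E hE, RatFunc.Luroth.eq_adjoin_generator (E := E.comap φ)]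
    rw [IntermediateField.adjoin_map, Set.image_singleton]

theorem finrank_adjoin_X_pow (n : ℕ) :
    Module.finrank k⟮(RatFunc.X : RatFunc k) ^ n⟯ (RatFunc k) = n := by
  have h : (RatFunc.X : RatFunc k) ^ n = algebraMap (Polynomial k) _ (Polynomial.X ^ n) := by
    simp
  rw [RatFunc.finrank_eq_max_natDegree, h, RatFunc.num_algebraMap, RatFunc.denom_algebraMap]
  simp

theorem finrank_adjoin_eq_one {φ : RatFunc k →ₐ[k] F} {f : RatFunc k}
    (h : φ RatFunc.X ∈ k⟮φ f⟯) : Module.finrank k⟮f⟯ (RatFunc k) = 1 := by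
  have h1 : (RatFunc.X : RatFunc k) ∈ k⟮f⟯ := by
    rw [← Set.image_singleton, ← IntermediateField.adjoin_map] at h
    obtain ⟨u, hu, hu'⟩ := h
    rwa [φ.injective hu'] at hu
  have h2 : k⟮f⟯ = ⊤ := by
    rw [eq_top_iff, ← RatFunc.adjoin_X]
    exact adjoin_simple_le_iff.2 h1
  rw [h2, IntermediateField.finrank_top]

theorem linear_ne_zero {w : F} (hw : Transcendental k w) {c d : k} (h : c ≠ 0 ∨ d ≠ 0) :
    algebraMap k F c * w + algebraMap k F d ≠ 0 := by
  intro h0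
  have hp : (Polynomial.C c * Polynomial.X + Polynomial.C d) ≠ 0 := by
    intro hp
    have h1 := congrArg (Polynomial.coeff · 1) hp
    have h2 := congrArg (Polynomial.coeff · 0) hp
    simp at h1 h2
    tauto
  exact hw ⟨_, hp, by simpa using h0⟩

theorem adjoin_eq_adjoin_pow_of_mem (q : ℕ) [ExpChar k q] {w z : F} (hw : Transcendental k w)
    (hz : z ∈ k⟮w⟯) {n : ℕ} (hn : w ^ q ^ n ∈ k⟮z⟯) : ∃ s : ℕ, k⟮z⟯ = k⟮w ^ q ^ s⟯ := by
  obtain ⟨φ, hX, hφ⟩ := exists_ratFunc_algHom hw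
  have hle : k⟮z⟯ ≤ k⟮w⟯ := adjoin_simple_le_iff.2 hz
  set E := k⟮z⟯.comap φ with hE
  have hXE : (RatFunc.X : RatFunc k) ^ q ^ n ∈ E := by
    change φ _ ∈ k⟮z⟯
    rw [map_pow, hX]
    exact hn
  have : ExpChar E q := expChar_of_injective_algebraMap (algebraMap k _).injective q
  have hsep : (minpoly E (RatFunc.X : RatFunc k)).natSepDegree = 1 :=
    (minpoly.natSepDegree_eq_one_iff_pow_mem q).2 ⟨n, ⟨_, hXE⟩, rfl⟩
  obtain ⟨s, y, hs⟩ := (minpoly.natSepDegree_eq_one_iff_eq_X_pow_sub_C q).1 hsep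
  have hq : 0 < q := expChar_pos k q
  have hint : IsIntegral E (RatFunc.X : RatFunc k) := by
    by_contra h
    rw [minpoly.eq_zero h] at hs
    exact Polynomial.X_pow_sub_C_ne_zero (pow_pos hq s) y hs.symm
  have hmem : (RatFunc.X : RatFunc k) ^ q ^ s ∈ E := by
    have := minpoly.aeval E (RatFunc.X : RatFunc k)
    rw [hs] at this
    simp only [map_sub, map_pow, Polynomial.aeval_X, Polynomial.aeval_C, sub_eq_zero] at this
    rw [this]
    exact y.2
  have hdeg : Module.finrank E (RatFunc k) = q ^ s := by
    have h1 := IntermediateField.adjoin.finrank hint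
    rw [RatFunc.IntermediateField.adjoin_X, IntermediateField.finrank_top', hs,
      Polynomial.natDegree_X_pow_sub_C] at h1
    exact h1
  have hX' : ¬ ∃ c, (RatFunc.X : RatFunc k) ^ q ^ s = RatFunc.C c := by
    rintro ⟨c, hc⟩
    have := RatFunc.transcendental_X (K := k)
    exact this.pow (pow_pos hq s) (hc ▸ isAlgebraic_algebraMap c)
  have hdeg' : Module.finrank k⟮(RatFunc.X : RatFunc k) ^ q ^ s⟯ (RatFunc k) = q ^ s := by
    exact finrank_adjoin_X_pow _
  have hfin : FiniteDimensional k⟮(RatFunc.X : RatFunc k) ^ q ^ s⟯ (RatFunc k) :=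
    Module.finite_of_finrank_pos (by rw [hdeg']; exact pow_pos hq s)
  have hEq : k⟮(RatFunc.X : RatFunc k) ^ q ^ s⟯ = E :=
    IntermediateField.eq_of_le_of_finrank_le' (adjoin_simple_le_iff.2 hmem) (by rw [hdeg, hdeg'])
  refine ⟨s, ?_⟩
  rw [← hφ _ hle, ← hE, ← hEq, IntermediateField.adjoin_map, Set.image_singleton, map_pow, hX]

theorem exists_moebius_of_adjoin_eq {w z : F} (hw : Transcendental k w) (h : k⟮z⟯ = k⟮w⟯) :
    ∃ a b c d : k, a * d - b * c ≠ 0 ∧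
      z * (algebraMap k F c * w + algebraMap k F d) =
        algebraMap k F a * w + algebraMap k F b := by
  obtain ⟨φ, hX, hφ⟩ := exists_ratFunc_algHom hw
  obtain ⟨f, hf⟩ : ∃ f, φ f = z := by
    have hz : z ∈ (k⟮z⟯.comap φ).map φ := by
      rw [hφ _ h.le]
      exact mem_adjoin_simple_self k z
    obtain ⟨f, -, hf⟩ := hz
    exact ⟨f, hf⟩
  subst hf
  have hdeg : Module.finrank k⟮f⟯ (RatFunc k) = 1 :=
    finrank_adjoin_eq_one (φ := φ) (by rw [hX, h]; exact mem_adjoin_simple_self k w)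
  rw [RatFunc.finrank_eq_max_natDegree] at hdeg
  have hft : Transcendental k (φ f) := by
    intro hf
    have h1 : w ∈ k⟮φ f⟯ := h ▸ mem_adjoin_simple_self k w
    have := IntermediateField.isAlgebraic_adjoin_simple hf.isIntegral
    exact hw (isAlgebraic_iff.1 (Algebra.IsAlgebraic.isAlgebraic (⟨w, h1⟩ : k⟮φ f⟯)))
  obtain ⟨a, b, hab⟩ := Polynomial.exists_eq_X_add_C_of_natDegree_le_one
    (show f.num.natDegree ≤ 1 by omega)
  obtain ⟨c, d, hcd⟩ := Polynomial.exists_eq_X_add_C_of_natDegree_le_one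
    (show f.denom.natDegree ≤ 1 by omega)
  have hφp : ∀ p : Polynomial k, φ (algebraMap _ _ p) = Polynomial.aeval w p := by
    intro p
    rw [← hX, Polynomial.aeval_algHom_apply, RatFunc.aeval_X_left_eq_algebraMap]
  have hrel : φ f * (algebraMap k F c * w + algebraMap k F d) =
      algebraMap k F a * w + algebraMap k F b := by
    have h1 : f * algebraMap _ _ f.denom = algebraMap _ _ f.num := by
      have h2 := f.num_div_denom
      rwa [div_eq_iff (RatFunc.algebraMap_ne_zero f.denom_ne_zero), eq_comm] at h2
    have h3 := congrArg φ h1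
    rw [map_mul, hφp, hφp, hab, hcd] at h3
    simpa using h3
  refine ⟨a, b, c, d, fun h0 ↦ ?_, hrel⟩
  have hcd0 : c ≠ 0 ∨ d ≠ 0 := by
    by_contra! hc
    apply f.denom_ne_zero
    rw [hcd, hc.1, hc.2]
    simp
  have hne := linear_ne_zero hw hcd0
  have hadbc : algebraMap k F a * algebraMap k F d = algebraMap k F b * algebraMap k F c := by
    rw [← map_mul, ← map_mul, sub_eq_zero.1 h0]
  have key : (algebraMap k F c * φ f - algebraMap k F a) = 0 := by
    apply (mul_eq_zero.1 _).resolve_right hne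
    linear_combination algebraMap k F c * hrel - hadbc
  have key' : (algebraMap k F d * φ f - algebraMap k F b) = 0 := by
    apply (mul_eq_zero.1 _).resolve_right hne
    linear_combination algebraMap k F d * hrel + w * hadbc
  rcases hcd0 with hc | hd
  · exact linear_ne_zero hft (d := -a) (.inl hc) (by rw [map_neg]; linear_combination key)
  · exact linear_ne_zero hft (d := -b) (.inl hd) (by rw [map_neg]; linear_combination key')

theorem not_adjoin_pow_eq {w : F} (hw : Transcendental k w) {n : ℕ} (hn : 1 < n) :
    k⟮w ^ n⟯ ≠ k⟮w⟯ := by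
  intro h
  obtain ⟨φ, hX, -⟩ := exists_ratFunc_algHom hw
  have := finrank_adjoin_eq_one (φ := φ) (f := RatFunc.X ^ n)
    (by rw [map_pow, hX, h]; exact mem_adjoin_simple_self k w)
  rw [finrank_adjoin_X_pow] at this
  omega

theorem exists_stabilizer_eq [IsAlgClosed F] (h1 : Algebra.trdeg k F = 1) {x : F}
    (hx : Transcendental k x) (H : Subgroup (F ≃ₐ[k] F)) (hst : ∀ g : F ≃ₐ[k] F, g x = x → g ∈ H)
    (hfin : {t | ∃ g ∈ H, g x = t}.Finite) :
    ∃ w, Transcendental k w ∧ ∀ g, g ∈ H ↔ g w = w := by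
  obtain ⟨q, hq⟩ := ExpChar.exists k
  have : ExpChar F q := expChar_of_injective_algebraMap (algebraMap k F).injective q
  have := isAlgebraic_adjoin_simple h1 hx
  set P : Polynomial F := ∏ z ∈ hfin.toFinset, (Polynomial.X - Polynomial.C z) with hP
  have hroot : ∀ t, P.IsRoot t ↔ ∃ g ∈ H, g x = t := by
    intro t
    rw [hP, Polynomial.IsRoot, Polynomial.eval_prod, Finset.prod_eq_zero_iff]
    simp [sub_eq_zero]
  have hmap : ∀ h ∈ H, P.map (h : F →+* F) = P := by
    intro h hh
    rw [hP, Polynomial.map_prod]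
    refine Finset.prod_bij (fun z _ ↦ h z) ?_ (fun _ _ _ _ e ↦ h.injective e) ?_ ?_
    · intro a ha
      obtain ⟨g, hg, rfl⟩ := hfin.mem_toFinset.1 ha
      exact hfin.mem_toFinset.2 ⟨h * g, H.mul_mem hh hg, rfl⟩
    · intro a ha
      obtain ⟨g, hg, rfl⟩ := hfin.mem_toFinset.1 ha
      exact ⟨h⁻¹ (g x), hfin.mem_toFinset.2 ⟨h⁻¹ * g, H.mul_mem (H.inv_mem hh) hg, rfl⟩,
        h.apply_symm_apply _⟩
    · intro a ha
      simp
  have hcoeff : ∀ i, ∀ h ∈ H, h (P.coeff i) = P.coeff i := by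
    intro i h hh
    conv_rhs => rw [← hmap h hh, Polynomial.coeff_map]
    rfl
  let M : IntermediateField k F := fixedField H
  have hM : ∀ {m}, m ∈ M ↔ ∀ h ∈ H, h m = m := fun {m} ↦ IntermediateField.mem_fixedField_iff H m
  have hMpow : ∀ m ∈ M, ∃ n : ℕ, m ^ q ^ n ∈ M ⊓ k⟮x⟯ := by
    intro m hm
    obtain ⟨n, hn⟩ := exists_pow_mem_adjoin q (S := {x}) (z := m)
      fun g hg ↦ hM.1 hm g (hst g (hg x rfl))
    exact ⟨n, pow_mem hm _, hn⟩
  obtain ⟨i, hi⟩ : ∃ i, Transcendental k (P.coeff i) := by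
    by_contra! hcon
    have hl : P ∈ Polynomial.lifts (algebraMap (algebraicClosure k F) F) := by
      rw [Polynomial.lifts_iff_coeff_lifts]
      exact fun i ↦ ⟨⟨P.coeff i, mem_algebraicClosure_iff.2 (not_not.1 (hcon i))⟩, rfl⟩
    obtain ⟨Q, hQ⟩ := (Polynomial.mem_lifts _).1 hl
    have hPne : P ≠ 0 := Finset.prod_ne_zero_iff.2 fun a _ ↦ Polynomial.X_sub_C_ne_zero a
    have hxa : IsAlgebraic (algebraicClosure k F) x := by
      refine ⟨Q, fun h0 ↦ hPne (by rw [← hQ, h0, Polynomial.map_zero]), ?_⟩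
      rw [← Polynomial.eval_map_algebraMap, hQ]
      exact (hroot x).2 ⟨1, H.one_mem, rfl⟩
    exact hx (hxa.restrictScalars k)
  obtain ⟨n, hn⟩ := hMpow _ (hM.2 (hcoeff i))
  obtain ⟨w, hwt, hw⟩ := exists_adjoin_eq_of_le hx (inf_le_right : M ⊓ k⟮x⟯ ≤ _) hn
    (hi.pow (pow_pos (expChar_pos k q) n))
  refine ⟨w, hwt, fun g ↦ ⟨fun hg ↦ ?_, fun hg ↦ ?_⟩⟩
  · have : w ∈ M ⊓ k⟮x⟯ := hw ▸ mem_adjoin_simple_self k w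
    exact hM.1 this.1 g hg
  · have hgP : P.map (g : F →+* F) = P := by
      ext j
      rw [Polynomial.coeff_map]
      obtain ⟨n, hn⟩ := hMpow _ (hM.2 (hcoeff j))
      rw [hw] at hn
      have h2 := apply_eq_of_mem_adjoin (g := g) (by simpa using hg) hn
      rw [map_pow] at h2
      exact iterateFrobenius_inj F q n h2
    have hgx : P.IsRoot (g x) := by
      have h3 : P.IsRoot x := (hroot x).2 ⟨1, H.one_mem, rfl⟩
      have := h3.map (f := (g : F →+* F))
      rwa [hgP] at this
    obtain ⟨h, hh, hhx⟩ := (hroot _).1 hgx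
    have : h⁻¹ * g ∈ H := hst _ (by
      change h.symm (g x) = x
      rw [← hhx, AlgEquiv.symm_apply_apply])
    simpa using H.mul_mem hh this

end RationalFunctions

section FrobeniusPowers

variable {k F : Type*} [Field k] [Field F] [Algebra k F]

/-- The integral powers `x ↦ x ^ (q ^ n)`, `n : ℤ`, of the Frobenius of a perfect field. -/
noncomputable def frobPow (K : Type*) [Field K] (q : ℕ) [ExpChar K q] [PerfectRing K q] (n : ℤ) :
    K ≃+* K :=
  (show RingAut K from frobeniusEquiv K q) ^ n

section

variable {K L : Type*} [Field K] [Field L] (q : ℕ) [ExpChar K q] [PerfectRing K q]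
  [ExpChar L q] [PerfectRing L q]

theorem frobPow_natCast (n : ℕ) (x : K) : frobPow K q n x = x ^ q ^ n := by
  induction n with
  | zero => simp [frobPow]
  | succ n ih =>
    have : frobPow K q (n + 1 : ℕ) x = frobeniusEquiv K q (frobPow K q n x) := by
      simp only [frobPow, zpow_natCast, pow_succ']
      rfl
    rw [this, ih, frobeniusEquiv_apply, frobenius_def, ← pow_mul, pow_succ]

theorem frobPow_add (m n : ℤ) (x : K) :
    frobPow K q (m + n) x = frobPow K q m (frobPow K q n x) := by
  rw [frobPow, zpow_add]
  rfl

theorem frobPow_zero (x : K) : frobPow K q 0 x = x := by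
  simp [frobPow]

theorem frobPow_neg_apply (n : ℤ) (x : K) : frobPow K q (-n) (frobPow K q n x) = x := by
  rw [← frobPow_add, neg_add_cancel, frobPow_zero]

theorem map_frobPow (f : K →+* L) (n : ℤ) (x : K) : f (frobPow K q n x) = frobPow L q n (f x) := by
  obtain ⟨m, rfl | rfl⟩ := n.eq_nat_or_neg
  · rw [frobPow_natCast, frobPow_natCast, map_pow]
  · apply (frobPow L q m).injective
    rw [← frobPow_add, add_neg_cancel, frobPow_zero, frobPow_natCast, ← map_pow,
      ← frobPow_natCast, ← frobPow_add, add_neg_cancel, frobPow_zero]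

end

variable (q : ℕ) [ExpChar k q] [ExpChar F q] [PerfectRing k q] [PerfectRing F q]

theorem frobPow_mem_adjoin (n : ℤ) {t w : F} (ht : t ∈ k⟮w⟯) :
    frobPow F q n t ∈ k⟮frobPow F q n w⟯ := by
  induction ht using adjoin_induction with
  | mem x hx => rw [Set.mem_singleton_iff.1 hx]; exact mem_adjoin_simple_self k _
  | algebraMap x => rw [← map_frobPow]; exact IntermediateField.algebraMap_mem _ _
  | add x y _ _ hx hy => rw [map_add]; exact add_mem hx hy
  | inv x _ hx => rw [map_inv₀]; exact inv_mem hx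
  | mul x y _ _ hx hy => rw [map_mul]; exact mul_mem hx hy

theorem adjoin_frobPow (n : ℤ) {z w : F} (h : k⟮z⟯ = k⟮w⟯) :
    k⟮frobPow F q n z⟯ = k⟮frobPow F q n w⟯ :=
  le_antisymm
    (adjoin_simple_le_iff.2 (frobPow_mem_adjoin q n (h ▸ mem_adjoin_simple_self k z)))
    (adjoin_simple_le_iff.2 (frobPow_mem_adjoin q n (h ▸ mem_adjoin_simple_self k w)))

theorem adjoin_apply (g : F ≃ₐ[k] F) {z w : F} (h : k⟮z⟯ = k⟮w⟯) : k⟮g z⟯ = k⟮g w⟯ := by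
  have := congrArg (IntermediateField.map (g : F →ₐ[k] F)) h
  simp only [IntermediateField.adjoin_map, Set.image_singleton] at this
  exact this

theorem transcendental_apply (g : F ≃ₐ[k] F) {z : F} (h : Transcendental k z) :
    Transcendental k (g z) :=
  mt (isAlgebraic_algHom_iff (g : F →ₐ[k] F) g.injective).1 h

theorem adjoin_eq_of_stabilizer_eq [IsAlgClosed F] (h1 : Algebra.trdeg k F = 1) {z w : F}
    (hz : Transcendental k z) (hw : Transcendental k w)
    (h : ∀ g : F ≃ₐ[k] F, g z = z ↔ g w = w) : ∃ n : ℤ, k⟮z⟯ = k⟮frobPow F q n w⟯ := by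
  have hmem : ∀ {x y : F}, Transcendental k x → (∀ g : F ≃ₐ[k] F, g x = x → g y = y) →
      ∃ n : ℕ, y ^ q ^ n ∈ k⟮x⟯ := by
    intro x y hx hxy
    have := isAlgebraic_adjoin_simple h1 hx
    exact exists_pow_mem_adjoin q (S := {x}) fun g hg ↦ hxy g (hg x rfl)
  obtain ⟨i, hi⟩ := hmem hw fun g ↦ (h g).2
  have hzi : Transcendental k (z ^ q ^ i) := hz.pow (pow_pos (expChar_pos k q) i)
  obtain ⟨N, hN⟩ := hmem (y := w) hzi fun g hg ↦ by
    rw [map_pow] at hg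
    exact (h g).1 (iterateFrobenius_inj F q i hg)
  obtain ⟨s, hs⟩ := adjoin_eq_adjoin_pow_of_mem q hw hi hN
  refine ⟨-i + s, ?_⟩
  have := adjoin_frobPow q (-i) hs
  rwa [← frobPow_natCast, ← frobPow_natCast, frobPow_neg_apply, ← frobPow_add] at this

theorem eq_of_adjoin_frobPow_eq {w : F} (hw : Transcendental k w) {m n : ℤ}
    (h : k⟮frobPow F q m w⟯ = k⟮frobPow F q n w⟯) : q = 1 ∨ m = n := by
  wlog hmn : n ≤ m generalizing m n
  · rcases this h.symm (by omega) with h | h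
    · exact .inl h
    · exact .inr h.symm
  obtain ⟨j, rfl⟩ : ∃ j : ℕ, m = n + j := ⟨(m - n).toNat, by omega⟩
  have h2 := adjoin_frobPow q (-n) h
  rw [← frobPow_add, neg_add_cancel_left, frobPow_neg_apply, frobPow_natCast] at h2
  by_contra! hcon
  have hq : 1 < q := by have := expChar_pos k q; omega
  have hj : j ≠ 0 := by omega
  exact not_adjoin_pow_eq hw (Nat.one_lt_pow hj hq) h2

end FrobeniusPowers

section Centralizer

variable {k F : Type*} [Field k] [Field F] [Algebra k F]

theorem eq_zero_of_quadratic {x : F} (hx : Transcendental k x) {a b c : k}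
    (h : algebraMap k F a * x ^ 2 + algebraMap k F b * x + algebraMap k F c = 0) :
    a = 0 ∧ b = 0 ∧ c = 0 := by
  by_contra hcon
  refine hx ⟨Polynomial.C a * Polynomial.X ^ 2 + Polynomial.C b * Polynomial.X + Polynomial.C c,
    fun h0 ↦ hcon ?_, by simpa using h⟩
  have h1 := congrArg (Polynomial.coeff · 2) h0
  have h2 := congrArg (Polynomial.coeff · 1) h0
  have h3 := congrArg (Polynomial.coeff · 0) h0
  simp [Polynomial.coeff_X, Polynomial.coeff_C] at h1 h2 h3
  exact ⟨h1, h2, h3⟩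

theorem transcendental_iff_notMem_range [IsAlgClosed k] {x : F} :
    Transcendental k x ↔ x ∉ Set.range (algebraMap k F) := by
  constructor
  · rintro hx ⟨c, rfl⟩
    exact hx (isAlgebraic_algebraMap c)
  · intro hx hcon
    have h : algebraicClosure k F = ⊥ :=
      IntermediateField.eq_bot_of_isAlgClosed_of_isAlgebraic _
    exact hx (IntermediateField.mem_bot.1 (h ▸ mem_algebraicClosure_iff.2 hcon))

theorem transcendental_affine {x : F} (hx : Transcendental k x) {a : k} (ha : a ≠ 0) (b : k) :
    Transcendental k (algebraMap k F a * x + algebraMap k F b) := by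
  intro hcon
  have h1 := (hcon.sub (isAlgebraic_algebraMap b)).mul (isAlgebraic_algebraMap (A := F) a⁻¹)
  rw [add_sub_cancel_right, mul_comm, ← mul_assoc, ← map_mul, inv_mul_cancel₀ ha, map_one,
    one_mul] at h1
  exact hx h1

theorem exists_ne_zero_ne_one (K : Type*) [Field K] [Infinite K] : ∃ r : K, r ≠ 0 ∧ r ≠ 1 := by
  classical
  obtain ⟨r, hr⟩ := Infinite.exists_notMem_finset ({0, 1} : Finset K)
  simp only [Finset.mem_insert, Finset.mem_singleton, not_or] at hr
  exact ⟨r, hr⟩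

theorem eq_frobPow_of_commute [IsAlgClosed k] [IsAlgClosed F] (h1 : Algebra.trdeg k F = 1)
    (q : ℕ) [ExpChar k q] [ExpChar F q] {x : F} (hx : Transcendental k x) (ν : F ≃+* F)
    (hν : ν '' Set.range (algebraMap k F) = Set.range (algebraMap k F))
    (hcomm : ∀ (τ : F ≃ₐ[k] F) (t : F), ν (τ t) = τ (ν t)) :
    ∃ n : ℤ, ∀ t, ν t = frobPow F q n t := by
  have hνx : Transcendental k (ν x) := by
    rw [transcendental_iff_notMem_range] at hx ⊢
    rw [← hν]
    rintro ⟨t, ht, he⟩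
    exact hx (ν.injective he ▸ ht)
  obtain ⟨n, hn⟩ := adjoin_eq_of_stabilizer_eq q h1 hνx hx fun g ↦ by
    rw [← hcomm, ν.injective.eq_iff]
  refine ⟨n, ?_⟩
  let ν' : F ≃+* F := ν.trans (frobPow F q (-n))
  have hν'k : ∀ r : k, ∃ r' : k, ν' (algebraMap k F r) = algebraMap k F r' := by
    intro r
    obtain ⟨s, hs⟩ : ν (algebraMap k F r) ∈ Set.range (algebraMap k F) :=
      hν ▸ Set.mem_image_of_mem _ ⟨r, rfl⟩
    exact ⟨frobPow k q (-n) s, by rw [map_frobPow q, hs]; rfl⟩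
  have hcomm' : ∀ (τ : F ≃ₐ[k] F) (t : F), ν' (τ t) = τ (ν' t) := by
    intro τ t
    change frobPow F q (-n) (ν (τ t)) = τ (frobPow F q (-n) (ν t))
    rw [hcomm]
    exact (map_frobPow q (τ : F →+* F) _ _).symm
  have hadj : k⟮ν' x⟯ = k⟮x⟯ := by
    have := adjoin_frobPow q (-n) hn
    rwa [frobPow_neg_apply] at this
  obtain ⟨a, b, c, d, hdet, hz⟩ := exists_moebius_of_adjoin_eq hx hadj
  have haff : ∀ {r s : k}, r ≠ 0 → ∃ τ : F ≃ₐ[k] F,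
      τ x = algebraMap k F r * x + algebraMap k F s := fun hr ↦
    exists_algEquiv_apply_eq h1 hx (transcendental_affine hx hr _)
  obtain ⟨τ, hτ⟩ := haff (r := 1) (s := 1) one_ne_zero
  simp only [map_one, one_mul] at hτ
  have hz1 := congrArg τ hz
  simp only [map_mul, map_add, AlgEquiv.commutes, ← hcomm', hτ, map_one] at hz1
  have hc : c = 0 := by
    have := (eq_zero_of_quadratic hx (a := c ^ 2)
      (b := c * (c + d + d)) (c := c * b + (c + d - a) * d) ?_).1
    · simpa using this
    · push_cast [map_mul, map_add, map_sub, map_pow]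
      linear_combination (algebraMap k F c * x + algebraMap k F d) * hz1 -
        (algebraMap k F c * x + algebraMap k F d + algebraMap k F c) * hz
  subst hc
  simp only [zero_mul, mul_zero, sub_zero, map_zero, zero_add] at hdet hz hz1
  have had : algebraMap k F d = algebraMap k F a := by linear_combination hz1 - hz
  have hd : algebraMap k F d ≠ 0 := by
    simpa using (mul_ne_zero_iff.1 hdet).2
  obtain ⟨r, hr0, hr1⟩ := exists_ne_zero_ne_one k
  obtain ⟨ρ, hρ⟩ := haff (s := 0) hr0
  obtain ⟨r', hr'⟩ := hν'k r
  have hz2 := congrArg ρ hz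
  simp only [map_mul, map_add, AlgEquiv.commutes, ← hcomm', hρ, hr', map_zero, add_zero] at hz2
  have h3 := eq_zero_of_quadratic hx (a := 0) (b := a * (r - r')) (c := b * (1 - r')) (by
    simp only [map_mul, map_sub, map_zero, map_one]
    linear_combination algebraMap k F r' * hz - hz2)
  have hrr : r' = r := by
    have := (mul_eq_zero.1 h3.2.1).resolve_left fun h ↦ (mul_ne_zero_iff.1 hdet).1 h
    linear_combination -this
  have hb : b = 0 := by
    refine (mul_eq_zero.1 h3.2.2).resolve_right fun h ↦ hr1 ?_
    linear_combination -h - hrr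
  have hfix : ν' x = x := by
    rw [hb, had, map_zero, add_zero, mul_comm] at hz
    exact mul_left_cancel₀ (had ▸ hd) hz
  have hfixt : ∀ t, Transcendental k t → ν' t = t := by
    intro t ht
    obtain ⟨g, rfl⟩ := exists_algEquiv_apply_eq h1 hx ht
    rw [hcomm', hfix]
  have hall : ∀ t, ν' t = t := by
    intro t
    by_cases ht : Transcendental k t
    · exact hfixt t ht
    · have h4 : Transcendental k (t + x) := fun h ↦ hx (by
        have := h.sub (not_not.1 ht)
        rwa [add_sub_cancel_left] at this)
      have h5 := hfixt _ h4
      rw [map_add, hfix] at h5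
      exact add_right_cancel h5
  intro t
  have : frobPow F q n (ν' t) = ν t := by
    change frobPow F q n (frobPow F q (-n) (ν t)) = ν t
    rw [← frobPow_add, add_neg_cancel, frobPow_zero]
  rw [← this, hall]

end Centralizer

section Conjugation

variable {k F k' F' : Type*} [Field k] [Field F] [Field k'] [Field F'] [Algebra k F]
  [Algebra k' F']

theorem symm_image_range (σ : F' ≃+* F)
    (hσ : σ '' Set.range (algebraMap k' F') = Set.range (algebraMap k F)) :
    σ.symm '' Set.range (algebraMap k F) = Set.range (algebraMap k' F') := by
  rw [← hσ, ← Set.image_comp]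
  simp

theorem frobTwist_iff [IsAlgClosed k] [IsAlgClosed F] (h1 : Algebra.trdeg k F = 1)
    {x : F} (hx : Transcendental k x) (σ₁ σ₂ : ExtIso k F k' F') :
    (∀ (τ : F ≃ₐ[k] F) (x : F'), σ₁.1.symm (τ (σ₁.1 x)) = σ₂.1.symm (τ (σ₂.1 x))) ↔
      FrobTwist σ₁.1 σ₂.1 := by
  obtain ⟨q, hq⟩ := ExpChar.exists k
  have : ExpChar F q := expChar_of_injective_algebraMap (algebraMap k F).injective q
  have hqF : ringExpChar F = q := ringExpChar.eq F q
  rw [FrobTwist, hqF]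
  constructor
  · intro h
    let ν : F ≃+* F := σ₁.1.symm.trans σ₂.1
    have hνσ : ∀ y, ν (σ₁.1 y) = σ₂.1 y := fun y ↦ by simp [ν]
    obtain ⟨n, hn⟩ := eq_frobPow_of_commute h1 q hx ν (by
      have : (ν : F → F) = σ₂.1 ∘ σ₁.1.symm := rfl
      rw [this, Set.image_comp, symm_image_range _ σ₁.2]
      exact σ₂.2) fun τ t ↦ by
        obtain ⟨y, rfl⟩ := σ₁.1.surjective t
        have := congrArg σ₂.1 (h τ y)
        rw [RingEquiv.apply_symm_apply] at this
        rw [hνσ, ← this]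
        rfl
    simp only [← hνσ, hn]
    obtain ⟨m, rfl | rfl⟩ := n.eq_nat_or_neg
    · exact ⟨m, .inl fun y ↦ frobPow_natCast q m _⟩
    · refine ⟨m, .inr fun y ↦ ?_⟩
      rw [← frobPow_natCast q m, ← frobPow_add, add_neg_cancel, frobPow_zero]
  · have key : ∀ (σ₁ σ₂ : ExtIso k F k' F') (n : ℕ), (∀ x, σ₂.1 x = σ₁.1 x ^ q ^ n) →
        ∀ (τ : F ≃ₐ[k] F) (x : F'), σ₁.1.symm (τ (σ₁.1 x)) = σ₂.1.symm (τ (σ₂.1 x)) := by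
      intro σ₁ σ₂ n h τ y
      apply σ₂.1.injective
      rw [RingEquiv.apply_symm_apply, h, RingEquiv.apply_symm_apply, h, map_pow]
    rintro ⟨n, h | h⟩ τ y
    · exact key σ₁ σ₂ n h τ y
    · exact (key σ₂ σ₁ n h τ y).symm

/-- Conjugation by an isomorphism of field extensions. -/
def conj (σ : F' ≃+* F) (hσ : σ '' Set.range (algebraMap k' F') = Set.range (algebraMap k F)) :
    (F ≃ₐ[k] F) →* (F' ≃ₐ[k'] F') where
  toFun τ := AlgEquiv.ofRingEquiv (f := (σ.trans τ.toRingEquiv).trans σ.symm) fun r ↦ by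
    obtain ⟨s, hs⟩ : σ (algebraMap k' F' r) ∈ Set.range (algebraMap k F) :=
      hσ ▸ Set.mem_image_of_mem _ ⟨r, rfl⟩
    change σ.symm (τ (σ _)) = _
    rw [← hs, τ.commutes, hs, RingEquiv.symm_apply_apply]
  map_one' := by
    ext y
    exact σ.symm_apply_apply y
  map_mul' τ ρ := by
    ext y
    change σ.symm (τ (ρ (σ y))) = σ.symm (τ (σ (σ.symm (ρ (σ y)))))
    rw [RingEquiv.apply_symm_apply]

theorem conj_apply (σ : F' ≃+* F)
    (hσ : σ '' Set.range (algebraMap k' F') = Set.range (algebraMap k F)) (τ : F ≃ₐ[k] F)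
    (y : F') : conj σ hσ τ y = σ.symm (τ (σ y)) := rfl

theorem continuous_conj (σ : F' ≃+* F)
    (hσ : σ '' Set.range (algebraMap k' F') = Set.range (algebraMap k F)) :
    @Continuous _ _ (autTop k F) (autTop k' F') (conj σ hσ) := by
  let _ : TopologicalSpace F := ⊥
  let _ : TopologicalSpace F' := ⊥
  have : DiscreteTopology F := ⟨rfl⟩
  let _ : TopologicalSpace (F ≃ₐ[k] F) := autTop k F
  let _ : TopologicalSpace (F' ≃ₐ[k'] F') := autTop k' F'
  refine continuous_induced_rng.2 (continuous_pi fun y ↦ ?_)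
  have h1 : Continuous fun τ : F ≃ₐ[k] F ↦ τ (σ y) :=
    (continuous_apply (σ y)).comp (continuous_induced_dom (f := fun τ : F ≃ₐ[k] F ↦ (τ : F → F)))
  exact (continuous_of_discreteTopology (f := σ.symm)).comp h1

theorem exists_topGrpIso (σ : ExtIso k F k' F') : ∃ e : TopGrpIso k F k' F',
    ∀ (τ : F ≃ₐ[k] F) (x : F'), e.1 τ x = σ.1.symm (τ (σ.1 x)) := by
  obtain ⟨σ, hσ⟩ := σ
  have hσ' := symm_image_range σ hσ
  refine ⟨⟨(conj σ hσ).toMulEquiv (conj σ.symm hσ') ?_ ?_, continuous_conj σ hσ,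
    continuous_conj σ.symm hσ'⟩, fun τ x ↦ rfl⟩
  · ext τ y
    simp [conj_apply]
  · ext τ y
    simp [conj_apply]

/-- Continuity at the identity in terms of pointwise stabilizers of finite sets. -/
theorem exists_finite_of_continuous (f : (F ≃ₐ[k] F) →* (F' ≃ₐ[k'] F'))
    (hf : @Continuous _ _ (autTop k F) (autTop k' F') f) {S' : Set F'} (hS' : S'.Finite) :
    ∃ S : Set F, S.Finite ∧ ∀ g : F ≃ₐ[k] F, (∀ s ∈ S, g s = s) → ∀ s ∈ S', f g s = s := by
  let _ : TopologicalSpace F := ⊥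
  let _ : TopologicalSpace F' := ⊥
  have : DiscreteTopology F := ⟨rfl⟩
  have : DiscreteTopology F' := ⟨rfl⟩
  let _ : TopologicalSpace (F ≃ₐ[k] F) := autTop k F
  let _ : TopologicalSpace (F' ≃ₐ[k'] F') := autTop k' F'
  have hev : ∀ y : F', Continuous fun τ : F ≃ₐ[k] F ↦ f τ y := fun y ↦
    (continuous_apply y).comp
      ((continuous_induced_dom (f := fun τ : F' ≃ₐ[k'] F' ↦ (τ : F' → F'))).comp hf)
  have hU : IsOpen {g : F ≃ₐ[k] F | ∀ s ∈ S', f g s = s} := by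
    have : {g : F ≃ₐ[k] F | ∀ s ∈ S', f g s = s} = ⋂ s ∈ S', {g | f g s = s} := by
      ext g; simp
    rw [this]
    exact hS'.isOpen_biInter fun s _ ↦ (isOpen_discrete {s}).preimage (hev s)
  obtain ⟨V, hV, hVU⟩ := isOpen_induced_iff.1 hU
  have h1 : ((1 : F ≃ₐ[k] F) : F → F) ∈ V := by
    change (1 : F ≃ₐ[k] F) ∈ (fun τ : F ≃ₐ[k] F ↦ (τ : F → F)) ⁻¹' V
    rw [hVU]
    intro s _
    simp
  obtain ⟨I, u, hu, huV⟩ := isOpen_pi_iff.1 hV _ h1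
  refine ⟨I, I.finite_toSet, fun g hg ↦ ?_⟩
  have hgV : g ∈ (fun τ : F ≃ₐ[k] F ↦ (τ : F → F)) ⁻¹' V := huV fun i hi ↦ by
    have h2 : (1 : F ≃ₐ[k] F) i ∈ u i := (hu i hi).2
    change g i ∈ u i
    rw [hg i hi]
    exact h2
  rw [hVU] at hgV
  exact hgV

end Conjugation

section Reconstruction

variable {k F k' F' : Type*} [Field k] [Field F] [Field k'] [Field F'] [Algebra k F]
  [Algebra k' F']

/-- A map `F' → F` that is equivariant along `μ` and compatible with affine transformations. -/
structure IsEquivariant (μ : (F' ≃ₐ[k'] F') ≃* (F ≃ₐ[k] F)) (α : k' →+* k) (s : F' → F) :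
    Prop where
  map_algebraMap : ∀ c, s (algebraMap k' F' c) = algebraMap k F (α c)
  map_apply : ∀ g t, s (g t) = μ g (s t)
  transcendental : ∀ {t}, Transcendental k' t → Transcendental k (s t)
  inj : ∀ {t u}, Transcendental k' t → Transcendental k' u → s t = s u → t = u
  surj : ∀ {u}, Transcendental k u → ∃ t, Transcendental k' t ∧ s t = u
  map_affine : ∀ a b t, s (algebraMap k' F' a * t + algebraMap k' F' b) =
    algebraMap k F (α a) * s t + algebraMap k F (α b)

theorem exists_isEquivariant [IsAlgClosed k] [IsAlgClosed k'] [IsAlgClosed F] [IsAlgClosed F']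
    (h1 : Algebra.trdeg k F = 1) (h1' : Algebra.trdeg k' F' = 1)
    (μ : (F' ≃ₐ[k'] F') ≃* (F ≃ₐ[k] F)) (α : k' →+* k) {y : F'} {w : F}
    (hy : Transcendental k' y) (hw : Transcendental k w)
    (hstab : ∀ g, μ g w = w → g y = y)
    (haff : ∀ g a b, a ≠ 0 → g y = algebraMap k' F' a * y + algebraMap k' F' b →
      μ g w = algebraMap k F (α a) * w + algebraMap k F (α b)) :
    ∃ s : F' → F, IsEquivariant μ α s := by
  classical
  have hstab' : ∀ g g', g y = g' y ↔ μ g w = μ g' w := by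
    intro g g'
    have e1 : g y = g' y ↔ (g'⁻¹ * g) y = y := by
      change _ ↔ g'.symm (g y) = y
      rw [AlgEquiv.symm_apply_eq]
    have e2 : μ g w = μ g' w ↔ μ (g'⁻¹ * g) w = w := by
      rw [map_mul, map_inv]
      change _ ↔ (μ g').symm (μ g w) = w
      rw [AlgEquiv.symm_apply_eq]
    rw [e1, e2]
    refine ⟨fun h ↦ ?_, hstab _⟩
    rw [haff _ 1 0 one_ne_zero (h.trans (by simp))]
    simp
  have hT : ∀ t : F', ∃ u : F, (∀ c, t = algebraMap k' F' c → u = algebraMap k F (α c)) ∧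
      ∀ g, t = (g : F' ≃ₐ[k'] F') y → u = μ g w := by
    intro t
    by_cases ht : Transcendental k' t
    · obtain ⟨g, rfl⟩ := exists_algEquiv_apply_eq h1' hy ht
      refine ⟨μ g w, fun c hc ↦ (ht (hc ▸ isAlgebraic_algebraMap c)).elim, fun g' hg ↦ ?_⟩
      exact (hstab' g g').1 hg
    · have ht' := ht
      rw [transcendental_iff_notMem_range, not_not] at ht'
      obtain ⟨c, rfl⟩ := ht'
      refine ⟨algebraMap k F (α c), fun c' hc ↦ ?_, fun g hg ↦ ?_⟩
      · rw [(algebraMap k' F').injective hc]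
      · exact (ht (hg ▸ transcendental_apply g hy)).elim
  choose s hsc hsg using hT
  have hsg' : ∀ g : F' ≃ₐ[k'] F', s (g y) = μ g w := fun g ↦ hsg _ g rfl
  have hsc' : ∀ c, s (algebraMap k' F' c) = algebraMap k F (α c) := fun c ↦ hsc _ c rfl
  refine ⟨s, hsc', ?_, ?_, ?_, ?_, ?_⟩
  · intro g t
    by_cases ht : Transcendental k' t
    · obtain ⟨g', rfl⟩ := exists_algEquiv_apply_eq h1' hy ht
      rw [hsg', ← AlgEquiv.mul_apply, hsg', map_mul, AlgEquiv.mul_apply]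
    · rw [transcendental_iff_notMem_range, not_not] at ht
      obtain ⟨c, rfl⟩ := ht
      rw [AlgEquiv.commutes, hsc', AlgEquiv.commutes]
  · intro t ht
    obtain ⟨g', rfl⟩ := exists_algEquiv_apply_eq h1' hy ht
    rw [hsg']
    exact transcendental_apply _ hw
  · intro t u ht hu h
    obtain ⟨g, rfl⟩ := exists_algEquiv_apply_eq h1' hy ht
    obtain ⟨g', rfl⟩ := exists_algEquiv_apply_eq h1' hy hu
    rwa [hsg', hsg', ← hstab'] at h
  · intro u hu
    obtain ⟨g, rfl⟩ := exists_algEquiv_apply_eq h1 hw hu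
    exact ⟨μ.symm g y, transcendental_apply _ hy, by rw [hsg', MulEquiv.apply_symm_apply]⟩
  · intro a b t
    by_cases ht : Transcendental k' t
    · by_cases ha : a = 0
      · subst ha
        simp [hsc']
      · obtain ⟨g, rfl⟩ := exists_algEquiv_apply_eq h1' hy ht
        obtain ⟨g', hg'⟩ := exists_algEquiv_apply_eq h1' hy (transcendental_affine hy ha b)
        have h3 : algebraMap k' F' a * g y + algebraMap k' F' b = (g * g') y := by
          rw [AlgEquiv.mul_apply, hg', map_add, map_mul, AlgEquiv.commutes, AlgEquiv.commutes]
        rw [h3, hsg', hsg', map_mul, AlgEquiv.mul_apply, haff g' a b ha hg', map_add, map_mul,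
          AlgEquiv.commutes, AlgEquiv.commutes]
    · rw [transcendental_iff_notMem_range, not_not] at ht
      obtain ⟨c, rfl⟩ := ht
      rw [← map_mul, ← map_add, hsc', hsc', map_add, map_mul, map_add, map_mul]

namespace IsEquivariant

variable {μ : (F' ≃ₐ[k'] F') ≃* (F ≃ₐ[k] F)} {α : k' →+* k} {s : F' → F}

theorem map_smul (hs : IsEquivariant μ α s) (a : k') (t : F') :
    s (algebraMap k' F' a * t) = algebraMap k F (α a) * s t := by
  simpa using hs.map_affine a 0 t

theorem map_zero' (hs : IsEquivariant μ α s) : s 0 = 0 := by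
  simpa using hs.map_algebraMap 0

theorem map_one' (hs : IsEquivariant μ α s) : s 1 = 1 := by
  simpa using hs.map_algebraMap 1

theorem exists_algebraMap [IsAlgClosed k'] {t : F'} (ht : ¬ Transcendental k' t) :
    ∃ c, t = algebraMap k' F' c := by
  rw [transcendental_iff_notMem_range, not_not] at ht
  obtain ⟨c, rfl⟩ := ht
  exact ⟨c, rfl⟩

theorem map_ne_zero' [IsAlgClosed k'] (hs : IsEquivariant μ α s) {t : F'} (ht : t ≠ 0) :
    s t ≠ 0 := by
  by_cases htt : Transcendental k' t
  · exact fun h ↦ hs.transcendental htt (h ▸ isAlgebraic_zero)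
  · obtain ⟨c, rfl⟩ := exists_algebraMap htt
    rw [hs.map_algebraMap]
    simpa using ht

variable [IsAlgClosed k] [IsAlgClosed k'] [IsAlgClosed F']

theorem map_pow_proportional (hs : IsEquivariant μ α s) (h1 : Algebra.trdeg k F = 1)
    (h1' : Algebra.trdeg k' F' = 1) {n : ℕ} (hn : 0 < n) (t : F') :
    ∃ c : k, c ≠ 0 ∧ s (t ^ n) = algebraMap k F c * s t ^ n := by
  by_cases ht : Transcendental k' t
  swap
  · obtain ⟨c, rfl⟩ := exists_algebraMap ht
    refine ⟨1, one_ne_zero, ?_⟩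
    rw [← map_pow, hs.map_algebraMap, hs.map_algebraMap, map_pow, map_pow, map_one, one_mul]
  have hst := hs.transcendental ht
  have hst0 : s t ≠ 0 := fun h ↦ hst (h ▸ isAlgebraic_zero)
  have hstn := hs.transcendental (ht.pow hn)
  have hstn0 : s (t ^ n) ≠ 0 := fun h ↦ hstn (h ▸ isAlgebraic_zero)
  set v := s (t ^ n) / s t ^ n with hv
  have hvalg : ¬ Transcendental k v := by
    intro hvt
    have := isAlgebraic_adjoin_simple h1 hvt
    have : Infinite {a : k' // a ≠ 0} := (Set.finite_singleton (0 : k')).infinite_compl.to_subtype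
    refine Set.infinite_of_injective_forall_mem (α := {a : k' // a ≠ 0})
      (f := fun a ↦ algebraMap k F (α a) * s t) ?_ ?_
      (finite_orbit (S := {v}) (Algebra.IsAlgebraic.isAlgebraic (R := k⟮v⟯) (s t)))
    · intro a b h
      exact Subtype.ext (α.injective ((algebraMap k F).injective (mul_right_cancel₀ hst0 h)))
    · rintro ⟨a, ha⟩
      obtain ⟨g, hg⟩ := exists_algEquiv_apply_eq h1' ht (transcendental_affine ht ha 0)
      rw [map_zero, add_zero] at hg
      have h2 : μ g (s t) = algebraMap k F (α a) * s t := by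
        rw [← hs.map_apply, hg, hs.map_smul]
      refine ⟨μ g, ?_, h2⟩
      rintro _ rfl
      rw [hv, map_div₀, map_pow, h2, ← hs.map_apply, map_pow, hg, mul_pow, ← map_pow,
        hs.map_smul, map_pow, map_pow, mul_pow]
      refine mul_div_mul_left _ _ ?_
      simpa using fun h ↦ (ha h).elim
  obtain ⟨c, hc⟩ := exists_algebraMap hvalg
  refine ⟨c, ?_, ?_⟩
  · rintro rfl
    rw [map_zero, hv] at hc
    exact div_ne_zero hstn0 (pow_ne_zero _ hst0) hc
  · rw [← hc, hv, div_mul_cancel₀ _ (pow_ne_zero _ hst0)]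

end IsEquivariant

end Reconstruction

section Reconstruction

variable {k F k' F' : Type*} [Field k] [Field F] [Field k'] [Field F'] [Algebra k F]
  [Algebra k' F']

namespace IsEquivariant

variable {μ : (F' ≃ₐ[k'] F') ≃* (F ≃ₐ[k] F)} {α : k' →+* k} {s : F' → F}

theorem exists_lt_natCast_ne_zero (K : Type*) [Field K] (N : ℕ) : ∃ n : ℕ, N < n ∧ (n : K) ≠ 0 := by
  by_contra! h
  have h2 := h (N + 1) (by omega)
  have h3 := h (N + 2) (by omega)
  push_cast at h2 h3
  exact one_ne_zero (α := K) (by linear_combination h3 - h2)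

theorem exists_pow_eq_algebraMap_of_pow_eq [IsAlgClosed k'] {n : ℕ} (hn : n ≠ 0) {t u : F'}
    (hu : u ≠ 0) (h : t ^ n = u ^ n) : ∃ ζ : k', ζ ≠ 0 ∧ t = algebraMap k' F' ζ * u := by
  have h2 : (t / u) ^ n = 1 := by rw [div_pow, h, div_self (pow_ne_zero _ hu)]
  have h3 : ¬ Transcendental k' (t / u) := fun h4 ↦
    h4.pow (Nat.pos_of_ne_zero hn) (h2 ▸ isAlgebraic_one)
  obtain ⟨ζ, hζ⟩ := exists_algebraMap h3
  refine ⟨ζ, ?_, ?_⟩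
  · rintro rfl
    rw [map_zero] at hζ
    rw [hζ, zero_pow hn] at h2
    exact zero_ne_one h2
  · rw [← hζ, div_mul_cancel₀ _ hu]

variable [IsAlgClosed k] [IsAlgClosed k'] [IsAlgClosed F] [IsAlgClosed F']

theorem map_mul_proportional (hs : IsEquivariant μ α s) (h1 : Algebra.trdeg k F = 1)
    (h1' : Algebra.trdeg k' F' = 1) {y z : F'} (hy : y ≠ 0) (hz : z ≠ 0) :
    ∃ c : k, c ≠ 0 ∧ s (y * z) = algebraMap k F c * (s y * s z) := by
  have hsy := hs.map_ne_zero' hy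
  have hsz := hs.map_ne_zero' hz
  have hsyz := hs.map_ne_zero' (mul_ne_zero hy hz)
  set u := s (y * z) / (s y * s z) with hu
  have hu0 : u ≠ 0 := div_ne_zero hsyz (mul_ne_zero hsy hsz)
  suffices hualg : ¬ Transcendental k u by
    obtain ⟨c, hc⟩ := exists_algebraMap hualg
    refine ⟨c, ?_, ?_⟩
    · rintro rfl
      exact hu0 (by rw [hc, map_zero])
    · rw [← hc, hu, div_mul_cancel₀ _ (mul_ne_zero hsy hsz)]
  intro hut
  obtain ⟨t₀, ht₀, hst₀⟩ := hs.surj hut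
  have := isAlgebraic_adjoin_simple h1' ht₀
  have hfin : ∀ x : F',
      {t | ∃ g : F' ≃ₐ[k'] F', (∀ s ∈ ({t₀} : Set F'), g s = s) ∧ g x = t}.Finite :=
    fun x ↦ finite_orbit (Algebra.IsAlgebraic.isAlgebraic (R := k'⟮t₀⟯) x)
  have hfinT := (hfin y).prod (hfin z)
  set T := {t | ∃ g : F' ≃ₐ[k'] F', (∀ s ∈ ({t₀} : Set F'), g s = s) ∧ g y = t} ×ˢ
    {t | ∃ g : F' ≃ₐ[k'] F', (∀ s ∈ ({t₀} : Set F'), g s = s) ∧ g z = t} with hT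
  obtain ⟨n, hTn, hn⟩ := exists_lt_natCast_ne_zero k T.ncard
  have hn0 : n ≠ 0 := fun h ↦ hn (by simp [h])
  have hnpos := Nat.pos_of_ne_zero hn0
  have : NeZero (n : k) := ⟨hn⟩
  obtain ⟨ζ, hζ⟩ := HasEnoughRootsOfUnity.exists_primitiveRoot k n
  obtain ⟨yn, hyn⟩ := IsAlgClosed.exists_pow_nat_eq y hnpos
  obtain ⟨zn, hzn⟩ := IsAlgClosed.exists_pow_nat_eq z hnpos
  have hyn0 : yn ≠ 0 := by rintro rfl; exact hy (by rw [← hyn, zero_pow hn0])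
  have hzn0 : zn ≠ 0 := by rintro rfl; exact hz (by rw [← hzn, zero_pow hn0])
  have hsyn := hs.map_ne_zero' hyn0
  have hszn := hs.map_ne_zero' hzn0
  obtain ⟨c₁, hc₁, e₁⟩ := hs.map_pow_proportional h1 h1' hnpos yn
  obtain ⟨c₂, hc₂, e₂⟩ := hs.map_pow_proportional h1 h1' hnpos zn
  obtain ⟨c₃, hc₃, e₃⟩ := hs.map_pow_proportional h1 h1' hnpos (yn * zn)
  obtain ⟨d, hd⟩ := IsAlgClosed.exists_pow_nat_eq (c₃ / (c₁ * c₂)) hnpos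
  have hinj : ∀ {c : k}, c ≠ 0 → algebraMap k F c ≠ 0 := fun hc ↦ by simpa using hc
  have hc₁' := hinj hc₁
  have hc₂' := hinj hc₂
  have hc₃' := hinj hc₃
  set r := algebraMap k F d * (s (yn * zn) / (s yn * s zn)) with hr
  have hrn : r ^ n = u := by
    rw [hr, mul_pow, ← map_pow, hd, hu, ← hyn, ← hzn, ← mul_pow, e₁, e₂, e₃, div_pow, mul_pow,
      map_div₀, map_mul]
    field_simp
  have hrt : Transcendental k r := fun h ↦ hut (hrn ▸ h.pow n)
  have hr0 : r ≠ 0 := fun h ↦ hrt (h ▸ isAlgebraic_zero)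
  have hζ0 : ∀ i, ζ ^ i ≠ 0 := fun i ↦ pow_ne_zero _ (hζ.ne_zero hn0)
  have hτ : ∀ i : Fin n, ∃ g : F' ≃ₐ[k'] F', μ g r = algebraMap k F (ζ ^ (i : ℕ)) * r := by
    intro i
    have h2 := transcendental_affine hrt (hζ0 i) 0
    rw [map_zero, add_zero] at h2
    obtain ⟨τ, hτ⟩ := exists_algEquiv_apply_eq h1 hrt h2
    exact ⟨μ.symm τ, by rwa [MulEquiv.apply_symm_apply]⟩
  choose g hg using hτ
  have hgt₀ : ∀ i, ∀ t ∈ ({t₀} : Set F'), g i t = t := by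
    rintro i t rfl
    refine hs.inj (transcendental_apply _ ht₀) ht₀ ?_
    have h3 : (ζ ^ (i : ℕ)) ^ n = 1 := by
      rw [← pow_mul, mul_comm, pow_mul, hζ.pow_eq_one, one_pow]
    rw [hs.map_apply, hst₀, ← hrn, map_pow, hg, mul_pow, ← map_pow, h3, map_one, one_mul]
  have hfix : ∀ h : F' ≃ₐ[k'] F', h y = y → h z = z → μ h r = r := by
    intro h hhy hhz
    obtain ⟨ζ₁, hζ₁, f₁⟩ := exists_pow_eq_algebraMap_of_pow_eq (k' := k') hn0 hyn0
      (show (h yn) ^ n = yn ^ n by rw [← map_pow, hyn, hhy])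
    obtain ⟨ζ₂, hζ₂, f₂⟩ := exists_pow_eq_algebraMap_of_pow_eq (k' := k') hn0 hzn0
      (show (h zn) ^ n = zn ^ n by rw [← map_pow, hzn, hhz])
    have f₃ : h (yn * zn) = algebraMap k' F' (ζ₁ * ζ₂) * (yn * zn) := by
      rw [map_mul, f₁, f₂, map_mul]; ring
    rw [hr, map_mul, AlgEquiv.commutes, map_div₀, map_mul, ← hs.map_apply, ← hs.map_apply,
      ← hs.map_apply, f₁, f₂, f₃, hs.map_smul, hs.map_smul, hs.map_smul, map_mul, map_mul]
    have hζ₁' : algebraMap k F (α ζ₁) ≠ 0 := by simpa using hζ₁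
    have hζ₂' : algebraMap k F (α ζ₂) ≠ 0 := by simpa using hζ₂
    field_simp
  have hinjT : Function.Injective fun i : Fin n ↦ (g i y, g i z) := by
    intro i j hij
    simp only [Prod.mk.injEq] at hij
    have h2 := hfix ((g j)⁻¹ * g i)
      ((AlgEquiv.symm_apply_eq _).2 hij.1) ((AlgEquiv.symm_apply_eq _).2 hij.2)
    rw [map_mul μ, map_inv μ] at h2
    have h3 : μ (g i) r = μ (g j) r := (AlgEquiv.symm_apply_eq _).1 h2
    rw [hg, hg] at h3
    exact Fin.ext (hζ.pow_inj i.2 j.2 ((algebraMap k F).injective (mul_right_cancel₀ hr0 h3)))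
  have hrange : Set.range (fun i : Fin n ↦ (g i y, g i z)) ⊆ T := by
    rintro _ ⟨i, rfl⟩
    exact ⟨⟨g i, hgt₀ i, rfl⟩, ⟨g i, hgt₀ i, rfl⟩⟩
  have hcard := Set.ncard_le_ncard hrange hfinT
  rw [← Set.image_univ, Set.ncard_image_of_injective _ hinjT, Set.ncard_univ, Nat.card_fin] at hcard
  omega

theorem exists_map_add_eq (hs : IsEquivariant μ α s) (h1 : Algebra.trdeg k F = 1)
    (h1' : Algebra.trdeg k' F' = 1) (y z : F') :
    ∃ A B : k, s (y + z) = algebraMap k F A * s y + algebraMap k F B * s z := by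
  by_cases hy : y = 0
  · exact ⟨0, 1, by simp [hy]⟩
  by_cases hz : z = 0
  · exact ⟨1, 0, by simp [hz]⟩
  by_cases hyz : y / z + 1 = 0
  · have : y + z = 0 := by field_simp at hyz; rwa [mul_zero] at hyz
    exact ⟨0, 0, by simp [this, hs.map_zero']⟩
  obtain ⟨C, hC, e⟩ := hs.map_mul_proportional h1 h1' hz hyz
  obtain ⟨D, hD, e'⟩ := hs.map_mul_proportional h1 h1' hz (div_ne_zero hy hz)
  rw [mul_div_cancel₀ _ hz] at e'
  have h2 : z * (y / z + 1) = y + z := by field_simp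
  have h3 : s (y / z + 1) = s (y / z) + 1 := by
    simpa using hs.map_affine 1 1 (y / z)
  have hD' : algebraMap k F D ≠ 0 := by simpa using hD
  refine ⟨C / D, C, ?_⟩
  rw [← h2, e, h3, e', map_div₀]
  field_simp

theorem map_add_of_linearIndependent (hs : IsEquivariant μ α s) (h1 : Algebra.trdeg k F = 1)
    (h1' : Algebra.trdeg k' F' = 1) {y z : F'}
    (h : ∀ a b c : k, algebraMap k F a * s y + algebraMap k F b * s z + algebraMap k F c = 0 →
      a = 0 ∧ b = 0 ∧ c = 0) : s (y + z) = s y + s z := by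
  have hadd : ∀ t, s (t + 1) = s t + 1 := fun t ↦ by simpa using hs.map_affine 1 1 t
  obtain ⟨A, B, e⟩ := hs.exists_map_add_eq h1 h1' y z
  obtain ⟨A₁, B₁, e₁⟩ := hs.exists_map_add_eq h1 h1' y (z + 1)
  obtain ⟨A₂, B₂, e₂⟩ := hs.exists_map_add_eq h1 h1' (y + 1) z
  rw [← add_assoc, hadd, hadd, e] at e₁
  rw [add_right_comm, hadd, hadd, e] at e₂
  have h₁ := h (A - A₁) (B - B₁) (1 - B₁) (by
    simp only [map_sub, map_one]; linear_combination e₁)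
  have h₂ := h (A - A₂) (B - B₂) (1 - A₂) (by
    simp only [map_sub, map_one]; linear_combination e₂)
  have hB : B = 1 := by linear_combination h₁.2.1 - h₁.2.2
  have hA : A = 1 := by linear_combination h₂.1 - h₂.2.2
  rw [e, hA, hB, map_one, one_mul, one_mul]

end IsEquivariant

end Reconstruction

section Reconstruction

variable {k F k' F' : Type*} [Field k] [Field F] [Field k'] [Field F'] [Algebra k F]
  [Algebra k' F']

namespace IsEquivariant

variable {μ : (F' ≃ₐ[k'] F') ≃* (F ≃ₐ[k] F)} {α : k' →+* k} {s : F' → F}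
  [IsAlgClosed k] [IsAlgClosed k'] [IsAlgClosed F] [IsAlgClosed F']

theorem map_add' (hs : IsEquivariant μ α s) (h1 : Algebra.trdeg k F = 1)
    (h1' : Algebra.trdeg k' F' = 1) {x : F} (hx : Transcendental k x) (y z : F') :
    s (y + z) = s y + s z := by
  have hconst : ∀ t (c : k'), s (t + algebraMap k' F' c) = s t + s (algebraMap k' F' c) := by
    intro t c
    rw [hs.map_algebraMap]
    simpa using hs.map_affine 1 c t
  by_cases hz : Transcendental k' z
  swap
  · obtain ⟨c, rfl⟩ := exists_algebraMap hz
    exact hconst y c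
  by_cases hy : Transcendental k' y
  swap
  · obtain ⟨c, rfl⟩ := exists_algebraMap hy
    rw [add_comm, hconst, add_comm]
  set V : Submodule k F := Submodule.span k {1, s y, s z, s (y + z)} with hV
  have hVfin : Module.Finite k V :=
    Module.Finite.span_of_finite k (by simp)
  obtain ⟨T, hT⟩ : ∃ T, T ∉ V := by
    by_contra! h
    have hV' : V = ⊤ := eq_top_iff.2 fun t _ ↦ h t
    have : Module.Finite k F := by
      have := hVfin
      rw [hV'] at this
      exact Module.Finite.equiv (Submodule.topEquiv : _ ≃ₗ[k] F)
    exact hx (Algebra.IsAlgebraic.isAlgebraic (R := k) x)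
  have m1 : ∀ c, algebraMap k F c ∈ V := fun c ↦ by
    rw [Algebra.algebraMap_eq_smul_one]
    exact V.smul_mem c (Submodule.subset_span (by simp))
  have my : s y ∈ V := Submodule.subset_span (by simp)
  have mz : s z ∈ V := Submodule.subset_span (by simp)
  have myz : s (y + z) ∈ V := Submodule.subset_span (by simp)
  have hmul : ∀ (c : k) {v}, v ∈ V → algebraMap k F c * v ∈ V := fun c v hv ↦ by
    rw [← Algebra.smul_def]
    exact V.smul_mem c hv
  have hTt : Transcendental k T := by
    rw [transcendental_iff_notMem_range]
    rintro ⟨c, rfl⟩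
    exact hT (m1 c)
  obtain ⟨t, ht, rfl⟩ := hs.surj hTt
  have key : ∀ u t', s u ∈ V → s t' ∉ V → s (u + t') = s u + s t' := by
    intro u t' hu ht'
    by_cases hut : Transcendental k' u
    swap
    · obtain ⟨c, rfl⟩ := exists_algebraMap hut
      rw [add_comm, hconst, add_comm]
    refine hs.map_add_of_linearIndependent h1 h1' fun a b c h ↦ ?_
    have hb : b = 0 := by
      by_contra hb
      refine ht' ?_
      have h2 := hmul b⁻¹ (V.neg_mem (V.add_mem (hmul a hu) (m1 c)))
      convert h2 using 1
      have hb' : algebraMap k F b ≠ 0 := by simpa using hb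
      rw [map_inv₀]
      field_simp
      linear_combination h
    subst hb
    have := eq_zero_of_quadratic (hs.transcendental hut) (a := 0) (b := a) (c := c)
      (by rw [← h]; simp)
    exact ⟨this.2.1, rfl, this.2.2⟩
  have e1 := key (y + z) t myz hT
  have e2 := key z t mz hT
  have e3 := key y (z + t) my (by
    rw [e2]
    exact fun h ↦ hT (by simpa using V.sub_mem h mz))
  rw [← add_assoc, e1, e2] at e3
  linear_combination e3

theorem map_mul' (hs : IsEquivariant μ α s) (h1 : Algebra.trdeg k F = 1)
    (h1' : Algebra.trdeg k' F' = 1) {x : F} (hx : Transcendental k x) (y z : F') :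
    s (y * z) = s y * s z := by
  by_cases hy : Transcendental k' y
  swap
  · obtain ⟨c, rfl⟩ := exists_algebraMap hy
    rw [hs.map_smul, hs.map_algebraMap]
  by_cases hz : z = 0
  · simp [hz, hs.map_zero']
  have hy0 : y ≠ 0 := fun h ↦ hy (h ▸ isAlgebraic_zero)
  have hy1 : y + 1 ≠ 0 := fun h ↦
    hy (by rw [eq_neg_of_add_eq_zero_left h]; exact isAlgebraic_one.neg)
  obtain ⟨c, -, e⟩ := hs.map_mul_proportional h1 h1' hy0 hz
  obtain ⟨c', -, e'⟩ := hs.map_mul_proportional h1 h1' hy1 hz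
  rw [add_mul, one_mul, hs.map_add' h1 h1' hx, e, hs.map_add' h1 h1' hx, hs.map_one'] at e'
  have hsz := hs.map_ne_zero' hz
  have h2 : algebraMap k F c * s y + 1 = algebraMap k F c' * (s y + 1) :=
    mul_right_cancel₀ hsz (by linear_combination e')
  have h3 := eq_zero_of_quadratic (hs.transcendental hy) (a := 0) (b := c - c') (c := 1 - c')
    (by simp only [map_zero, map_sub, map_one]; linear_combination h2)
  have hc : c = 1 := by linear_combination h3.2.1 - h3.2.2
  rw [e, hc, map_one, one_mul]

theorem exists_ringEquiv (hs : IsEquivariant μ α s) (h1 : Algebra.trdeg k F = 1)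
    (h1' : Algebra.trdeg k' F' = 1) {x : F} (hx : Transcendental k x) :
    ∃ σ : F' ≃+* F, σ '' Set.range (algebraMap k' F') = Set.range (algebraMap k F) ∧
      ∀ g t, σ (g t) = μ g (σ t) := by
  set f : F' →+* F :=
    { toFun := s
      map_zero' := hs.map_zero'
      map_one' := hs.map_one'
      map_add' := hs.map_add' h1 h1' hx
      map_mul' := hs.map_mul' h1 h1' hx } with hf
  have hsurj : Function.Surjective f := by
    intro u
    by_cases hu : Transcendental k u
    · obtain ⟨t, -, ht⟩ := hs.surj hu
      exact ⟨t, ht⟩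
    · obtain ⟨t, -, ht⟩ := hs.surj hx
      obtain ⟨c, rfl⟩ := exists_algebraMap hu
      have h2 := transcendental_affine hx one_ne_zero c
      rw [map_one, one_mul] at h2
      obtain ⟨t', -, ht'⟩ := hs.surj h2
      refine ⟨t' - t, ?_⟩
      rw [map_sub]
      change s t' - s t = _
      rw [ht, ht']
      ring
  refine ⟨RingEquiv.ofBijective f ⟨f.injective, hsurj⟩, ?_, fun g t ↦ hs.map_apply g t⟩
  ext u
  constructor
  · rintro ⟨_, ⟨c, rfl⟩, rfl⟩
    exact ⟨α c, (hs.map_algebraMap c).symm⟩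
  · rintro ⟨c, rfl⟩
    obtain ⟨t, ht⟩ := hsurj (algebraMap k F c)
    refine ⟨t, ?_, ht⟩
    by_contra htr
    rw [← transcendental_iff_notMem_range] at htr
    exact hs.transcendental htr (by
      rw [show s t = f t from rfl, ht]
      exact isAlgebraic_algebraMap c)

end IsEquivariant

end Reconstruction

section Transfer

theorem finite_image_of_finite_orbits {G X β : Type*} {A : Set G} {S : Set X} (hS : S.Finite)
    (φ : G → X → X) (f : G → β)
    (hf : ∀ g ∈ A, ∀ g' ∈ A, (∀ s ∈ S, φ g s = φ g' s) → f g = f g')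
    (horb : ∀ s ∈ S, {t | ∃ g ∈ A, φ g s = t}.Finite) : (f '' A).Finite := by
  have := hS.to_subtype
  have hfin : ((fun (g : G) (s : S) ↦ φ g s) '' A).Finite := by
    refine (Set.Finite.pi' fun s : S ↦ horb s s.2).subset ?_
    rintro _ ⟨g, hg, rfl⟩ s
    exact ⟨g, hg, rfl⟩
  obtain ⟨B, hBA, hB⟩ := Set.exists_subset_bijOn A (fun (g : G) (s : S) ↦ φ g s)
  have hBfin : B.Finite := hB.finite_iff_finite.2 hfin
  refine (hBfin.image f).subset ?_
  rintro _ ⟨g, hg, rfl⟩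
  obtain ⟨g', hg', e⟩ := hB.surjOn ⟨g, hg, rfl⟩
  exact ⟨g', hg', hf _ (hBA hg') _ hg fun s hs ↦ congrFun e ⟨s, hs⟩⟩

theorem isAlgebraic_of_finite_orbit {k F : Type*} [Field k] [Field F] [Algebra k F]
    (H : Subgroup (F ≃ₐ[k] F)) {z : F} (h : {t | ∃ g ∈ H, g z = t}.Finite) :
    IsAlgebraic (fixedField H) z := by
  classical
  set O := h.toFinset with hO
  have hmem : ∀ {t}, t ∈ O ↔ ∃ g ∈ H, g z = t := by simp [hO]
  set P : Polynomial F := ∏ t ∈ O, (Polynomial.X - Polynomial.C t) with hP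
  have hinv : ∀ g ∈ H, P.map (g : F →+* F) = P := by
    intro g hg
    rw [hP, Polynomial.map_prod]
    simp only [Polynomial.map_sub, Polynomial.map_X, Polynomial.map_C]
    refine Finset.prod_bij (fun t _ ↦ g t) ?_ (fun _ _ _ _ h ↦ g.injective h) ?_ fun _ _ ↦ rfl
    · intro t ht
      obtain ⟨g', hg', rfl⟩ := hmem.1 ht
      exact hmem.2 ⟨g * g', H.mul_mem hg hg', rfl⟩
    · intro t ht
      obtain ⟨g', hg', rfl⟩ := hmem.1 ht
      exact ⟨(g⁻¹ * g') z, hmem.2 ⟨_, H.mul_mem (H.inv_mem hg) hg', rfl⟩,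
        g.apply_symm_apply _⟩
  have hlift : P ∈ Polynomial.lifts (algebraMap (fixedField H) F) := by
    rw [Polynomial.lifts_iff_coeff_lifts]
    intro n
    refine ⟨⟨P.coeff n, fun g ↦ ?_⟩, rfl⟩
    have := congrArg (Polynomial.coeff · n) (hinv g g.2)
    rw [Polynomial.coeff_map] at this
    exact this
  obtain ⟨Q, hQ⟩ := (Polynomial.mem_lifts _).1 hlift
  refine ⟨Q, ?_, ?_⟩
  · rintro rfl
    rw [Polynomial.map_zero] at hQ
    exact (Polynomial.monic_prod_of_monic _ _ fun t _ ↦ Polynomial.monic_X_sub_C t).ne_zero hQ.symm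
  · rw [Polynomial.aeval_def, ← Polynomial.eval_map, hQ, hP, Polynomial.eval_prod]
    exact Finset.prod_eq_zero (hmem.2 ⟨1, H.one_mem, rfl⟩) (by simp)

variable {k F k' F' : Type*} [Field k] [Field F] [Field k'] [Field F'] [Algebra k F]
  [Algebra k' F']

theorem finite_orbit_of_continuous (f : (F ≃ₐ[k] F) →* (F' ≃ₐ[k'] F'))
    (hf : @Continuous _ _ (autTop k F) (autTop k' F') f) (A : Set F)
    [Algebra.IsAlgebraic (adjoin k A) F] (z : F') :
    {t | ∃ g : F ≃ₐ[k] F, (∀ s ∈ A, g s = s) ∧ f g z = t}.Finite := by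
  obtain ⟨S, hS, hSz⟩ := exists_finite_of_continuous f hf (Set.finite_singleton z)
  refine finite_image_of_finite_orbits (A := {g : F ≃ₐ[k] F | ∀ s ∈ A, g s = s}) hS
    (fun g ↦ g) (fun g ↦ f g z) ?_ ?_
  · intro g _ g' _ h
    have h2 := hSz (g'⁻¹ * g) (fun s hs ↦ (AlgEquiv.symm_apply_eq _).2 (h s hs)) z rfl
    rw [map_mul f, map_inv f] at h2
    exact (AlgEquiv.symm_apply_eq _).1 h2
  · exact fun s _ ↦ finite_orbit (Algebra.IsAlgebraic.isAlgebraic s)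

variable [IsAlgClosed k'] [IsAlgClosed F]

theorem exists_transcendenceBasis_stabilizer (h1 : Algebra.trdeg k F = 1) {x : F}
    (hx : Transcendental k x) (μ : (F' ≃ₐ[k'] F') ≃* (F ≃ₐ[k] F))
    (hμ : @Continuous _ _ (autTop k' F') (autTop k F) μ)
    (hμ' : @Continuous _ _ (autTop k F) (autTop k' F') μ.symm) :
    ∃ Y : Set F', Y.Nonempty ∧ IsTranscendenceBasis k' ((↑) : Y → F') ∧
      ∃ w : F, Transcendental k w ∧ ∀ g, (∀ y ∈ Y, g y = y) ↔ μ g w = w := by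
  have halg := isAlgebraic_adjoin_simple h1 hx
  set V : Subgroup (F' ≃ₐ[k'] F') :=
    (MulAction.stabilizer (F ≃ₐ[k] F) x).comap μ.toMonoidHom with hV
  have hVmem : ∀ {g}, g ∈ V ↔ μ g x = x := Iff.rfl
  have hKalg : Algebra.IsAlgebraic (fixedField V) F' := by
    refine ⟨fun z ↦ isAlgebraic_of_finite_orbit V ?_⟩
    refine (finite_orbit_of_continuous (μ.symm : (F ≃ₐ[k] F) →* (F' ≃ₐ[k'] F')) hμ' {x} z).subset ?_
    rintro _ ⟨g, hg, rfl⟩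
    exact ⟨μ g, by simpa using hVmem.1 hg, by simp⟩
  have hK : Algebra.adjoin k' (fixedField V : Set F') = (fixedField V).toSubalgebra :=
    Algebra.adjoin_eq (fixedField V).toSubalgebra
  have : Algebra.IsAlgebraic (Algebra.adjoin k' (fixedField V : Set F')) F' := by
    rw [hK]; exact hKalg
  obtain ⟨Y, hYK, hY⟩ := exists_isTranscendenceBasis_subset (R := k') (fixedField V : Set F')
  have hYalg := hY.isAlgebraic_field
  rw [Subtype.range_coe] at hYalg
  refine ⟨Y, ?_, hY, ?_⟩
  · by_contra hYe
    rw [Set.not_nonempty_iff_eq_empty] at hYe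
    have htriv : ∀ g : F' ≃ₐ[k'] F', g = 1 := by
      intro g
      ext t
      have : IsEmpty Y := Set.isEmpty_coe_sort.2 hYe
      have halg' := hY.isEmpty_iff_isAlgebraic.1 this
      obtain ⟨c, rfl⟩ := IsEquivariant.exists_algebraMap
        (not_not.2 (halg'.isAlgebraic t) : ¬ Transcendental k' t)
      exact g.commutes c
    obtain ⟨g, hg⟩ := exists_algEquiv_apply_eq h1 hx (transcendental_affine hx one_ne_zero 1)
    have h2 := htriv (μ.symm g)
    rw [EmbeddingLike.map_eq_one_iff] at h2
    rw [h2] at hg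
    simp at hg
  · set H : Subgroup (F ≃ₐ[k] F) :=
      (fixingSubgroup (F' ≃ₐ[k'] F') Y).map μ.toMonoidHom with hH
    have hmem : ∀ g, μ g ∈ H ↔ ∀ y ∈ Y, g y = y := by
      intro g
      rw [hH, Subgroup.mem_map_equiv, MulEquiv.symm_apply_apply, _root_.mem_fixingSubgroup_iff]
      rfl
    have hst : ∀ g, g x = x → g ∈ H := by
      intro g hg
      obtain ⟨g, rfl⟩ := μ.surjective g
      rw [hmem]
      exact fun y hy ↦ hYK hy ⟨g, hg⟩
    have hfin : {t | ∃ g ∈ H, g x = t}.Finite := by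
      refine (finite_orbit_of_continuous μ.toMonoidHom hμ Y x).subset ?_
      rintro _ ⟨g, hg, rfl⟩
      obtain ⟨g, rfl⟩ := μ.surjective g
      exact ⟨g, (hmem g).1 hg, rfl⟩
    obtain ⟨w, hw, hHw⟩ := exists_stabilizer_eq h1 hx H hst hfin
    exact ⟨w, hw, fun g ↦ by rw [← hmem, hHw]⟩

end Transfer

section AffineFamily

variable {k F k' : Type*} [Field k] [Field F] [Field k'] [Algebra k F]

theorem apply_eq_apply_of_mem_adjoin {w t : F} {g g' : F ≃ₐ[k] F} (ht : t ∈ k⟮w⟯)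
    (h : g w = g' w) : g t = g' t := by
  have h2 : ∀ s ∈ ({w} : Set F), (g'⁻¹ * g) s = s := by
    rintro s rfl
    exact (AlgEquiv.symm_apply_eq _).2 h
  exact (AlgEquiv.symm_apply_eq _).1 (apply_eq_of_mem_adjoin h2 ht)

/-- A family of automorphisms whose action on `w` is, faithfully, that of the opposite of the
affine group of `k'`. -/
structure IsAffineFamily (P : k' → k' → (F ≃ₐ[k] F)) (w : F) : Prop where
  mul : ∀ {a b c d}, a ≠ 0 → c ≠ 0 → P a b (P c d w) = P (a * c) (b * c + d) w
  inj : ∀ {a b c d}, a ≠ 0 → c ≠ 0 → P a b w = P c d w → a = c ∧ b = d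

namespace IsAffineFamily

variable {P : k' → k' → (F ≃ₐ[k] F)} {w : F}

theorem of_adjoin_eq (hP : IsAffineFamily P w) {z : F} (h : k⟮z⟯ = k⟮w⟯) : IsAffineFamily P z where
  mul {a b c d} ha hc := apply_eq_apply_of_mem_adjoin (g := P a b * P c d)
    (h ▸ mem_adjoin_simple_self k z) (hP.mul ha hc)
  inj ha hc e := hP.inj ha hc
    (apply_eq_apply_of_mem_adjoin (h.symm ▸ mem_adjoin_simple_self k w) e)

section Frobenius

variable (q : ℕ) [ExpChar k q] [ExpChar F q] [PerfectRing k q] [PerfectRing F q]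

theorem adjoin_mul_apply {g g' : F ≃ₐ[k] F} {m n : ℤ}
    (h : k⟮g w⟯ = k⟮frobPow F q m w⟯) (h' : k⟮g' w⟯ = k⟮frobPow F q n w⟯) :
    k⟮g (g' w)⟯ = k⟮frobPow F q (m + n) w⟯ := by
  have h2 := adjoin_apply g h'
  have h3 : g (frobPow F q n w) = frobPow F q n (g w) :=
    map_frobPow q ((g : F ≃+* F) : F →+* F) n w
  rw [h2, h3, adjoin_frobPow q n h, ← frobPow_add, add_comm]

theorem adjoin_apply_eq [IsAlgClosed k'] (hP : IsAffineFamily P w) (hw : Transcendental k w)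
    (hN : ∀ a b, a ≠ 0 → ∃ n : ℤ, k⟮P a b w⟯ = k⟮frobPow F q n w⟯) {a : k'} (ha : a ≠ 0) (b : k') :
    k⟮P a b w⟯ = k⟮w⟯ := by
  choose! N hN using hN
  by_cases hq : q = 1
  · subst hq
    obtain ⟨m, h | h⟩ := (N a b).eq_nat_or_neg
    · rw [hN a b ha, h, frobPow_natCast, one_pow, pow_one]
    · have h2 := frobPow_neg_apply 1 (m : ℤ) w
      rw [frobPow_natCast, one_pow, pow_one] at h2
      rw [hN a b ha, h, h2]
  have hadd : ∀ a b c d, a ≠ 0 → c ≠ 0 → N (a * c) (b * c + d) = N a b + N c d := by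
    intro a b c d ha hc
    have h2 := adjoin_mul_apply q (hN a b ha) (hN c d hc)
    rw [hP.mul ha hc, hN _ _ (mul_ne_zero ha hc)] at h2
    exact (eq_of_adjoin_frobPow_eq q hw h2).resolve_left hq
  have htrans : ∀ c, c ≠ 0 → N 1 c = N 1 1 := by
    intro c hc
    have hc' := inv_ne_zero hc
    have h2 := hadd c⁻¹ 0 1 1 hc' one_ne_zero
    have h3 := hadd 1 c c⁻¹ 0 one_ne_zero hc'
    rw [mul_inv_cancel₀ hc, one_mul, add_zero] at h3
    rw [zero_mul, zero_add, mul_one] at h2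
    omega
  obtain ⟨t, ht0, ht1⟩ : ∃ t : k', t ≠ 0 ∧ t + 1 ≠ 0 := by
    obtain ⟨r, h0, h1⟩ := exists_ne_zero_ne_one k'
    exact ⟨r - 1, sub_ne_zero.2 h1, by simpa using h0⟩
  have hN1 : N 1 1 = 0 := by
    have h2 := hadd 1 t 1 1 one_ne_zero one_ne_zero
    rw [mul_one, mul_one, htrans _ ht1, htrans _ ht0] at h2
    omega
  have hN0 : N 1 0 = 0 := by
    have h2 := hadd 1 0 1 0 one_ne_zero one_ne_zero
    rw [mul_one, zero_mul, add_zero] at h2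
    omega
  have hNb : N 1 b = 0 := by
    by_cases hb : b = 0
    · rw [hb, hN0]
    · rw [htrans b hb, hN1]
  have hpow : ∀ (c : k'), c ≠ 0 → ∀ m : ℕ, N (c ^ m) 0 = m * N c 0 := by
    intro c hc m
    induction m with
    | zero => simp [hN0]
    | succ m ih =>
      have h2 := hadd (c ^ m) 0 c 0 (pow_ne_zero m hc) hc
      rw [← pow_succ, zero_mul, add_zero, ih] at h2
      rw [h2]; push_cast; ring
  have hNa : N a 0 = 0 := by
    obtain ⟨c, hc⟩ := IsAlgClosed.exists_pow_nat_eq a (Nat.succ_pos (N a 0).natAbs)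
    have hc0 : c ≠ 0 := by
      rintro rfl
      exact ha (by rw [← hc, zero_pow (Nat.succ_ne_zero _)])
    have h2 := hpow c hc0 ((N a 0).natAbs + 1)
    rw [show c ^ ((N a 0).natAbs + 1) = a from hc] at h2
    exact Int.eq_zero_of_abs_lt_dvd (Dvd.intro _ h2.symm) (by push_cast; omega)
  have h2 := hadd a 0 1 b ha one_ne_zero
  rw [mul_one, zero_mul, zero_add, hNa, hNb] at h2
  rw [hN a b ha, h2, add_zero, frobPow_zero]

end Frobenius

end IsAffineFamily

end AffineFamily

section AffineFamily

variable {k F k' : Type*} [Field k] [Field F] [Field k'] [Algebra k F]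

theorem adjoin_simple_eq_of_mem {z w : F} (h : z ∈ k⟮w⟯) (h' : w ∈ k⟮z⟯) : k⟮z⟯ = k⟮w⟯ :=
  le_antisymm (adjoin_simple_le_iff.2 h) (adjoin_simple_le_iff.2 h')

theorem adjoin_affine {a : k} (ha : a ≠ 0) (b : k) (w : F) :
    k⟮algebraMap k F a * w + algebraMap k F b⟯ = k⟮w⟯ := by
  refine adjoin_simple_eq_of_mem ?_ ?_
  · exact add_mem (mul_mem (IntermediateField.algebraMap_mem _ a) (mem_adjoin_simple_self k w))
      (IntermediateField.algebraMap_mem _ b)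
  · have ha' : algebraMap k F a ≠ 0 := by simpa using ha
    have h2 : algebraMap k F a⁻¹ * ((algebraMap k F a * w + algebraMap k F b) - algebraMap k F b) =
        w := by
      rw [map_inv₀]; field_simp; ring
    have h3 := mul_mem
      (IntermediateField.algebraMap_mem k⟮algebraMap k F a * w + algebraMap k F b⟯ a⁻¹)
      (sub_mem (mem_adjoin_simple_self k (algebraMap k F a * w + algebraMap k F b))
        (IntermediateField.algebraMap_mem _ b))
    rwa [h2] at h3

theorem exists_affine_coordinate [IsAlgClosed k] {w : F} (hw : Transcendental k w)
    {g : F ≃ₐ[k] F} (hg : k⟮g w⟯ = k⟮w⟯) : ∃ z, k⟮z⟯ = k⟮w⟯ ∧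
      ∃ A B : k, g z = algebraMap k F A * z + algebraMap k F B := by
  obtain ⟨a, b, c, d, hdet, e⟩ := exists_moebius_of_adjoin_eq hw hg
  by_cases hc : c = 0
  · subst hc
    have hd : d ≠ 0 := by rintro rfl; simp at hdet
    have hd' : algebraMap k F d ≠ 0 := by simpa using hd
    refine ⟨w, rfl, a / d, b / d, ?_⟩
    rw [map_div₀, map_div₀]
    field_simp
    simpa using e
  · obtain ⟨p, hp⟩ := IsAlgClosed.exists_root
      (Polynomial.C c * Polynomial.X ^ 2 + Polynomial.C (d - a) * Polynomial.X + Polynomial.C (-b))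
      (by rw [Polynomial.degree_quadratic hc]; decide)
    simp only [Polynomial.IsRoot, Polynomial.eval_add, Polynomial.eval_mul, Polynomial.eval_C,
      Polynomial.eval_pow, Polynomial.eval_X] at hp
    have hacp : a - c * p ≠ 0 := by
      intro h
      refine hdet ?_
      have h2 : a = c * p := sub_eq_zero.1 h
      subst h2
      linear_combination c * hp
    have hacp' : algebraMap k F (a - c * p) ≠ 0 :=
      (map_ne_zero_iff _ (algebraMap k F).injective).2 hacp
    have hwp : w - algebraMap k F p ≠ 0 := by
      have := linear_ne_zero hw (c := 1) (d := -p) (Or.inl one_ne_zero)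
      simpa [sub_eq_add_neg] using this
    have hgwp : g w - algebraMap k F p ≠ 0 := by
      intro h
      refine hwp (g.injective ?_)
      rw [map_sub, AlgEquiv.commutes, h, map_zero]
    refine ⟨(w - algebraMap k F p)⁻¹, adjoin_simple_eq_of_mem ?_ ?_, (c * p + d) / (a - c * p),
      c / (a - c * p), ?_⟩
    · exact inv_mem (sub_mem (mem_adjoin_simple_self k w) (IntermediateField.algebraMap_mem _ p))
    · have h2 := add_mem (inv_mem (mem_adjoin_simple_self k (w - algebraMap k F p)⁻¹))
        (IntermediateField.algebraMap_mem k⟮(w - algebraMap k F p)⁻¹⟯ p)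
      rwa [inv_inv, sub_add_cancel] at h2
    · rw [map_inv₀, map_sub, AlgEquiv.commutes, map_div₀, map_div₀]
      have hp' := congrArg (algebraMap k F) hp
      have hD : algebraMap k F (a - c * p) =
          algebraMap k F a - algebraMap k F c * algebraMap k F p := by rw [map_sub, map_mul]
      generalize algebraMap k F (a - c * p) = D at hacp' hD ⊢
      simp only [map_sub, map_add, map_mul, map_pow, map_neg, map_zero] at hp' ⊢
      field_simp
      rw [hD]
      linear_combination hp' - e

namespace IsAffineFamily

variable {P : k' → k' → (F ≃ₐ[k] F)} {w : F}

theorem apply_one_zero (hP : IsAffineFamily P w) : P 1 0 w = w := by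
  have h2 := hP.mul (b := 0) (d := 0) one_ne_zero one_ne_zero
  rw [mul_one, mul_one, add_zero] at h2
  exact (P 1 0).injective h2

theorem comm_apply (hP : IsAffineFamily P w) {a : k'} (ha : a ≠ 0) (b : k') :
    P 1 a⁻¹ (P a b w) = P a b (P 1 1 w) := by
  rw [hP.mul one_ne_zero ha, hP.mul ha one_ne_zero, inv_mul_cancel₀ ha, one_mul, mul_one, mul_one,
    add_comm]

theorem false_of_apply_eq_smul [Infinite k'] (hP : IsAffineFamily P w) (hw : Transcendental k w)
    (hadj : ∀ a b, a ≠ 0 → k⟮P a b w⟯ = k⟮w⟯) {A : k}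
    (hA : P 1 1 w = algebraMap k F A * w) : False := by
  have hw0 : w ≠ 0 := fun h ↦ hw (h ▸ isAlgebraic_zero)
  have hP0 : ∀ a b, P a b w ≠ 0 := fun a b ↦ (map_ne_zero_iff _ (P a b).injective).2 hw0
  have hA1 : A - 1 ≠ 0 := by
    intro h
    rw [sub_eq_zero.1 h, map_one, one_mul] at hA
    have := hP.inj one_ne_zero one_ne_zero (hA.trans hP.apply_one_zero.symm)
    exact one_ne_zero this.2
  have hA0 : A ≠ 0 := by
    rintro rfl
    exact hP0 1 1 (by rw [hA, map_zero, zero_mul])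
  have hcases : ∀ b, (∃ r, P 1 b w = algebraMap k F r * w) ∨
      ∃ t, P 1 b w * w = algebraMap k F t := by
    intro b
    obtain ⟨α, β, γ, δ, hdet, e⟩ := exists_moebius_of_adjoin_eq hw (hadj 1 b one_ne_zero)
    have h2 := congrArg (P 1 1) e
    have h3 := hP.comm_apply one_ne_zero b
    rw [inv_one] at h3
    simp only [map_mul, map_add, AlgEquiv.commutes, h3, hA] at h2
    have h4 := eq_zero_of_quadratic hw (a := α * γ * A * (A - 1)) (b := β * γ * (A ^ 2 - 1))
      (c := β * δ * (A - 1)) (by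
        simp only [map_mul, map_sub, map_one, map_pow]
        linear_combination (algebraMap k F γ * w + algebraMap k F δ) * h2 -
          (algebraMap k F A * (algebraMap k F γ * algebraMap k F A * w + algebraMap k F δ)) * e)
    by_cases hα : α = 0
    · right
      subst hα
      have hβ : β ≠ 0 := by rintro rfl; simp at hdet
      have hγ : γ ≠ 0 := by rintro rfl; simp at hdet
      have hδ : δ = 0 := by simpa [hβ, hA1] using h4.2.2
      subst hδ
      have hγ' : algebraMap k F γ ≠ 0 := by simpa using hγ
      refine ⟨β / γ, ?_⟩
      rw [map_div₀]
      field_simp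
      simp only [map_zero, add_zero, zero_mul, zero_add] at e
      linear_combination e
    · left
      have hγ : γ = 0 := by simpa [hα, hA1, hA0] using h4.1
      subst hγ
      have hδ : δ ≠ 0 := by rintro rfl; simp at hdet
      have hβ : β = 0 := by simpa [hδ, hA1] using h4.2.2
      subst hβ
      have hδ' : algebraMap k F δ ≠ 0 := by simpa using hδ
      refine ⟨α / δ, ?_⟩
      rw [map_div₀]
      field_simp
      simp only [map_zero, add_zero, zero_mul, zero_add] at e
      linear_combination e
  have hdiag : ∀ b, (∃ r, P 1 b w = algebraMap k F r * w) → b = 0 ∨ b = 1 ∨ b = -1 := by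
    rintro b ⟨r, hr⟩
    by_cases hb : b = 0
    · exact Or.inl hb
    right
    have hb' := inv_ne_zero hb
    have hr0 : r ≠ 0 := by
      rintro rfl
      exact hP0 1 b (by rw [hr, map_zero, zero_mul])
    obtain ⟨α, β, γ, δ, hdet, e⟩ := exists_moebius_of_adjoin_eq hw (hadj b⁻¹ 0 hb')
    have h2 := congrArg (P 1 b) e
    have h3 := hP.comm_apply hb' 0
    rw [inv_inv] at h3
    simp only [map_mul, map_add, AlgEquiv.commutes, h3, hA, hr] at h2
    have h4 := eq_zero_of_quadratic hw (a := α * γ * r * (A - 1))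
      (b := A * α * δ + A * β * γ * r - α * r * δ - β * γ)
      (c := β * δ * (A - 1)) (by
        simp only [map_mul, map_sub, map_one, map_add]
        linear_combination (algebraMap k F γ * w + algebraMap k F δ) * h2 -
          (algebraMap k F A * (algebraMap k F γ * algebraMap k F r * w + algebraMap k F δ)) * e)
    by_cases hα : α = 0
    · right
      subst hα
      have hβ : β ≠ 0 := by rintro rfl; simp at hdet
      have hγ : γ ≠ 0 := by rintro rfl; simp at hdet
      have h5 : A * r = 1 := by
        refine mul_left_cancel₀ (mul_ne_zero hβ hγ) ?_
        linear_combination h4.2.1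
      have h6 : P 1 b (P 1 1 w) = P 1 0 w := by
        rw [hA, map_mul, AlgEquiv.commutes, hr, ← mul_assoc, ← map_mul, h5, map_one, one_mul,
          hP.apply_one_zero]
      rw [hP.mul one_ne_zero one_ne_zero] at h6
      have h7 := (hP.inj (by simp) one_ne_zero h6).2
      linear_combination h7
    · left
      have hγ : γ = 0 := by simpa [hα, hA1, hr0] using h4.1
      subst hγ
      have hδ : δ ≠ 0 := by rintro rfl; simp at hdet
      have h5 : A = r := by
        refine mul_left_cancel₀ (mul_ne_zero hα hδ) ?_
        linear_combination h4.2.1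
      exact (hP.inj one_ne_zero one_ne_zero (hr.trans (by rw [hA, h5]))).2
  classical
  have hanti : ∀ b, b ≠ 0 → b ≠ 1 → b ≠ -1 → ∃ t, P 1 b w * w = algebraMap k F t := by
    intro b h0 h1 h2
    refine (hcases b).resolve_left fun h ↦ ?_
    have := hdiag b h
    tauto
  obtain ⟨b, hb⟩ := Infinite.exists_notMem_finset ({0, 1, -1} : Finset k')
  obtain ⟨b', hb'⟩ := Infinite.exists_notMem_finset ({0, 1, -1, -b, 1 - b, -1 - b} : Finset k')
  simp only [Finset.mem_insert, Finset.mem_singleton, not_or] at hb hb'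
  obtain ⟨t, ht⟩ := hanti b hb.1 hb.2.1 hb.2.2
  obtain ⟨t', ht'⟩ := hanti b' hb'.1 hb'.2.1 hb'.2.2.1
  have ht0 : algebraMap k F t ≠ 0 := ht ▸ mul_ne_zero (hP0 1 b) hw0
  have h2 := congrArg (P 1 b) ht'
  rw [map_mul, AlgEquiv.commutes, hP.mul one_ne_zero one_ne_zero, mul_one, mul_one] at h2
  have h3 := hdiag (b + b') ⟨t' / t, by
    rw [map_div₀]
    field_simp
    linear_combination w * h2 - P 1 (b + b') w * ht⟩
  rcases h3 with h | h | h
  · exact hb'.2.2.2.1 (by linear_combination h)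
  · exact hb'.2.2.2.2.1 (by linear_combination h)
  · exact hb'.2.2.2.2.2 (by linear_combination h)

end IsAffineFamily

end AffineFamily

section AffineFamily

variable {k F k' : Type*} [Field k] [Field F] [Field k'] [Algebra k F]

theorem exists_affine_of_translation {z w : F} (hw : Transcendental k w) {g : F ≃ₐ[k] F} {e : k}
    (hgw : g w = w + algebraMap k F e) (hgz : g z = z + 1) (h : k⟮z⟯ = k⟮w⟯) :
    ∃ A B : k, A ≠ 0 ∧ z = algebraMap k F A * w + algebraMap k F B := by
  obtain ⟨α, β, γ, δ, hdet, e₁⟩ := exists_moebius_of_adjoin_eq hw h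
  have h2 := congrArg g e₁
  simp only [map_mul, map_add, AlgEquiv.commutes, hgz, hgw] at h2
  have h4 := eq_zero_of_quadratic hw (a := γ ^ 2)
    (b := γ * δ + γ * (γ * e + δ) + α * (γ * e + δ) + β * γ - α * δ - γ * (α * e + β))
    (c := (β + δ) * (γ * e + δ) - (α * e + β) * δ) (by
      simp only [map_mul, map_sub, map_add, map_pow]
      linear_combination (algebraMap k F γ * w + algebraMap k F δ) * h2 -
        (algebraMap k F γ * (w + algebraMap k F e) + algebraMap k F δ) * e₁)
  have hγ : γ = 0 := by simpa using h4.1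
  subst hγ
  have hδ : δ ≠ 0 := by rintro rfl; simp at hdet
  have hα : α ≠ 0 := by rintro rfl; simp at hdet
  have hδ' : algebraMap k F δ ≠ 0 := by simpa using hδ
  refine ⟨α / δ, β / δ, div_ne_zero hα hδ, ?_⟩
  rw [map_div₀, map_div₀]
  field_simp
  simp only [map_zero, zero_mul, zero_add] at e₁
  linear_combination e₁

theorem affine_inj {w : F} (hw : Transcendental k w) {a b c d : k}
    (h : algebraMap k F a * w + algebraMap k F b = algebraMap k F c * w + algebraMap k F d) :
    a = c ∧ b = d := by
  have := eq_zero_of_quadratic hw (a := 0) (b := a - c) (c := b - d) (by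
    simp only [map_zero, map_sub]; linear_combination h)
  exact ⟨sub_eq_zero.1 this.2.1, sub_eq_zero.1 this.2.2⟩

theorem transcendental_of_adjoin_eq {z w : F} (hw : Transcendental k w) (h : k⟮z⟯ = k⟮w⟯) :
    Transcendental k z := fun hz ↦ by
  have h2 : k⟮z⟯ ≤ algebraicClosure k F :=
    adjoin_simple_le_iff.2 (mem_algebraicClosure_iff.2 hz)
  exact hw (mem_algebraicClosure_iff.1 (h2 (h ▸ mem_adjoin_simple_self k w)))

namespace IsAffineFamily

variable {P : k' → k' → (F ≃ₐ[k] F)} {w : F}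

theorem exists_translation_coordinate [IsAlgClosed k] [Infinite k'] (hP : IsAffineFamily P w)
    (hw : Transcendental k w) (hadj : ∀ a b, a ≠ 0 → k⟮P a b w⟯ = k⟮w⟯) :
    ∃ z, k⟮z⟯ = k⟮w⟯ ∧ P 1 1 z = z + 1 := by
  obtain ⟨z, hz, A, B, e⟩ := exists_affine_coordinate hw (hadj 1 1 one_ne_zero)
  have hzt := transcendental_of_adjoin_eq hw hz
  by_cases hA : A = 1
  · have hB : B ≠ 0 := by
      rintro rfl
      have hPz := hP.of_adjoin_eq hz
      have := (hPz.inj one_ne_zero one_ne_zero ((e.trans (by simp [hA])).trans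
        hPz.apply_one_zero.symm)).2
      exact one_ne_zero this
    have hB' : algebraMap k F B ≠ 0 := by simpa using hB
    have h2 := adjoin_affine (inv_ne_zero hB) 0 z
    refine ⟨_, h2.trans hz, ?_⟩
    rw [map_add, map_mul, AlgEquiv.commutes, AlgEquiv.commutes, e, hA, map_inv₀, map_one, map_zero]
    field_simp
    ring
  · have hA1 : A - 1 ≠ 0 := sub_ne_zero.2 hA
    have hA1' : algebraMap k F A - 1 ≠ 0 := by
      rw [← map_one (algebraMap k F), ← map_sub]
      exact (map_ne_zero_iff _ (algebraMap k F).injective).2 hA1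
    have h2 := (adjoin_affine one_ne_zero (B / (A - 1)) z).trans hz
    refine ((hP.of_adjoin_eq h2).false_of_apply_eq_smul (A := A) (transcendental_of_adjoin_eq hw h2)
      (fun a b ha ↦ ?_) ?_).elim
    · rw [adjoin_apply (P a b) h2, hadj a b ha, h2]
    · rw [map_add, map_mul, AlgEquiv.commutes, AlgEquiv.commutes, e, map_div₀, map_sub, map_one]
      field_simp
      ring

theorem exists_ringHom [IsAlgClosed k] [Infinite k'] (hP : IsAffineFamily P w)
    (hw : Transcendental k w) (hadj : ∀ a b, a ≠ 0 → k⟮P a b w⟯ = k⟮w⟯) :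
    ∃ z, k⟮z⟯ = k⟮w⟯ ∧ ∃ α : k' →+* k, ∀ a b, a ≠ 0 →
      P a b z = algebraMap k F (α a) * z + algebraMap k F (α b) := by
  obtain ⟨u, hu, hu1⟩ := hP.exists_translation_coordinate hw hadj
  have hut := transcendental_of_adjoin_eq hw hu
  have hPu := hP.of_adjoin_eq hu
  have hadju : ∀ a b, a ≠ 0 → k⟮P a b u⟯ = k⟮u⟯ := fun a b ha ↦ by
    rw [adjoin_apply (P a b) hu, hadj a b ha, hu]
  have htr : ∀ c, c ≠ 0 → ∃ e : k, P 1 c u = u + algebraMap k F e := by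
    intro c hc
    have h3 := hPu.comm_apply one_ne_zero c
    rw [hu1, map_add, map_one, inv_one] at h3
    obtain ⟨A, B, -, e⟩ := exists_affine_of_translation (e := 1) hut (by rw [hu1, map_one]) h3
      (hadju 1 c one_ne_zero)
    have h4 := congrArg (P 1 1) e
    rw [h3, map_add, map_mul, AlgEquiv.commutes, AlgEquiv.commutes, hu1, e] at h4
    have h5 := affine_inj hut (a := A) (b := B + 1) (c := A) (d := A + B) (by
      simp only [map_add, map_one]; linear_combination h4)
    have hA : A = 1 := by linear_combination -h5.2
    exact ⟨B, by rw [e, hA, map_one, one_mul]⟩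
  have haff : ∀ a b, a ≠ 0 → ∃ A B : k, A ≠ 0 ∧
      P a b u = algebraMap k F A * u + algebraMap k F B := by
    intro a b ha
    have h3 := hPu.comm_apply ha b
    rw [hu1, map_add, map_one] at h3
    obtain ⟨e, he⟩ := htr a⁻¹ (inv_ne_zero ha)
    exact exists_affine_of_translation hut he h3 (hadju a b ha)
  choose! A B hA hAB using haff
  have hmul : ∀ {a b c d}, a ≠ 0 → c ≠ 0 → A (a * c) (b * c + d) = A c d * A a b ∧
      B (a * c) (b * c + d) = A c d * B a b + B c d := by
    intro a b c d ha hc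
    have h2 := hPu.mul (b := b) (d := d) ha hc
    rw [hAB _ _ (mul_ne_zero ha hc), hAB c d hc, map_add, map_mul, AlgEquiv.commutes,
      AlgEquiv.commutes, hAB a b ha] at h2
    refine affine_inj hut ?_
    rw [← h2]
    simp only [map_add, map_mul]
    ring
  have h11 : A 1 1 = 1 ∧ B 1 1 = 1 := by
    refine affine_inj hut ?_
    rw [← hAB 1 1 one_ne_zero, hu1, map_one, one_mul]
  have hA1 : ∀ b, A 1 b = 1 := by
    intro b
    have h2 := (hmul (b := b) (d := 1) one_ne_zero one_ne_zero).2
    have h3 := (hmul (b := 1) (d := b) one_ne_zero one_ne_zero).2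
    rw [mul_one, mul_one, h11.1, h11.2] at h2
    rw [mul_one, h11.2, add_comm 1 b, h2] at h3
    linear_combination -h3
  have hAa : ∀ {a}, a ≠ 0 → ∀ b, A a b = A a 0 ∧ B a b = B a 0 + B 1 b := by
    intro a ha b
    have h2 := hmul (b := 0) (d := b) ha one_ne_zero
    rw [mul_one, zero_mul, zero_add, hA1, one_mul, one_mul] at h2
    exact h2
  have hB1 : ∀ {a}, a ≠ 0 → B 1 a = A a 0 := by
    intro a ha
    have h2 := (hmul (b := 1) (d := 0) one_ne_zero ha).2
    rw [one_mul, add_zero, h11.2, (hAa ha a).2] at h2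
    linear_combination h2
  have hB10 : B 1 0 = 0 := by
    have h2 := (hmul (b := 0) (d := 0) one_ne_zero one_ne_zero).2
    rw [mul_one, zero_mul, zero_add, hA1, one_mul] at h2
    linear_combination -h2
  obtain ⟨a₀, ha₀, ha₁⟩ := exists_ne_zero_ne_one k'
  have hAa₀ : A a₀ 0 - 1 ≠ 0 := by
    intro h
    refine ha₁ (hPu.inj (a := 1) (c := 1) one_ne_zero one_ne_zero ?_).2
    rw [hAB 1 a₀ one_ne_zero, hAB 1 1 one_ne_zero, hA1, hA1, hB1 ha₀, h11.2, sub_eq_zero.1 h]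
  have hcomm : ∀ {a}, a ≠ 0 → A a₀ 0 * B a 0 + B a₀ 0 = A a 0 * B a₀ 0 + B a 0 := by
    intro a ha
    have h2 := (hmul (b := 0) (d := 0) ha ha₀).2
    have h3 := (hmul (b := 0) (d := 0) ha₀ ha).2
    rw [zero_mul, zero_add] at h2 h3
    rw [← h2, ← h3, mul_comm]
  set e := B a₀ 0 / (A a₀ 0 - 1) with he
  have he' : e * (A a₀ 0 - 1) = B a₀ 0 := div_mul_cancel₀ _ hAa₀
  have hBa : ∀ {a}, a ≠ 0 → B a 0 = (A a 0 - 1) * e := by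
    intro a ha
    refine mul_left_cancel₀ hAa₀ ?_
    linear_combination hcomm ha + (1 - A a 0) * he'
  have hβ : ∀ {a b}, a ≠ 0 → B 1 (a * b) = B 1 a * B 1 b := by
    intro a b ha
    have h2 := (hmul (b := b) (d := 0) one_ne_zero ha).2
    rw [one_mul, add_zero, (hAa ha _).2, mul_comm] at h2
    rw [hB1 ha]
    linear_combination h2
  have h2 := adjoin_affine one_ne_zero e u
  refine ⟨_, h2.trans hu, {
    toFun := B 1
    map_zero' := hB10
    map_one' := h11.2
    map_add' := ?_
    map_mul' := ?_ }, ?_⟩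
  · intro a b
    by_cases ha : a = 0
    · rw [ha, zero_mul, hB10, zero_mul]
    · exact hβ ha
  · intro a b
    have h2 := (hmul (b := a) (d := b) one_ne_zero one_ne_zero).2
    rw [mul_one, mul_one, hA1, one_mul] at h2
    exact h2
  · intro a b ha
    change _ = algebraMap k F (B 1 a) * _ + algebraMap k F (B 1 b)
    rw [map_add, map_mul, AlgEquiv.commutes, AlgEquiv.commutes, hAB a b ha, (hAa ha b).1,
      (hAa ha b).2, hBa ha, hB1 ha]
    simp only [map_add, map_mul, map_sub, map_one]
    ring

end IsAffineFamily

end AffineFamily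

section Reconstruction

variable {k F k' F' : Type*} [Field k] [Field F] [Field k'] [Field F'] [Algebra k F]
  [Algebra k' F']

theorem forall_eq_iff_apply_eq (μ : (F' ≃ₐ[k'] F') ≃* (F ≃ₐ[k] F)) {Y : Set F'} {w : F}
    (hstab : ∀ g, (∀ y ∈ Y, g y = y) ↔ μ g w = w) (g g' : F' ≃ₐ[k'] F') :
    (∀ y ∈ Y, g y = g' y) ↔ μ g w = μ g' w := by
  have e1 : (∀ y ∈ Y, g y = g' y) ↔ ∀ y ∈ Y, (g'⁻¹ * g) y = y :=
    forall₂_congr fun y _ ↦ (AlgEquiv.symm_apply_eq g').symm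
  have e2 : μ g w = μ g' w ↔ μ (g'⁻¹ * g) w = w := by
    rw [map_mul μ, map_inv μ]
    exact (AlgEquiv.symm_apply_eq (μ g')).symm
  rw [e1, e2, hstab]

variable [IsAlgClosed k] [IsAlgClosed k'] [IsAlgClosed F] [IsAlgClosed F']

theorem exists_affineFamily (h1 : Algebra.trdeg k F = 1) (μ : (F' ≃ₐ[k'] F') ≃* (F ≃ₐ[k] F))
    {Y : Set F'} (hY : IsTranscendenceBasis k' ((↑) : Y → F')) {w : F} (hw : Transcendental k w)
    (hstab : ∀ g, (∀ y ∈ Y, g y = y) ↔ μ g w = w) {y₀ : F'} (hy₀ : y₀ ∈ Y) :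
    ∃ L : k' → k' → (F' ≃ₐ[k'] F'),
      (∀ a b, a ≠ 0 → L a b y₀ = algebraMap k' F' a * y₀ + algebraMap k' F' b) ∧
      (∀ a b, a ≠ 0 → ∀ y ∈ Y, y ≠ y₀ → L a b y = y) ∧
      IsAffineFamily (fun a b ↦ μ (L a b)) w ∧ ∀ a b, a ≠ 0 → k⟮μ (L a b) w⟯ = k⟮w⟯ := by
  classical
  have hagree := forall_eq_iff_apply_eq μ hstab
  have hy₀t : Transcendental k' y₀ := hY.1.transcendental ⟨y₀, hy₀⟩
  have hL : ∀ a b : k', ∃ g : F' ≃ₐ[k'] F', a ≠ 0 →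
      g y₀ = algebraMap k' F' a * y₀ + algebraMap k' F' b ∧ ∀ y ∈ Y, y ≠ y₀ → g y = y := by
    intro a b
    by_cases ha : a = 0
    · exact ⟨1, fun h ↦ (h ha).elim⟩
    obtain ⟨g, hg⟩ := exists_algEquiv_of_isTranscendenceBasis hY
      (isTranscendenceBasis_update_affine hY ⟨y₀, hy₀⟩ ha b)
    refine ⟨g, fun _ ↦ ⟨?_, fun y hy hne ↦ ?_⟩⟩
    · have := hg ⟨y₀, hy₀⟩
      rwa [Function.update_self] at this
    · have := hg ⟨y, hy⟩
      rwa [Function.update_of_ne (by simpa using hne)] at this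
  choose L hL using hL
  have hL0 := fun a b ha ↦ (hL a b ha).1
  have hL1 := fun a b ha ↦ (hL a b ha).2
  have hP : IsAffineFamily (fun a b ↦ μ (L a b)) w := by
    refine ⟨fun {a b c d} ha hc ↦ ?_, fun {a b c d} ha hc h ↦ ?_⟩
    · have h2 := (hagree (L a b * L c d) (L (a * c) (b * c + d))).1 fun y hy ↦ ?_
      · rw [map_mul μ] at h2
        exact h2
      · change L a b (L c d y) = _
        by_cases hyy : y = y₀
        · rw [hyy, hL0 _ _ hc, map_add, map_mul, AlgEquiv.commutes, AlgEquiv.commutes, hL0 _ _ ha,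
            hL0 _ _ (mul_ne_zero ha hc)]
          simp only [map_add, map_mul]
          ring
        · rw [hL1 _ _ hc y hy hyy, hL1 _ _ ha y hy hyy, hL1 _ _ (mul_ne_zero ha hc) y hy hyy]
    · have h2 := (hagree _ _).2 h y₀ hy₀
      rw [hL0 _ _ ha, hL0 _ _ hc] at h2
      exact affine_inj hy₀t h2
  refine ⟨L, hL0, hL1, hP, fun a b ha ↦ ?_⟩
  obtain ⟨q, hq⟩ := ExpChar.exists k
  have : ExpChar F q := expChar_of_injective_algebraMap (algebraMap k F).injective q
  refine hP.adjoin_apply_eq q hw (fun a b ha ↦ ?_) ha b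
  refine adjoin_eq_of_stabilizer_eq q h1 (transcendental_apply _ hw) hw fun g ↦ ?_
  obtain ⟨g, rfl⟩ := μ.surjective g
  have h2 := hagree (g * L a b) (L a b)
  rw [map_mul μ] at h2
  refine h2.symm.trans (Iff.trans ?_ (hstab g))
  refine forall₂_congr fun y hy ↦ ?_
  change g (L a b y) = L a b y ↔ _
  by_cases hyy : y = y₀
  · have ha' : algebraMap k' F' a ≠ 0 := by simpa using ha
    rw [hyy, hL0 _ _ ha, map_add, map_mul, AlgEquiv.commutes, AlgEquiv.commutes, add_left_inj,
      mul_right_inj' ha']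
  · rw [hL1 _ _ ha y hy hyy]

theorem exists_extIso_of_topGrpIso (h1 : Algebra.trdeg k F = 1) {x : F} (hx : Transcendental k x)
    (e : TopGrpIso k F k' F') : ∃ σ : ExtIso k F k' F',
      ∀ (τ : F ≃ₐ[k] F) (x : F'), e.1 τ x = σ.1.symm (τ (σ.1 x)) := by
  obtain ⟨e, he, he'⟩ := e
  set μ := e.symm with hμ
  obtain ⟨Y, ⟨y₀, hy₀⟩, hY, w, hw, hstab⟩ := exists_transcendenceBasis_stabilizer h1 hx μ he' he
  obtain ⟨L, hL0, hL1, hP, hadj⟩ := exists_affineFamily h1 μ hY hw hstab hy₀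
  obtain ⟨z, hz, α, hα⟩ := hP.exists_ringHom hw hadj
  have hzt := transcendental_of_adjoin_eq hw hz
  have hy₀t : Transcendental k' y₀ := hY.1.transcendental ⟨y₀, hy₀⟩
  have hagree : ∀ g g' : F' ≃ₐ[k'] F', (∀ y ∈ Y, g y = g' y) ↔ μ g z = μ g' z := fun g g' ↦
    (forall_eq_iff_apply_eq μ hstab g g').trans
      ⟨apply_eq_apply_of_mem_adjoin (hz ▸ mem_adjoin_simple_self k z),
        apply_eq_apply_of_mem_adjoin (hz.symm ▸ mem_adjoin_simple_self k w)⟩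
  have hYsing : ∀ y ∈ Y, y = y₀ := by
    intro y₁ hy₁
    by_contra hne
    obtain ⟨L', hL0', hL1', -, hadj'⟩ := exists_affineFamily h1 μ hY hw hstab hy₁
    obtain ⟨r, hr0, hr1⟩ := exists_ne_zero_ne_one k'
    have hcomm : ∀ a b, a ≠ 0 → μ (L a b) (μ (L' r 0) z) = μ (L' r 0) (μ (L a b) z) := by
      intro a b ha
      have h2 := (hagree (L a b * L' r 0) (L' r 0 * L a b)).1 fun y hy ↦ ?_
      · rw [map_mul μ, map_mul μ] at h2
        exact h2
      · change L a b (L' r 0 y) = L' r 0 (L a b y)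
        by_cases hyy : y = y₀
        · subst hyy
          rw [hL1' _ _ hr0 y hy (Ne.symm hne), hL0 _ _ ha, map_add, map_mul, AlgEquiv.commutes,
            AlgEquiv.commutes, hL1' _ _ hr0 y hy (Ne.symm hne)]
        · rw [hL1 _ _ ha y hy hyy]
          by_cases hyy' : y = y₁
          · subst hyy'
            rw [hL0' _ _ hr0, map_add, map_mul, AlgEquiv.commutes, AlgEquiv.commutes,
              hL1 _ _ ha y hy hyy]
          · rw [hL1' _ _ hr0 y hy hyy', hL1 _ _ ha y hy hyy]
    have hp : k⟮μ (L' r 0) z⟯ = k⟮z⟯ := by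
      rw [adjoin_apply _ hz, hadj' r 0 hr0, hz]
    have h11 : μ (L 1 1) z = z + 1 := by
      have := hα 1 1 one_ne_zero
      simpa using this
    have hp11 : μ (L 1 1) (μ (L' r 0) z) = μ (L' r 0) z + 1 := by
      rw [hcomm 1 1 one_ne_zero, h11, map_add, map_one]
    obtain ⟨A, B, -, hAB⟩ := exists_affine_of_translation (e := 1) hzt (by rw [h11, map_one])
      hp11 hp
    have hA : A = 1 := by
      have h2 := hp11
      rw [hAB, map_add, map_mul, AlgEquiv.commutes, AlgEquiv.commutes, h11] at h2
      refine (algebraMap k F).injective ?_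
      rw [map_one]
      linear_combination h2
    subst hA
    have hB : B = 0 := by
      have h2 := hcomm r 0 hr0
      have hr := hα r 0 hr0
      rw [map_zero, map_zero, add_zero] at hr
      rw [hr, hAB, map_add, map_mul, AlgEquiv.commutes, AlgEquiv.commutes, hr, map_mul,
        AlgEquiv.commutes, hAB, map_one, one_mul, one_mul] at h2
      have h3 : algebraMap k F (B * (α r - 1)) = 0 := by
        rw [map_mul, map_sub, map_one]
        linear_combination -h2
      rw [map_eq_zero_iff _ (algebraMap k F).injective, mul_eq_zero, sub_eq_zero] at h3
      refine h3.resolve_right fun h ↦ hr1 (α.injective ?_)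
      rw [h, map_one]
    subst hB
    have h2 := (hagree (L' r 0) 1).2 (by rw [hAB, map_one μ]; simp) y₁ hy₁
    rw [hL0' _ _ hr0] at h2
    have h3 := affine_inj (hY.1.transcendental ⟨y₁, hy₁⟩) (a := r) (b := 0) (c := 1) (d := 0)
      (by rw [h2]; simp)
    exact hr1 h3.1
  have h1' : Algebra.trdeg k' F' = 1 := by
    rw [← hY.cardinalMk_eq_trdeg]
    obtain rfl : Y = {y₀} := Set.eq_singleton_iff_unique_mem.2 ⟨hy₀, hYsing⟩
    exact Cardinal.mk_singleton _
  obtain ⟨s, hs⟩ := exists_isEquivariant h1 h1' μ α hy₀t hzt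
    (fun g hg ↦ (hagree g 1).2 (by rw [hg, map_one μ]; rfl) y₀ hy₀)
    (fun g a b ha hg ↦ by
      rw [← hα a b ha]
      refine (hagree _ _).1 fun y hy ↦ ?_
      rw [hYsing y hy, hg, hL0 a b ha])
  obtain ⟨σ, hσ, hσμ⟩ := hs.exists_ringEquiv h1 h1' hx
  refine ⟨⟨σ, hσ⟩, fun τ t ↦ ?_⟩
  rw [RingEquiv.eq_symm_apply, hσμ, hμ, MulEquiv.symm_apply_apply]

end Reconstruction

end CurveAut

/-- **Theorem B.** Let `F|k` be an extension of algebraically closed fields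
with `trdeg(F|k) = 1` and `F'|k'` any extension of algebraically closed fields.  For a
field isomorphism `σ : F' ≅ F` with `σ(k') = k`, let `Φ(σ)(τ) = σ⁻¹ ∘ τ ∘ σ`.  Then:
(i) `Φ(σ)` is an isomorphism of topological groups `G_{F|k} ≅ G_{F'|k'}`;
(ii) every topological group isomorphism `G_{F|k} ≅ G_{F'|k'}` is of the form `Φ(σ)`;
(iii) `Φ(σ₁) = Φ(σ₂)` iff `σ₁` and `σ₂` are Frobenius twists of each other.
Thus `Φ` induces a bijection `Isomⁱ(F'|k', F|k) ≅ Isom(G_{F|k}, G_{F'|k'})`. -/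
theorem stmt1 {k F k' F' : Type*} [Field k] [Field F] [Field k'] [Field F']
    [Algebra k F] [Algebra k' F'] [IsAlgClosed k] [IsAlgClosed k']
    [IsAlgClosed F] [IsAlgClosed F']
    (htr : ∃ x : F, Transcendental k x ∧
      Algebra.IsAlgebraic (IntermediateField.adjoin k {x}) F) :
    (∀ σ : ExtIso k F k' F', ∃ e : TopGrpIso k F k' F',
      ∀ (τ : F ≃ₐ[k] F) (x : F'), e.1 τ x = σ.1.symm (τ (σ.1 x))) ∧
    (∀ e : TopGrpIso k F k' F', ∃ σ : ExtIso k F k' F',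
      ∀ (τ : F ≃ₐ[k] F) (x : F'), e.1 τ x = σ.1.symm (τ (σ.1 x))) ∧
    (∀ σ₁ σ₂ : ExtIso k F k' F',
      (∀ (τ : F ≃ₐ[k] F) (x : F'), σ₁.1.symm (τ (σ₁.1 x)) = σ₂.1.symm (τ (σ₂.1 x))) ↔
        FrobTwist σ₁.1 σ₂.1) := by
  obtain ⟨x, hx, hxalg⟩ := htr
  have h1 : Algebra.trdeg k F = 1 := CurveAut.trdeg_eq_one_of_isAlgebraic_adjoin hx
  exact ⟨CurveAut.exists_topGrpIso, CurveAut.exists_extIso_of_topGrpIso h1 hx,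
    CurveAut.frobTwist_iff h1 hx⟩
end

section
/- Let k and k' be algebraically closed fields, let K|k and K'|k' be finitely generated field extensions of transcendence degree ≥ 1, and let F and F' be algebraic closures of K and K' respectively. If σ₁, σ₂ : F' ≅ F are field isomorphisms with σ₁(K') = K and σ₂(K') = K such that σ₁⁻¹ ∘ τ ∘ σ₁ = σ₂⁻¹ ∘ τ ∘ σ₂ for all τ ∈ U_K (i.e. they induce the same isomorphism U_K ≅ U_{K'}), then σ₁ = σ₂. -/
open Polynomial IntermediateField

/-- An automorphism of an abelian group that is multiplication by an integer modulo `n` for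
arbitrarily large `n` acts as a sign on all integer-valued homomorphisms. -/
theorem AddEquiv.exists_isUnit_forall_hom_eq_mul {G : Type*} [AddCommGroup G] (φ : G ≃+ G)
    (hφ : ∀ m : ℕ, ∃ n : ℕ, m ≤ n ∧ ∃ i : ℤ, ∀ a : G, ∃ b : G, φ a = i • a + n • b)
    (w : G →+ ℤ) (hw : w ≠ 0) :
    ∃ ε : ℤ, IsUnit ε ∧ ∀ (v : G →+ ℤ) (b : G), v (φ b) = ε * v b := by
  have cross (v u : G →+ ℤ) (a b : G) : v (φ a) * u b = v a * u (φ b) := by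
    obtain ⟨n, hn, i, h⟩ := hφ ((v (φ a) * u b - v a * u (φ b)).natAbs + 1)
    obtain ⟨c, hc⟩ := h a
    obtain ⟨d, hd⟩ := h b
    refine sub_eq_zero.mp (Int.eq_zero_of_abs_lt_dvd (m := n) ⟨v c * u b - v a * u d, ?_⟩ ?_)
    · simp only [hc, hd, map_add, map_zsmul, map_nsmul, smul_eq_mul, nsmul_eq_mul]
      ring
    · rw [Int.abs_eq_natAbs]
      exact_mod_cast hn
  obtain ⟨g, hg⟩ := Int.subgroup_cyclic w.range
  rw [← AddSubgroup.zmultiples_eq_closure] at hg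
  have hgw (x : G) : ∃ r : ℤ, w x = r * g := by
    have : w x ∈ w.range := ⟨x, rfl⟩
    rw [hg, AddSubgroup.mem_zmultiples_iff] at this
    obtain ⟨r, hr⟩ := this
    exact ⟨r, by simp [← hr]⟩
  have hg0 : g ≠ 0 := by
    rintro rfl
    exact hw (AddMonoidHom.ext fun x ↦ by simpa using hgw x)
  obtain ⟨a, ha⟩ : g ∈ w.range := hg ▸ AddSubgroup.mem_zmultiples g
  obtain ⟨r, hr⟩ := hgw (φ a)
  have key (v : G →+ ℤ) (b : G) : v (φ b) = r * v b := by
    have := cross w v a b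
    rw [hr, ha] at this
    exact mul_left_cancel₀ hg0 (by rw [← this]; ring)
  refine ⟨r, ?_, key⟩
  obtain ⟨s, hs⟩ := hgw (φ.symm a)
  have := key w (φ.symm a)
  rw [φ.apply_symm_apply, ha, hs] at this
  exact IsUnit.of_mul_eq_one s (mul_right_cancel₀ hg0 (by linarith))

open scoped algebraAdjoinAdjoin in
/-- Over the function field of a variety, every transcendental element is detected by an
integer-valued homomorphism on the multiplicative group. -/
theorem Transcendental.exists_units_hom_ne_zero {k L : Type*} [Field k] [Field L] [Algebra k L]
    [Algebra.EssFiniteType k L] (x : Lˣ) (hx : Transcendental k (x : L)) :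
    ∃ w : Additive Lˣ →+ ℤ, w (Additive.ofMul x) ≠ 0 := by
  obtain ⟨t, hxt, ht⟩ := exists_isTranscendenceBasis_superset (R := k) (s := {(x : L)})
    ((algebraicIndependent_singleton_iff (⟨x, rfl⟩ : ({(x : L)} : Set L))).mpr hx)
  let E := adjoin k (t \ {(x : L)})
  have hxE : Transcendental E (x : L) := by
    have := ht.1.transcendental_adjoin (s := {i | (i : L) ≠ x}) (i := ⟨x, hxt rfl⟩) (by simp)
    rw [show ((↑) : t → L) '' {i | (i : L) ≠ x} = t \ {(x : L)} by ext; simp [and_comm]] at this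
    exact this.extendScalars E
  have : Algebra.IsAlgebraic E⟮(x : L)⟯ L := by
    have := ht.isAlgebraic_field
    rw [Subtype.range_coe] at this
    have hle : adjoin k t ≤ E⟮(x : L)⟯.restrictScalars k := adjoin_le_iff.mpr fun y hy ↦ by
      by_cases hyx : y = x
      · exact hyx ▸ mem_adjoin_simple_self E (x : L)
      · exact E⟮(x : L)⟯.algebraMap_mem ⟨y, subset_adjoin k _ ⟨hy, hyx⟩⟩
    let : Algebra (adjoin k t) E⟮(x : L)⟯ := (inclusion hle).toRingHom.toAlgebra
    have : IsScalarTower (adjoin k t) E⟮(x : L)⟯ L := .of_algebraMap_eq fun _ ↦ rfl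
    exact Algebra.IsAlgebraic.tower_top (K := adjoin k t) _
  have : Algebra.EssFiniteType E L := .of_comp k E L
  have : Algebra.EssFiniteType E⟮(x : L)⟯ L := .of_comp E _ L
  have : Module.Finite E⟮(x : L)⟯ L := Algebra.finite_of_essFiniteType_of_isAlgebraic
  let e := RatFunc.algEquivOfTranscendental (x : L) hxE
  have hN (y : Lˣ) : e.symm (Algebra.norm E⟮(x : L)⟯ (y : L)) ≠ 0 := by simp
  let w : Additive Lˣ →+ ℤ := AddMonoidHom.mk'
    (fun y ↦ (e.symm (Algebra.norm E⟮(x : L)⟯ (y.toMul : L))).intDegree)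
    (fun y z ↦ by simp [RatFunc.intDegree_mul (hN _) (hN _)])
  have hex : e.symm (AdjoinSimple.gen E (x : L)) = RatFunc.X :=
    RatFunc.algEquivOfTranscendental_symm_gen ..
  have hnorm : Algebra.norm E⟮(x : L)⟯ (x : L) =
      AdjoinSimple.gen E (x : L) ^ Module.finrank E⟮(x : L)⟯ L :=
    Algebra.norm_algebraMap (S := L) (AdjoinSimple.gen E (x : L))
  have hdeg (n : ℕ) : ((RatFunc.X : RatFunc E) ^ n).intDegree = n := by
    induction n with
    | zero => simp
    | succ n ih =>
      rw [pow_succ, RatFunc.intDegree_mul (pow_ne_zero n RatFunc.X_ne_zero) RatFunc.X_ne_zero, ih]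
      simp
  refine ⟨w, ?_⟩
  simpa [w, hnorm, hex, hdeg] using Module.finrank_pos.ne'

/-- A separable element of a normal extension that is fixed by all automorphisms lies in the
base field. -/
theorem IsSeparable.mem_range_of_forall_algEquiv {L F : Type*} [Field L] [Field F] [Algebra L F]
    [Normal L F] {x : F} (hs : IsSeparable L x) (h : ∀ τ : F ≃ₐ[L] F, τ x = x) :
    x ∈ (algebraMap L F).range := by
  by_contra hx
  obtain ⟨y, hxy, hy⟩ := (notMem_iff_exists_ne_and_isConjRoot hs (Normal.splits' x)).mp
    (fun hb ↦ hx (by simpa using Algebra.mem_bot.mp hb))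
  obtain ⟨τ, rfl⟩ := isConjRoot_iff_exists_algEquiv.mp hy.symm
  exact hxy (h τ).symm

theorem isSeparable_of_pow_mem {L F : Type*} [Field L] [Field F] [Algebra L F] {n : ℕ}
    (hn : (n : L) ≠ 0) {x : F} {a : L} (ha : a ≠ 0) (h : x ^ n = algebraMap L F a) :
    IsSeparable L x :=
  (separable_X_pow_sub_C a hn ha).of_dvd (minpoly.dvd L x (by simp [h]))

theorem exists_forall_eq_pow_mul_pow {L F : Type*} [Field L] [Field F] [Algebra L F]
    [IsAlgClosed F] [Algebra.IsAlgebraic L F] (ρ : F ≃+* F) (φ : L ≃+* L)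
    (hφ : ∀ x, ρ (algebraMap L F x) = algebraMap L F (φ x))
    (hρ : ∀ (τ : F ≃ₐ[L] F) x, τ (ρ x) = ρ (τ x)) {n : ℕ} (hn : (n : L) ≠ 0) :
    ∃ i : ℕ, ∀ a : L, a ≠ 0 → ∃ b : L, b ≠ 0 ∧ φ a = a ^ i * b ^ n := by
  have hn0 : n ≠ 0 := by rintro rfl; simp at hn
  have : NeZero n := ⟨hn0⟩
  have : NeZero (n : F) := ⟨by simpa using (map_ne_zero (algebraMap L F)).mpr hn⟩
  obtain ⟨ζ, hζ⟩ := HasEnoughRootsOfUnity.exists_primitiveRoot F n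
  obtain ⟨i, -, hi⟩ := hζ.eq_pow_of_pow_eq_one (ξ := ρ ζ) (by rw [← map_pow, hζ.pow_eq_one, map_one])
  have hpow (ξ : F) (hξ : ξ ^ n = 1) : ρ ξ = ξ ^ i := by
    obtain ⟨j, -, rfl⟩ := hζ.eq_pow_of_pow_eq_one hξ
    rw [map_pow, ← hi, ← pow_mul, ← pow_mul, mul_comm]
  refine ⟨i, fun a ha ↦ ?_⟩
  obtain ⟨α, hα⟩ := IsAlgClosed.exists_pow_nat_eq (algebraMap L F a) (Nat.pos_of_ne_zero hn0)
  have ha' : algebraMap L F a ≠ 0 := by simpa using ha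
  have hα0 : α ≠ 0 := by rintro rfl; simp [hn0] at hα; exact ha' hα.symm
  have hβ : (ρ α / α ^ i) ^ n = algebraMap L F (φ a / a ^ i) := by
    rw [div_pow, ← map_pow, hα, hφ, ← pow_mul, mul_comm, pow_mul, hα, map_div₀, map_pow]
  have hφa : φ a ≠ 0 := by simpa using ha
  have : Normal L F := have : IsAlgClosure L F := ⟨inferInstance, inferInstance⟩
    IsAlgClosure.normal L F
  obtain ⟨b, hb⟩ := (isSeparable_of_pow_mem hn (by positivity) hβ).mem_range_of_forall_algEquiv
    fun τ ↦ by
      have hτ : ρ (τ α / α) = (τ α / α) ^ i :=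
        hpow _ (by rw [div_pow, ← map_pow, hα, τ.commutes, div_self ha'])
      have hτ0 : τ α ≠ 0 := by simpa using hα0
      have hρ0 : ρ α ≠ 0 := by simpa using hα0
      rw [map_div₀, div_pow] at hτ
      rw [map_div₀, map_pow, hρ]
      field_simp at hτ ⊢
      linear_combination hτ
  refine ⟨b, ?_, ?_⟩
  · rintro rfl
    rw [map_zero, eq_comm, div_eq_zero_iff] at hb
    simp [hα0] at hb
  · rw [← hb, ← map_pow] at hβ
    rw [(algebraMap L F).injective hβ]
    field_simp

theorem RingEquiv.eq_refl_of_eq_mul_zpow {k L : Type*} [Field k] [Field L] [Algebra k L]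
    [Algebra.Transcendental k L] (φ : L ≃+* L) {ε : ℤ} (hε : IsUnit ε)
    (h : ∀ x : L, x ≠ 0 → ∃ c : k, φ x = algebraMap k L c * x ^ ε) : φ = .refl L := by
  have key (x : L) (hx : Transcendental k x) : φ x = x := by
    have hx0 : x ≠ 0 := by rintro rfl; exact hx isAlgebraic_zero
    have hx1 : x + 1 ≠ 0 := by
      intro h0
      exact hx (by simpa [eq_neg_of_add_eq_zero_left h0] using isAlgebraic_one.neg)
    obtain ⟨c, hc⟩ := h x hx0
    obtain ⟨d, hd⟩ := h (x + 1) hx1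
    rw [map_add, map_one, hc] at hd
    rcases Int.isUnit_iff.mp hε with rfl | rfl
    · rw [zpow_one, zpow_one] at hd
      rw [hc, zpow_one]
      have := transcendental_iff.mp hx (C (c - d) * X + C (1 - d))
        (by simp; linear_combination hd)
      have h0 := congrArg (coeff · 0) this
      have h1 := congrArg (coeff · 1) this
      simp [sub_eq_zero, coeff_one] at h0 h1
      rw [h1, ← h0, map_one, one_mul]
    · rw [zpow_neg_one, zpow_neg_one] at hd
      field_simp at hd
      have := transcendental_iff.mp hx (X ^ 2 + C (1 + c - d) * X + C c)
        (by simp; linear_combination hd)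
      have h2 := congrArg (coeff · 2) this
      simp [coeff_one] at h2
  obtain ⟨t, ht⟩ := Algebra.Transcendental.transcendental (R := k) (A := L)
  ext x
  by_cases hx : Transcendental k x
  · exact key x hx
  · have hx' : IsAlgebraic k x := by simpa [Transcendental] using hx
    have := key (x + t) fun H ↦ ht (by simpa using H.sub hx')
    rw [map_add, key t ht] at this
    simpa using this

theorem eq_refl_of_commute_algEquiv {k L F : Type*} [Field k] [Field L] [Field F] [Algebra k L]
    [Algebra L F] [IsAlgClosed k] [IsAlgClosed F] [Algebra.IsAlgebraic L F]
    [Algebra.EssFiniteType k L] [Algebra.Transcendental k L] (ρ : F ≃+* F) (φ : L ≃+* L)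
    (hφ : ∀ x, ρ (algebraMap L F x) = algebraMap L F (φ x))
    (hρ : ∀ (τ : F ≃ₐ[L] F) x, τ (ρ x) = ρ (τ x)) : φ = .refl L := by
  obtain ⟨l, hl, hl2⟩ : ∃ l : ℕ, (l : L) ≠ 0 ∧ 2 ≤ l := by
    by_cases h2 : (2 : L) = 0
    · exact ⟨3, fun h ↦ one_ne_zero (α := L) (by push_cast at h; linear_combination h - h2), by simp⟩
    · exact ⟨2, mod_cast h2, le_rfl⟩
  obtain ⟨t, ht⟩ := Algebra.Transcendental.transcendental (R := k) (A := L)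
  have ht0 : t ≠ 0 := by rintro rfl; exact ht isAlgebraic_zero
  obtain ⟨w, hw⟩ := Transcendental.exists_units_hom_ne_zero (Units.mk0 t ht0) ht
  have hpow (m : ℕ) : ∃ n : ℕ, m ≤ n ∧ ∃ i : ℤ, ∀ a : Additive Lˣ, ∃ b : Additive Lˣ,
      MulEquiv.toAdditive (Units.mapEquiv φ.toMulEquiv) a = i • a + n • b := by
    obtain ⟨i, hi⟩ := exists_forall_eq_pow_mul_pow ρ φ hφ hρ (n := l ^ m) (by simp [hl])
    refine ⟨l ^ m, (Nat.lt_pow_self hl2).le, i, fun a ↦ ?_⟩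
    obtain ⟨b, hb, hab⟩ := hi (a.toMul : L) a.toMul.ne_zero
    refine ⟨Additive.ofMul (Units.mk0 b hb), Additive.toMul.injective (Units.ext ?_)⟩
    simpa using hab
  obtain ⟨ε, hε, h⟩ := AddEquiv.exists_isUnit_forall_hom_eq_mul
    (MulEquiv.toAdditive (Units.mapEquiv φ.toMulEquiv)) hpow w (by rintro rfl; simp at hw)
  refine φ.eq_refl_of_eq_mul_zpow (k := k) hε fun x hx ↦ ?_
  let u := Units.mk0 x hx
  let y : Lˣ := Units.mapEquiv φ.toMulEquiv u * (u ^ ε)⁻¹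
  have hy : ¬ Transcendental k (y : L) := fun hy ↦ by
    obtain ⟨v, hv⟩ := hy.exists_units_hom_ne_zero
    apply hv
    have := h v (Additive.ofMul u)
    simp [y] at this ⊢
    linarith
  obtain ⟨c, hc⟩ : ∃ c, algebraMap k L c = y := by
    have := isAlgebraic_adjoin_simple (not_not.mp hy).isIntegral
    have hbot := eq_bot_of_isAlgClosed_of_isAlgebraic k⟮(y : L)⟯
    exact mem_bot.mp (hbot ▸ mem_adjoin_simple_self k (y : L))
  refine ⟨c, ?_⟩
  rw [hc]
  simp [y, u, zpow_ne_zero ε hx]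

/-- The restriction of a field automorphism to an intermediate field it stabilizes. -/
def RingEquiv.restrictIntermediateField {k F : Type*} [Field k] [Field F] [Algebra k F]
    (ρ : F ≃+* F) (M : IntermediateField k F) (hM : ∀ x, ρ x ∈ M ↔ x ∈ M) : M ≃+* M where
  toFun x := ⟨ρ x, (hM x).mpr x.2⟩
  invFun x := ⟨ρ.symm x, (hM _).mp (by simp)⟩
  left_inv x := by simp
  right_inv x := by simp
  map_mul' x y := by ext; simp
  map_add' x y := by ext; simp

theorem IntermediateField.FG.eq_self_of_commute_algEquiv {k F : Type*} [Field k] [Field F]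
    [Algebra k F] [IsAlgClosed k] [IsAlgClosed F] {M : IntermediateField k F}
    [Algebra.IsAlgebraic M F] (hfg : M.FG) (htr : ∃ x ∈ M, Transcendental k x) (ρ : F ≃+* F)
    (hM : ∀ x, ρ x ∈ M ↔ x ∈ M) (hρ : ∀ (τ : F ≃ₐ[M] F) x, τ (ρ x) = ρ (τ x)) {x : F}
    (hx : x ∈ M) : ρ x = x := by
  have := essFiniteType_iff.mpr hfg
  obtain ⟨t, htM, ht⟩ := htr
  have : Algebra.Transcendental k M :=
    ⟨⟨t, htM⟩, fun h ↦ ht (h.algebraMap (A := F))⟩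
  have := eq_refl_of_commute_algEquiv (k := k) ρ (ρ.restrictIntermediateField M hM)
    (fun _ ↦ rfl) hρ
  exact congrArg Subtype.val (RingEquiv.congr_fun this ⟨x, hx⟩)

theorem IsSeparable.map_mem_of_commute_algEquiv {L F : Type*} [Field L] [Field F] [Algebra L F]
    [Normal L F] (ρ : F ≃+* F) (φ : L ≃+* L)
    (hφ : ∀ x, ρ (algebraMap L F x) = algebraMap L F (φ x))
    (hρ : ∀ (τ : F ≃ₐ[L] F) x, τ (ρ x) = ρ (τ x)) {E : IntermediateField L F} {x : F}
    (hs : IsSeparable L x) (hx : x ∈ E) : ρ x ∈ E := by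
  have hs' : IsSeparable L (ρ x) := by
    refine (Polynomial.Separable.map (f := (φ : L →+* L)) hs).of_dvd (minpoly.dvd L _ ?_)
    have hcomp : (algebraMap L F).comp (φ : L →+* L) = (ρ : F →+* F).comp (algebraMap L F) :=
      RingHom.ext fun a ↦ (hφ a).symm
    have := hom_eval₂ (minpoly L x) (algebraMap L F) (ρ : F →+* F) x
    rw [← aeval_def, minpoly.aeval, map_zero] at this
    rw [aeval_def, eval₂_map, hcomp]
    exact this.symm
  obtain ⟨y, hy⟩ := (hs'.tower_top E).mem_range_of_forall_algEquiv fun τ ↦ by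
    have h := hρ (τ.restrictScalars L) x
    simp only [AlgEquiv.restrictScalars_apply] at h
    rw [h, show τ x = x from τ.commutes ⟨x, hx⟩]
  exact hy ▸ y.2

/-- **Injectivity.** Let `K|k` and `K'|k'` be finitely generated extensions of
algebraically closed fields of transcendence degree `≥ 1`, with algebraic closures `F`, `F'`.
If `σ₁, σ₂ : F' ≅ F` map `K'` onto `K` and induce the same isomorphism `U_K ≅ U_{K'}` by
conjugation (`σ₁⁻¹ ∘ τ ∘ σ₁ = σ₂⁻¹ ∘ τ ∘ σ₂` for all `τ ∈ U_K = Aut(F|K)`),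
then `σ₁ = σ₂`. -/
theorem stmt2 {k F k' F' : Type*} [Field k] [Field F] [Field k'] [Field F']
    [Algebra k F] [Algebra k' F'] [IsAlgClosed k] [IsAlgClosed k']
    [IsAlgClosed F] [IsAlgClosed F']
    (K : IntermediateField k F) (K' : IntermediateField k' F')
    [Algebra.IsAlgebraic K F] [Algebra.IsAlgebraic K' F']
    (hfg : K.FG) (hfg' : K'.FG)
    (htr : ∃ x ∈ K, Transcendental k x) (htr' : ∃ x ∈ K', Transcendental k' x)
    (σ₁ σ₂ : F' ≃+* F)
    (h₁ : σ₁ '' (K' : Set F') = (K : Set F))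
    (h₂ : σ₂ '' (K' : Set F') = (K : Set F))
    (hconj : ∀ τ : F ≃+* F, (∀ x ∈ K, τ x = x) →
      ∀ x : F', σ₁.symm (τ (σ₁ x)) = σ₂.symm (τ (σ₂ x))) :
    σ₁ = σ₂ := by
  let ρ : F ≃+* F := σ₁.symm.trans σ₂
  have hK (x : F) : ρ x ∈ K ↔ x ∈ K := by
    have e₁ := Set.ext_iff.mp h₁ x
    have e₂ := Set.ext_iff.mp h₂ (ρ x)
    simp only [Set.mem_image, SetLike.mem_coe] at e₁ e₂
    rw [← e₁, ← e₂]
    exact ⟨fun ⟨y, hy, h⟩ ↦ ⟨y, hy, by simp [σ₂.injective h]⟩,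
      fun ⟨y, hy, h⟩ ↦ ⟨y, hy, by simp [ρ, ← h]⟩⟩
  have hρ (τ : F ≃ₐ[K] F) (x : F) : τ (ρ x) = ρ (τ x) := by
    have := hconj τ.toRingEquiv (fun x hx ↦ τ.commutes ⟨x, hx⟩) (σ₁.symm x)
    simpa [ρ] using (congrArg σ₂ this).symm
  have hρ' (τ : F ≃ₐ[K] F) (x : F) : τ (ρ.symm x) = ρ.symm (τ x) := by
    rw [RingEquiv.eq_symm_apply, ← hρ, ρ.apply_symm_apply]
  have : IsAlgClosure K F := ⟨inferInstance, inferInstance⟩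
  have : Normal K F := IsAlgClosure.normal K F
  let φ := ρ.restrictIntermediateField K hK
  have hsep (x : F) (hx : IsSeparable K x) : ρ x = x := by
    let M := K⟮x⟯.restrictScalars k
    have hle : K⟮x⟯ ≤ separableClosure K F :=
      adjoin_simple_le_iff.mpr (mem_separableClosure_iff.mpr hx)
    have hsM {z : F} (hz : z ∈ K⟮x⟯) : IsSeparable K z := mem_separableClosure_iff.mp (hle hz)
    have : Algebra.IsAlgebraic M F :=
      inferInstanceAs (Algebra.IsAlgebraic K⟮x⟯ F)
    have hfgM : M.FG := by
      rw [show M = K ⊔ adjoin k {x} from restrictScalars_adjoin_eq_sup k K _]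
      exact fg_sup hfg (fg_adjoin_of_finite (Set.finite_singleton x))
    obtain ⟨t, htK, ht⟩ := htr
    refine hfgM.eq_self_of_commute_algEquiv ⟨t, K⟮x⟯.algebraMap_mem ⟨t, htK⟩, ht⟩ ρ
      (fun z ↦ ⟨fun hz ↦ ?_, fun hz ↦ ?_⟩) (fun τ z ↦ ?_) (mem_adjoin_simple_self K x)
    · have h := (hsM hz).map_mem_of_commute_algEquiv ρ.symm φ.symm (fun _ ↦ rfl) hρ' hz
      rwa [ρ.symm_apply_apply] at h
    · exact (hsM hz).map_mem_of_commute_algEquiv ρ φ (fun _ ↦ rfl) hρ hz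
    · let τ' : F ≃ₐ[K⟮x⟯] F := τ
      exact hρ (τ'.restrictScalars K) z
  ext y
  obtain ⟨n, z, hz⟩ := IsPurelyInseparable.pow_mem (separableClosure K F) (ringExpChar K) (σ₁ y)
  have hy : ρ (σ₁ y) = σ₁ y := by
    have : ExpChar F (ringExpChar K) := expChar_of_injective_algebraMap (algebraMap K F).injective _
    apply iterateFrobenius_inj F (ringExpChar K) n
    have h := hsep z (mem_separableClosure_iff.mp z.2)
    rw [show (z : F) = σ₁ y ^ ringExpChar K ^ n from hz, map_pow] at h
    simpa only [iterateFrobenius_def] using h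
  simpa [ρ] using hy.symm
end

section
/- Let K be a field and F an algebraic closure of K. If v and w are two inequivalent rank-1 valuations on F, then the decomposition groups over K satisfy Z_v(F|K) ∩ Z_w(F|K) = {id}. -/
/-- A rank-1 valuation on a field `F`, written additively with values in `ℝ ∪ {∞}`:
`v x = ∞ ↔ x = 0`, `v (x * y) = v x + v y`, `v (x + y) ≥ min (v x) (v y)`, and
`v` is not identically `0` on `Fˣ`. -/
def IsRank1Val {F : Type*} [Field F] (v : F → WithTop ℝ) : Prop :=
  (∀ x, v x = ⊤ ↔ x = 0) ∧
  (∀ x y, v (x * y) = v x + v y) ∧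
  (∀ x y, min (v x) (v y) ≤ v (x + y)) ∧
  (∃ x, x ≠ 0 ∧ v x ≠ 0)

/-- Equivalence of rank-1 valuations: `w = λ • v` for some real `λ > 0`. -/
def ValEquiv {F : Type*} [Field F] (v w : F → WithTop ℝ) : Prop :=
  ∃ c : ℝ, 0 < c ∧ ∀ x, w x = (c : WithTop ℝ) * v x

section AbsoluteValue

open Polynomial Filter Topology

variable {F : Type*} [Field F]

/-- If `p` is small at `a` compared with its leading coefficient, then it has a root near `a`. -/
theorem AbsoluteValue.exists_isRoot_sub_lt [IsAlgClosed F] (A : AbsoluteValue F ℝ) {p : F[X]}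
    {a : F} {ε : ℝ} (hε : 0 < ε) (h : A (p.eval a) < A p.leadingCoeff * ε ^ p.natDegree) :
    ∃ β, p.IsRoot β ∧ A (a - β) < ε := by
  by_contra! hfar
  have hs := IsAlgClosed.splits p
  have key : ∀ s : Multiset F, (∀ β ∈ s, ε ≤ A (a - β)) →
      ε ^ s.card ≤ A (s.map (a - ·)).prod := by
    intro s
    induction s using Multiset.induction with
    | empty => simp
    | cons b s ih =>
      intro hb
      simp only [Multiset.card_cons, Multiset.map_cons, Multiset.prod_cons, map_mul, pow_succ']
      exact mul_le_mul (hb b (by simp)) (ih fun β hβ => hb β (by simp [hβ]))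
        (by positivity) (A.nonneg _)
  have hk := key p.roots fun β hβ => hfar β (isRoot_of_mem_roots hβ)
  rw [hs.eval_eq_prod_roots, map_mul, hs.natDegree_eq_card_roots] at h
  exact absurd h (not_lt.2 (mul_le_mul_of_nonneg_left hk (A.nonneg _)))

/-- If a polynomial `g` of degree `n` invariant under `τ` has a root near each of `n` points fixed
by `τ` which are far apart from each other, then all its roots are fixed by `τ`. -/
theorem Polynomial.apply_root_eq_of_near_fixed {B : AbsoluteValue F ℝ}
    (hB : IsNonarchimedean B) {τ : F ≃+* F} (hBτ : ∀ x, B (τ x) = B x) {g : F[X]} (hg : g ≠ 0)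
    (hgτ : g.map (τ : F →+* F) = g) {b : ℕ → F} (hbτ : ∀ i, τ (b i) = b i)
    (hb : ∀ i j, i ≠ j → 1 ≤ B (b i - b j))
    (hnear : ∀ i < g.natDegree, ∃ β, g.IsRoot β ∧ B (b i - β) < 1) {β : F} (hβ : g.IsRoot β) :
    τ β = β := by
  classical
  choose! r hr hbr using hnear
  have hclose : ∀ {i j : ℕ} {γ : F}, B (b i - γ) < 1 → B (b j - γ) < 1 → i = j := by
    intro i j γ hi hj
    by_contra hij
    refine absurd (hb i j hij) (not_le.2 ?_)
    have h := hB (b i - γ) (γ - b j)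
    rw [sub_add_sub_cancel, B.map_sub γ] at h
    exact h.trans_lt (max_lt hi hj)
  have hsurj : Set.SurjOn r (Finset.range g.natDegree) g.roots.toFinset := by
    refine Finset.surjOn_of_injOn_of_card_le r ?_ ?_ ?_
    · intro i hi
      simpa [hg] using hr i (by simpa using hi)
    · intro i hi j hj hij
      exact hclose (hbr i (by simpa using hi)) (hij ▸ hbr j (by simpa using hj))
    · simpa using (Multiset.toFinset_card_le _).trans (card_roots' g)
  have hroot : ∀ γ, g.IsRoot γ → ∃ i < g.natDegree, r i = γ := by
    intro γ hγ
    obtain ⟨i, hi, h⟩ := hsurj (show γ ∈ (g.roots.toFinset : Set F) by simpa [hg] using hγ)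
    exact ⟨i, by simpa using hi, h⟩
  have hτβ : g.IsRoot (τ β) := by
    have h := hβ.map (f := (τ : F →+* F))
    rwa [hgτ] at h
  obtain ⟨i, hi, rfl⟩ := hroot _ hβ
  obtain ⟨j, hj, hji⟩ := hroot _ hτβ
  have h1 : B (b i - r j) < 1 := by
    rw [hji, ← hbτ i, ← map_sub, hBτ]
    exact hbr i hi
  rw [← hji, hclose h1 (hbr j hj)]

/-- The orbit polynomial `∏ (X - τ ^ i a)` of a periodic point `a` of `τ` is invariant. -/
theorem RingEquiv.map_prod_X_sub_C_iterate {τ : F ≃+* F} {a : F} {n : ℕ} (hn : τ^[n] a = a) :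
    (∏ i ∈ Finset.range n, (X - C (τ^[i] a))).map (τ : F →+* F) =
      ∏ i ∈ Finset.range n, (X - C (τ^[i] a)) := by
  cases n with
  | zero => simp
  | succ n =>
    simp only [Polynomial.map_prod, Polynomial.map_sub, map_X, map_C, RingEquiv.coe_toRingHom,
      ← Function.iterate_succ_apply' τ]
    rw [Finset.prod_range_succ, hn, Finset.prod_range_succ', Function.iterate_zero_apply]

/-- A periodic point of a ring automorphism preserving two absolute values separated by a fixed
point is itself fixed. -/
theorem RingEquiv.apply_eq_of_map_absoluteValue_eq [IsAlgClosed F] {A B : AbsoluteValue F ℝ}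
    (hB : IsNonarchimedean B) {τ : F ≃+* F} (hAτ : ∀ x, A (τ x) = A x)
    (hBτ : ∀ x, B (τ x) = B x) {z : F} (hzτ : τ z = z) (hAz : A z < 1) (hBz : 1 < B z)
    {a : F} {n : ℕ} (hn0 : 0 < n) (hn : τ^[n] a = a) : τ a = a := by
  by_contra hne
  set ε := A (a - τ a) / 2 with hε_def
  have hε : 0 < ε := half_pos (A.pos (sub_ne_zero.2 (Ne.symm hne)))
  set f : F[X] := ∏ i ∈ Finset.range n, (X - C (τ^[i] a)) with hf_def
  set h : F[X] := ∏ i ∈ Finset.range n, (X - C (z ^ i)) with hh_def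
  have hfm : f.Monic := monic_prod_X_sub_C _ _
  have hhm : h.Monic := monic_prod_X_sub_C _ _
  have hfd : f.natDegree = n := by simp [hf_def]
  have hhd : h.natDegree = n := by
    rw [hh_def, natDegree_finsetProd_X_sub_C_eq_card, Finset.card_range]
  have hhτ : h.map (τ : F →+* F) = h := by
    simp [hh_def, Polynomial.map_prod, hzτ]
  have hfa : f.eval a = 0 := by
    rw [hf_def, eval_prod]
    exact Finset.prod_eq_zero (Finset.mem_range.2 hn0) (by simp)
  have hhz : ∀ i < n, h.eval (z ^ i) = 0 := by
    intro i hi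
    rw [hh_def, eval_prod]
    exact Finset.prod_eq_zero (Finset.mem_range.2 hi) (by simp)
  have hAlim : Tendsto (fun m : ℕ => A z ^ m) atTop (𝓝 0) :=
    tendsto_pow_atTop_nhds_zero_of_lt_one (A.nonneg z) hAz
  have hBlim : Tendsto (fun m : ℕ => B z ^ m) atTop atTop := tendsto_pow_atTop_atTop_of_one_lt hBz
  have hA1 : ∀ᶠ m : ℕ in atTop, A z ^ m * A (h.eval a) < (1 - A z ^ m) * ε ^ n := by
    refine Tendsto.eventually_lt (hAlim.mul_const _) ((hAlim.const_sub 1).mul_const _) ?_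
    simpa using pow_pos hε n
  have hB1 : ∀ᶠ m : ℕ in atTop, ∀ i ∈ Finset.range n, B (f.eval (z ^ i)) < B z ^ m - 1 := by
    rw [Filter.eventually_all_finset]
    intro i _
    filter_upwards [hBlim.eventually_gt_atTop (B (f.eval (z ^ i)) + 1)] with m hm
    linarith
  obtain ⟨m, hAm, hBm⟩ := (hA1.and hB1).exists
  set g : F[X] := f + C (z ^ m) * h with hg_def
  have hcoeff : g.coeff n = 1 + z ^ m := by
    have h1 : f.coeff n = 1 := by simpa [hfd] using hfm.coeff_natDegree
    have h2 : h.coeff n = 1 := by simpa [hhd] using hhm.coeff_natDegree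
    simp only [hg_def, coeff_add, coeff_C_mul, h1, h2, mul_one]
  have hB2 : B z ^ m - 1 ≤ B (1 + z ^ m) := by
    have := B.add_le (1 + z ^ m) (-1)
    simp only [add_neg_cancel_comm, map_pow, map_neg_eq_map, map_one] at this
    linarith
  have hA2 : 1 - A z ^ m ≤ A (1 + z ^ m) := by
    have := A.add_le (1 + z ^ m) (-z ^ m)
    simp only [add_neg_cancel_right, map_pow, map_neg_eq_map, map_one] at this
    linarith
  have hlc0 : 1 + z ^ m ≠ 0 := by
    intro h0
    have h1 := (B.nonneg _).trans_lt (hBm 0 (by simpa using hn0))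
    rw [h0, map_zero] at hB2
    linarith
  have hgd : g.natDegree = n := by
    refine natDegree_eq_of_le_of_coeff_ne_zero ?_ (hcoeff ▸ hlc0)
    refine (natDegree_add_le _ _).trans (max_le hfd.le ((natDegree_C_mul_le _ _).trans hhd.le))
  have hlc : g.leadingCoeff = 1 + z ^ m := by rw [leadingCoeff, hgd, hcoeff]
  have hg0 : g ≠ 0 := by
    rintro h0
    rw [h0, leadingCoeff_zero] at hlc
    exact hlc0 hlc.symm
  have hgτ : g.map (τ : F →+* F) = g := by
    rw [hg_def, Polynomial.map_add, Polynomial.map_mul, map_C, hhτ, hf_def,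
      map_prod_X_sub_C_iterate hn, map_pow, RingEquiv.coe_toRingHom, hzτ]
  obtain ⟨β, hβ, haβ⟩ := A.exists_isRoot_sub_lt (p := g) (a := a) hε (by
    rw [hlc, hgd, hg_def, eval_add, eval_mul, eval_C, hfa, zero_add, map_mul, map_pow]
    exact hAm.trans_le (mul_le_mul_of_nonneg_right hA2 (by positivity)))
  have hfix : τ β = β := by
    refine apply_root_eq_of_near_fixed hB hBτ hg0 hgτ (b := fun i => z ^ i) (by simp [hzτ])
      ?_ ?_ hβ
    · intro i j hij
      have hlt : B (z ^ i) ≠ B (-z ^ j) := by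
        rw [map_neg_eq_map, map_pow, map_pow]
        exact fun h => hij (pow_right_injective₀ (by linarith) hBz.ne' h)
      rw [sub_eq_add_neg, hB.add_eq_max_of_ne hlt, map_pow]
      exact le_max_of_le_left (one_le_pow₀ hBz.le)
    · intro i hi
      rw [hgd] at hi
      refine B.exists_isRoot_sub_lt one_pos ?_
      rw [hlc, hg_def, eval_add, eval_mul, hhz i hi, mul_zero, add_zero, one_pow, mul_one]
      exact (hBm i (by simpa using hi)).trans_le hB2
  have h1 : A (β - τ a) < ε := by
    rw [← hfix, ← map_sub, hAτ, A.map_sub]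
    exact haβ
  have h2 := A.sub_le a β (τ a)
  linarith

/-- If all orbits of `τ` are finite, then inequivalent absolute values preserved by `τ` are
separated by a fixed point of `τ`. -/
theorem RingEquiv.exists_fixed_lt_one_one_lt {A B : AbsoluteValue F ℝ} (hA : A.IsNontrivial)
    (hB : B.IsNontrivial) (hAB : ¬ A.IsEquiv B) {τ : F ≃+* F} (hAτ : ∀ x, A (τ x) = A x)
    (hBτ : ∀ x, B (τ x) = B x) (hper : ∀ x, ∃ n, 0 < n ∧ τ^[n] x = x) :
    ∃ z, τ z = z ∧ A z < 1 ∧ 1 < B z := by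
  obtain ⟨x, hBx, hAx⟩ := AbsoluteValue.exists_one_lt_lt_one_of_not_isEquiv hB hA (mt .symm hAB)
  obtain ⟨n, hn0, hn⟩ := hper x
  have hnorm : ∀ D : AbsoluteValue F ℝ, (∀ y, D (τ y) = D y) →
      D (∏ i ∈ Finset.range n, τ^[i] x) = D x ^ n := by
    intro D hD
    have hi : ∀ i, D (τ^[i] x) = D x := fun i => by
      induction i with
      | zero => rfl
      | succ i ih => rw [Function.iterate_succ_apply', hD, ih]
    simp [map_prod, hi]
  refine ⟨∏ i ∈ Finset.range n, τ^[i] x, ?_, ?_, ?_⟩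
  · obtain ⟨k, rfl⟩ := Nat.exists_eq_succ_of_ne_zero hn0.ne'
    simp only [map_prod, ← Function.iterate_succ_apply' τ]
    rw [Finset.prod_range_succ, hn, Finset.prod_range_succ', Function.iterate_zero_apply]
  · rw [hnorm A hAτ]
    exact pow_lt_one₀ (A.nonneg _) hAx hn0.ne'
  · rw [hnorm B hBτ]
    exact one_lt_pow₀ hBx hn0.ne'

/-- An automorphism of an algebraic extension has finite orbits. -/
theorem RingEquiv.exists_iterate_eq_of_isAlgebraic {K : Subfield F} [Algebra.IsAlgebraic K F]
    {τ : F ≃+* F} (hτ : ∀ x ∈ K, τ x = x) (x : F) : ∃ n, 0 < n ∧ τ^[n] x = x := by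
  have hp : minpoly K x ≠ 0 := minpoly.ne_zero (Algebra.IsAlgebraic.isAlgebraic x).isIntegral
  have hmem : ∀ i : ℕ, τ^[i] x ∈ (minpoly K x).rootSet F := by
    intro i
    let σ : F →ₐ[K] F := { (τ : F →+* F) with commutes' := fun y => hτ y y.2 }
    induction i with
    | zero => simp [mem_rootSet, hp]
    | succ i ih =>
      rw [mem_rootSet] at ih ⊢
      refine ⟨hp, ?_⟩
      rw [Function.iterate_succ_apply', show τ (τ^[i] x) = σ (τ^[i] x) from rfl,
        aeval_algHom_apply, ih.2, map_zero]
  obtain ⟨i, j, hij, h⟩ :=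
    Set.Finite.exists_lt_map_eq_of_forall_mem hmem (rootSet_finite (minpoly K x) F)
  refine ⟨j - i, by omega, (τ.injective.iterate i) ?_⟩
  rw [← Function.iterate_add_apply, Nat.add_sub_cancel' hij.le, h]

end AbsoluteValue

namespace IsRank1Val

variable {F : Type*} [Field F] {v w : F → WithTop ℝ}

theorem coe_untopD (hv : IsRank1Val v) {x : F} (hx : x ≠ 0) :
    (((v x).untopD 0 : ℝ) : WithTop ℝ) = v x := by
  have h : v x ≠ ⊤ := fun h => hx ((hv.1 x).1 h)
  lift v x to ℝ using h with r
  rfl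

theorem untopD_mul (hv : IsRank1Val v) {x y : F} (hx : x ≠ 0) (hy : y ≠ 0) :
    (v (x * y)).untopD 0 = (v x).untopD 0 + (v y).untopD 0 := by
  have h := hv.2.1 x y
  rw [← hv.coe_untopD hx, ← hv.coe_untopD hy, ← hv.coe_untopD (mul_ne_zero hx hy)] at h
  exact_mod_cast h

open Classical in
/-- The function `x ↦ exp (-v x)` attached to a rank-1 valuation `v`. -/
noncomputable def absFun (v : F → WithTop ℝ) (x : F) : ℝ :=
  if x = 0 then 0 else Real.exp (-(v x).untopD 0)

theorem absFun_of_ne_zero (v : F → WithTop ℝ) {x : F} (hx : x ≠ 0) :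
    absFun v x = Real.exp (-(v x).untopD 0) := if_neg hx

theorem absFun_nonneg (v : F → WithTop ℝ) (x : F) : 0 ≤ absFun v x := by
  unfold absFun
  split_ifs <;> positivity

theorem isNonarchimedean_absFun (hv : IsRank1Val v) : IsNonarchimedean (absFun v) := by
  intro x y
  by_cases hx : x = 0
  · simp [hx]
  by_cases hy : y = 0
  · simp [hy]
  by_cases hxy : x + y = 0
  · rw [hxy, absFun, if_pos rfl]
    exact le_max_of_le_left (absFun_nonneg v x)
  have h := hv.2.2.1 x y
  rw [← hv.coe_untopD hx, ← hv.coe_untopD hy, ← hv.coe_untopD hxy] at h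
  have h' : min ((v x).untopD 0) ((v y).untopD 0) ≤ (v (x + y)).untopD 0 := by exact_mod_cast h
  simp only [absFun_of_ne_zero v hx, absFun_of_ne_zero v hy, absFun_of_ne_zero v hxy,
    le_max_iff, Real.exp_le_exp, neg_le_neg_iff]
  exact min_le_iff.1 h'

/-- The absolute value `x ↦ exp (-v x)` attached to a rank-1 valuation `v`. -/
noncomputable def toAbs (hv : IsRank1Val v) : AbsoluteValue F ℝ where
  toFun := absFun v
  map_mul' x y := by
    by_cases hx : x = 0
    · simp [hx, absFun]
    by_cases hy : y = 0
    · simp [hy, absFun]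
    rw [absFun_of_ne_zero v hx, absFun_of_ne_zero v hy, absFun_of_ne_zero v (mul_ne_zero hx hy),
      hv.untopD_mul hx hy, neg_add, Real.exp_add]
  nonneg' := absFun_nonneg v
  eq_zero' x := by
    unfold absFun
    split_ifs with h <;> simp [h, Real.exp_ne_zero]
  add_le' x y := (isNonarchimedean_absFun hv x y).trans
    (max_le_add_of_nonneg (absFun_nonneg v x) (absFun_nonneg v y))

theorem toAbs_of_ne_zero (hv : IsRank1Val v) {x : F} (hx : x ≠ 0) :
    hv.toAbs x = Real.exp (-(v x).untopD 0) := absFun_of_ne_zero v hx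

theorem isNontrivial_toAbs (hv : IsRank1Val v) : hv.toAbs.IsNontrivial := by
  obtain ⟨x, hx, hvx⟩ := hv.2.2.2
  refine ⟨x, hx, fun h => hvx ?_⟩
  rw [hv.toAbs_of_ne_zero hx, Real.exp_eq_one_iff, neg_eq_zero] at h
  rw [← hv.coe_untopD hx, h, WithTop.coe_zero]

theorem valEquiv_of_isEquiv (hv : IsRank1Val v) (hw : IsRank1Val w)
    (h : hv.toAbs.IsEquiv hw.toAbs) : ValEquiv v w := by
  obtain ⟨c, hc, hcw⟩ := AbsoluteValue.isEquiv_iff_exists_rpow_eq.1 h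
  refine ⟨c, hc, fun x => ?_⟩
  by_cases hx : x = 0
  · rw [(hv.1 x).2 hx, (hw.1 x).2 hx, WithTop.mul_top (by exact_mod_cast hc.ne')]
  have hx' := congrFun hcw x
  simp only [hv.toAbs_of_ne_zero hx, hw.toAbs_of_ne_zero hx, ← Real.exp_mul, Real.exp_eq_exp]
    at hx'
  rw [← hv.coe_untopD hx, ← hw.coe_untopD hx, ← WithTop.coe_mul]
  congr 1
  linarith

/-- An automorphism with finite orbits in the decomposition group of `v` preserves `v`. -/
theorem apply_eq_of_valEquiv (hv : IsRank1Val v) {τ : F ≃+* F}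
    (hper : ∀ x, ∃ n, 0 < n ∧ τ^[n] x = x) (hτ : ValEquiv (fun x => v (τ.symm x)) v) (x : F) :
    v (τ x) = v x := by
  obtain ⟨c, hc, h⟩ := hτ
  have hstep : ∀ y, v (τ y) = (c : WithTop ℝ) * v y := fun y => by simpa using h (τ y)
  have hiter : ∀ (n : ℕ) y, v (τ^[n] y) = ((c ^ n : ℝ) : WithTop ℝ) * v y := by
    intro n y
    induction n with
    | zero => simp
    | succ n ih =>
      rw [Function.iterate_succ_apply', hstep, ih, ← mul_assoc, ← WithTop.coe_mul, pow_succ']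
  obtain ⟨y, hy, hvy⟩ := hv.2.2.2
  obtain ⟨n, hn0, hn⟩ := hper y
  have hy' := hiter n y
  rw [hn, ← hv.coe_untopD hy, ← WithTop.coe_mul, WithTop.coe_inj] at hy'
  have hr : (v y).untopD 0 ≠ 0 := fun h0 => hvy (by rw [← hv.coe_untopD hy, h0, WithTop.coe_zero])
  have hcn : c ^ n = 1 := by
    rw [eq_comm, mul_eq_right₀ hr] at hy'
    exact hy'
  have hc1 : c = 1 := (pow_eq_one_iff_of_nonneg hc.le hn0.ne').1 hcn
  rw [hstep, hc1, WithTop.coe_one, one_mul]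

theorem toAbs_apply_eq (hv : IsRank1Val v) {τ : F ≃+* F} (hτ : ∀ x, v (τ x) = v x) (x : F) :
    hv.toAbs (τ x) = hv.toAbs x := by
  by_cases hx : x = 0
  · simp [hx]
  rw [hv.toAbs_of_ne_zero hx, hv.toAbs_of_ne_zero (by simpa using hx), hτ]

end IsRank1Val

/-- Let `K` be a field with algebraic closure `F` and let `v`, `w` be two
inequivalent rank-1 valuations on `F`.  If `τ ∈ Aut(F|K)` lies in both decomposition groups
`Z_v(F|K)` and `Z_w(F|K)` (i.e. `v ∘ τ⁻¹ ∼ v` and `w ∘ τ⁻¹ ∼ w`), then `τ = id`. -/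
theorem stmt3 {F : Type*} [Field F] [IsAlgClosed F] (K : Subfield F)
    [Algebra.IsAlgebraic K F]
    (v w : F → WithTop ℝ) (hv : IsRank1Val v) (hw : IsRank1Val w)
    (hvw : ¬ ValEquiv v w)
    (τ : F ≃+* F) (hτK : ∀ x ∈ K, τ x = x)
    (hτv : ValEquiv (fun x => v (τ.symm x)) v)
    (hτw : ValEquiv (fun x => w (τ.symm x)) w) :
    τ = RingEquiv.refl F := by
  have hper := RingEquiv.exists_iterate_eq_of_isAlgebraic hτK
  have hAτ := hv.toAbs_apply_eq (hv.apply_eq_of_valEquiv hper hτv)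
  have hBτ := hw.toAbs_apply_eq (hw.apply_eq_of_valEquiv hper hτw)
  obtain ⟨z, hzτ, hAz, hBz⟩ := RingEquiv.exists_fixed_lt_one_one_lt hv.isNontrivial_toAbs
    hw.isNontrivial_toAbs (fun h => hvw (hv.valEquiv_of_isEquiv hw h)) hAτ hBτ hper
  ext a
  obtain ⟨n, hn0, hn⟩ := hper a
  exact RingEquiv.apply_eq_of_map_absoluteValue_eq hw.isNonarchimedean_absFun hAτ hBτ hzτ hAz hBz
    hn0 hn
end

section
/- Let K be a field and σ a field automorphism of K. If there exists a proper subfield k ⊊ K such that σ(x)/x ∈ kˣ for all x ∈ Kˣ, then σ is the identity. -/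
/-- An automorphism `σ` with `σ x / x ∈ k` for all `x ≠ 0` fixes every element outside `k`. -/
theorem map_eq_self_of_notMem {K : Type*} [Field K] (k : Subfield K) (σ : K ≃+* K)
    (h : ∀ x : K, x ≠ 0 → σ x / x ∈ k) {x : K} (hx : x ∉ k) : σ x = x := by
  have hx0 : x ≠ 0 := fun e => hx (e ▸ k.zero_mem)
  have hx1 : x + 1 ≠ 0 := fun e => hx (eq_neg_of_add_eq_zero_left e ▸ k.neg_mem k.one_mem)
  have ha := h x hx0
  have hb := h (x + 1) hx1
  have ea : σ x = σ x / x * x := (div_mul_cancel₀ _ hx0).symm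
  have eb : σ x + 1 = σ (x + 1) / (x + 1) * (x + 1) := by
    rw [div_mul_cancel₀ _ hx1, map_add, map_one]
  generalize σ x / x = a at ha ea
  generalize σ (x + 1) / (x + 1) = b at hb eb
  have key : (a - b) * x = b - 1 := by linear_combination eb - ea
  have hab : a - b = 0 := by
    by_contra hne
    apply hx
    rw [eq_div_of_mul_eq hne ((mul_comm _ _).trans key)]
    exact k.div_mem (k.sub_mem hb k.one_mem) (k.sub_mem ha hb)
  linear_combination ea + x * (x + 1) * hab - x * key


/-- If `σ` is an automorphism of a field `K` and there is a proper
subfield `k ⊊ K` with `σ x / x ∈ kˣ` for all `x ∈ Kˣ`, then `σ = id`. -/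
theorem stmt4 {K : Type*} [Field K] (k : Subfield K) (hk : k ≠ ⊤)
    (σ : K ≃+* K) (h : ∀ x : K, x ≠ 0 → σ x / x ∈ k) :
    σ = RingEquiv.refl K := by
  obtain ⟨x, hx⟩ : ∃ x, x ∉ k := by
    by_contra! hall
    exact hk (eq_top_iff.mpr fun y _ => hall y)
  ext y
  by_cases hy : y ∈ k
  · have hxy : x + y ∉ k := fun hm => hx (by simpa using k.sub_mem hm hy)
    have e := map_eq_self_of_notMem k σ h hxy
    rw [map_add, map_eq_self_of_notMem k σ h hx] at e
    exact add_left_cancel e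
  · exact map_eq_self_of_notMem k σ h hy
end

section
/- Let F be an algebraically closed field and L a subfield of F. Then the fixed field of Aut(F|L) acting on F equals the perfect closure L^i of L in F, i.e. {x ∈ F : σ(x) = x for all σ ∈ Aut(F|L)} = L^i. -/
/-- If `F` is algebraically closed with transcendence basis `v` over `K`, then every ring
automorphism of the polynomial ring in `v` extends to `F`. -/
theorem IsTranscendenceBasis.exists_ringEquiv_apply_aeval {ι K F : Type*} [Field K] [Field F]
    [Algebra K F] [IsAlgClosed F] {v : ι → F} (hv : IsTranscendenceBasis K v)
    (e : MvPolynomial ι K ≃+* MvPolynomial ι K) :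
    ∃ σ : F ≃+* F, ∀ p, σ (MvPolynomial.aeval v p) = MvPolynomial.aeval v (e p) := by
  have := IsAlgClosed.isAlgClosure_of_transcendence_basis v hv
  let φ := hv.1.aevalEquiv
  refine ⟨IsAlgClosure.equivOfEquiv F F
    ((φ.symm.toRingEquiv.trans e).trans φ.toRingEquiv), fun p ↦ ?_⟩
  rw [← hv.1.algebraMap_aevalEquiv, ← hv.1.algebraMap_aevalEquiv,
    IsAlgClosure.equivOfEquiv_algebraMap]
  simp [φ]

/-- Translation of all variables by `1`, as an automorphism of the polynomial ring. -/
noncomputable def MvPolynomial.shiftEquiv (ι K : Type*) [CommRing K] :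
    MvPolynomial ι K ≃ₐ[K] MvPolynomial ι K :=
  AlgEquiv.ofAlgHom (MvPolynomial.aeval fun i ↦ MvPolynomial.X i + 1)
    (MvPolynomial.aeval fun i ↦ MvPolynomial.X i - 1)
    (by ext; simp) (by ext; simp)

@[simp]
theorem MvPolynomial.shiftEquiv_C {ι K : Type*} [CommRing K] (a : K) :
    shiftEquiv ι K (C a) = C a :=
  (shiftEquiv ι K).commutes a

@[simp]
theorem MvPolynomial.shiftEquiv_X {ι K : Type*} [CommRing K] (i : ι) :
    shiftEquiv ι K (X i) = X i + 1 := by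
  simp [shiftEquiv]

section

variable {K F : Type*} [Field K] [Field F] [Algebra K F]

/-- A transcendental element of an algebraically closed extension is moved by some
automorphism. -/
theorem Transcendental.exists_algEquiv_apply_ne [IsAlgClosed F] {x : F}
    (hx : Transcendental K x) : ∃ σ : F ≃ₐ[K] F, σ x ≠ x := by
  obtain ⟨t, hxt, ht⟩ := exists_isTranscendenceBasis_superset (R := K) (s := {x})
    (algebraicIndependent_unique_type_iff.2 hx)
  obtain ⟨σ, hσ⟩ := ht.exists_ringEquiv_apply_aeval (MvPolynomial.shiftEquiv t K).toRingEquiv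
  refine ⟨AlgEquiv.ofRingEquiv (f := σ) fun k ↦ ?_, ?_⟩
  · simpa using hσ (MvPolynomial.C k)
  · have := hσ (MvPolynomial.X ⟨x, hxt rfl⟩)
    simp_all

/-- Automorphisms of the relative algebraic closure extend to an algebraically closed field. -/
theorem algebraicClosure.exists_algEquiv_extends [IsAlgClosed F]
    (τ : algebraicClosure K F ≃ₐ[K] algebraicClosure K F) :
    ∃ σ : F ≃ₐ[K] F, ∀ a : algebraicClosure K F, σ a = τ a := by
  obtain ⟨s, hs⟩ := exists_isTranscendenceBasis (algebraicClosure K F) F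
  obtain ⟨σ, hσ⟩ := hs.exists_ringEquiv_apply_aeval (MvPolynomial.mapEquiv s τ.toRingEquiv)
  have key (a : algebraicClosure K F) : σ a = τ a := by
    simpa using hσ (MvPolynomial.C a)
  exact ⟨AlgEquiv.ofRingEquiv (f := σ) fun k ↦ by
    simpa using key (algebraMap K (algebraicClosure K F) k), key⟩

/-- In a normal extension, an element fixed by all automorphisms is purely inseparable. -/
theorem mem_perfectClosure_of_forall_algEquiv_apply_eq [Normal K F] {x : F}
    (hx : ∀ σ : F ≃ₐ[K] F, σ x = x) : x ∈ perfectClosure K F := by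
  classical
  rw [mem_perfectClosure_iff_natSepDegree_eq_one,
    Polynomial.natSepDegree_eq_of_splits _ (Normal.splits inferInstance x), Finset.card_eq_one]
  have hint : IsIntegral K x := Normal.isIntegral inferInstance x
  refine ⟨x, ?_⟩
  ext y
  rw [Multiset.mem_toFinset, Polynomial.mem_aroots, Finset.mem_singleton]
  constructor
  · rintro ⟨-, hy⟩
    obtain ⟨σ, rfl⟩ := minpoly.exists_algEquiv_of_root' hint.isAlgebraic hy
    exact hx σ
  · rintro rfl
    exact ⟨minpoly.ne_zero hint, minpoly.aeval K y⟩

/-- Purely inseparable elements are fixed by all automorphisms. -/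
theorem algEquiv_apply_eq_of_mem_perfectClosure {x : F} (hx : x ∈ perfectClosure K F)
    (σ : F ≃ₐ[K] F) : σ x = x := by
  have := expChar_of_injective_algebraMap (algebraMap K F).injective (ringExpChar K)
  obtain ⟨n, a, ha⟩ := mem_perfectClosure_iff.1 hx
  apply iterateFrobenius_inj F (ringExpChar K) n
  rw [iterateFrobenius_def, iterateFrobenius_def, ← map_pow, ← ha, σ.commutes]

end

/-- Let `F` be an algebraically closed field and `L` a subfield.  The fixed
field of `Aut(F|L)` acting on `F` is the perfect closure `Lⁱ` of `L` in `F` (the set of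
elements of `F` purely inseparable over `L`). -/
theorem stmt5 {F : Type*} [Field F] [IsAlgClosed F] (L : Subfield F) :
    {x : F | ∀ σ : F ≃ₐ[L] F, σ x = x} = (perfectClosure L F : Set F) := by
  ext x
  refine ⟨fun hx ↦ ?_, fun hx ↦ algEquiv_apply_eq_of_mem_perfectClosure hx⟩
  have halg : IsAlgebraic L x := by
    by_contra h
    obtain ⟨σ, hσ⟩ := Transcendental.exists_algEquiv_apply_ne h
    exact hσ (hx σ)
  lift x to algebraicClosure L F using mem_algebraicClosure_iff.2 halg
  have : Normal L (algebraicClosure L F) := IsAlgClosure.normal _ _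
  refine (map_mem_perfectClosure_iff (algebraicClosure L F).val).2
    (mem_perfectClosure_of_forall_algEquiv_apply_eq fun τ ↦ Subtype.ext ?_)
  obtain ⟨σ, hσ⟩ := algebraicClosure.exists_algEquiv_extends τ
  rw [← hσ, hx σ]
end

section
/- Let F be an algebraically closed field and L₁, L₂ two subfields of F. Then Aut(F|L₁) = Aut(F|L₂) (as subgroups of the automorphism group of F) if and only if L₁ and L₂ are perfectly equivalent, i.e. L₁^i = L₂^i. -/
/-- If `F` is algebraically closed with transcendence basis `v` over `R`, every ring automorphism
of the polynomial ring on `v` extends to a ring automorphism of `F`. -/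
theorem IsTranscendenceBasis.exists_ringEquiv_extending {R F ι : Type*} [CommRing R] [Field F]
    [Algebra R F] [IsAlgClosed F] {v : ι → F} (hv : IsTranscendenceBasis R v)
    (e : MvPolynomial ι R ≃+* MvPolynomial ι R) :
    ∃ σ : F ≃+* F, ∀ p, σ (MvPolynomial.aeval v p) = MvPolynomial.aeval v (e p) := by
  let := IsAlgClosed.isAlgClosure_of_transcendence_basis v hv
  let f : Algebra.adjoin R (Set.range v) ≃+* Algebra.adjoin R (Set.range v) :=
    hv.1.aevalEquiv.symm.toRingEquiv.trans (e.trans hv.1.aevalEquiv.toRingEquiv)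
  refine ⟨IsAlgClosure.equivOfEquiv F F f, fun p => ?_⟩
  have h := IsAlgClosure.equivOfEquiv_algebraMap F F f (hv.1.aevalEquiv p)
  simpa [f] using h

/-- An element of an algebraically closed field which is transcendental over a subfield `K` is
moved by some automorphism fixing `K` pointwise. -/
theorem Transcendental.exists_ringEquiv_apply_ne {K F : Type*} [Field K] [Field F] [Algebra K F]
    [IsAlgClosed F] {x : F} (hx : Transcendental K x) :
    ∃ σ : F ≃+* F, (∀ a : K, σ (algebraMap K F a) = algebraMap K F a) ∧ σ x ≠ x := by
  have hind : AlgebraicIndepOn K id ({x} : Set F) :=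
    algebraicIndependent_singleton_iff (x := fun i : ({x} : Set F) => (i : F)) ⟨x, rfl⟩ |>.2 hx
  obtain ⟨s, hs, hb⟩ := exists_isTranscendenceBasis_superset hind
  have hxs : x ∈ s := hs rfl
  let e : MvPolynomial s K ≃ₐ[K] MvPolynomial s K :=
    AlgEquiv.ofAlgHom (MvPolynomial.aeval fun i => MvPolynomial.X i + 1)
      (MvPolynomial.aeval fun i => MvPolynomial.X i - 1) (by ext; simp) (by ext; simp)
  obtain ⟨σ, hσ⟩ := hb.exists_ringEquiv_extending e.toRingEquiv
  refine ⟨σ, fun a => ?_, ?_⟩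
  · simpa [e] using hσ (MvPolynomial.C a)
  · have h := hσ (MvPolynomial.X ⟨x, hxs⟩)
    simp [e] at h
    simp [h]

/-- An element of an algebraically closed field which is algebraic but not purely inseparable over
a subfield `K` is moved by some automorphism fixing `K` pointwise. -/
theorem IsAlgebraic.exists_ringEquiv_apply_ne {K F : Type*} [Field K] [Field F] [Algebra K F]
    [IsAlgClosed F] {x : F} (hx : IsAlgebraic K x) (hxp : x ∉ perfectClosure K F) :
    ∃ σ : F ≃+* F, (∀ a : K, σ (algebraMap K F a) = algebraMap K F a) ∧ σ x ≠ x := by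
  have hroot : ∃ y : F, y ≠ x ∧ Polynomial.aeval y (minpoly K x) = 0 := by
    by_contra! hcon
    classical
    rw [mem_perfectClosure_iff_natSepDegree_eq_one,
      Polynomial.natSepDegree_eq_of_isAlgClosed (E := F)] at hxp
    refine hxp (Finset.card_eq_one.2 ⟨x, Finset.eq_singleton_iff_unique_mem.2 ⟨?_, fun y hy => ?_⟩⟩)
    · simp [minpoly.ne_zero hx.isIntegral]
    · by_contra hne
      exact hcon y hne (Polynomial.mem_aroots.1 (Multiset.mem_toFinset.1 hy)).2
  obtain ⟨y, hyx, hy⟩ := hroot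
  let A := algebraicClosure K F
  have hxA : x ∈ A := mem_algebraicClosure_iff.2 hx
  have hyA : y ∈ A := mem_algebraicClosure_iff.2 ⟨_, minpoly.ne_zero hx.isIntegral, hy⟩
  have hclosure : IsAlgClosure K A := inferInstance
  have hnormal : Normal K A := IsAlgClosure.normal K A
  obtain ⟨τ, hτ⟩ := minpoly.exists_algEquiv_of_root' (K := K) (y := (⟨x, hxA⟩ : A))
    (x := ⟨y, hyA⟩) (Algebra.IsAlgebraic.isAlgebraic _) (by
      rw [← minpoly.algebraMap_eq (algebraMap A F).injective]
      exact (algebraMap A F).injective (by simpa [← Polynomial.aeval_algebraMap_apply] using hy))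
  obtain ⟨s, hb⟩ := exists_isTranscendenceBasis A F
  obtain ⟨σ, hσ⟩ := hb.exists_ringEquiv_extending (MvPolynomial.mapEquiv s τ.toRingEquiv)
  have hσA (a : A) : σ a = τ a := by simpa using hσ (MvPolynomial.C a)
  refine ⟨σ, fun a => ?_, ?_⟩
  · simpa using hσA (algebraMap K A a)
  · have h := hσA ⟨x, hxA⟩
    rw [hτ] at h
    exact fun h' => hyx (h.symm.trans h')

/-- The perfect closure of a subfield `L` in an algebraically closed field `F` is the fixed field
of the automorphisms of `F` fixing `L` pointwise. -/
theorem mem_perfectClosure_iff_forall_ringEquiv {F : Type*} [Field F] [IsAlgClosed F]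
    (L : Subfield F) (x : F) :
    x ∈ perfectClosure L F ↔ ∀ σ : F ≃+* F, (∀ y ∈ L, σ y = y) → σ x = x := by
  constructor
  · intro hx σ hσ
    obtain ⟨n, y, hy⟩ := mem_perfectClosure_iff.1 hx
    have : ExpChar F (ringExpChar L) := expChar_of_injective_algebraMap (algebraMap L F).injective _
    apply iterateFrobenius_inj F (ringExpChar L) n
    simp only [iterateFrobenius_def]
    rw [← map_pow, ← hy]
    exact hσ y y.2
  · intro h
    by_contra hx
    obtain ⟨σ, hσ, hne⟩ : ∃ σ : F ≃+* F,
        (∀ a : L, σ (algebraMap L F a) = algebraMap L F a) ∧ σ x ≠ x := by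
      by_cases halg : IsAlgebraic L x
      · exact halg.exists_ringEquiv_apply_ne hx
      · exact Transcendental.exists_ringEquiv_apply_ne halg
    exact hne (h σ fun y hy => hσ ⟨y, hy⟩)

/-- Let `F` be an algebraically closed field and `L₁`, `L₂` two subfields.
Then `Aut(F|L₁) = Aut(F|L₂)` (as subgroups of the automorphism group of `F`) if and only if
`L₁` and `L₂` are perfectly equivalent, i.e. have the same perfect closure in `F`. -/
theorem stmt6 {F : Type*} [Field F] [IsAlgClosed F] (L₁ L₂ : Subfield F) :
    (∀ σ : F ≃+* F, (∀ x ∈ L₁, σ x = x) ↔ (∀ x ∈ L₂, σ x = x)) ↔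
      (perfectClosure L₁ F : Set F) = (perfectClosure L₂ F : Set F) := by
  constructor
  · intro h
    ext x
    simp only [SetLike.mem_coe, mem_perfectClosure_iff_forall_ringEquiv, h]
  · intro h σ
    have key (L : Subfield F) :
        (∀ x ∈ L, σ x = x) ↔ ∀ x ∈ (perfectClosure L F : Set F), σ x = x :=
      ⟨fun hσ x hx => (mem_perfectClosure_iff_forall_ringEquiv L x).1 hx σ hσ,
        fun hσ x hx => hσ x ((perfectClosure L F).algebraMap_mem ⟨x, hx⟩)⟩
    rw [key L₁, key L₂, h]
end

section
/- Let F|k be a field extension with F algebraically closed and let G_{F|k} = Aut(F|k) carry the topology of pointwise convergence. If H is a compact subgroup of G_{F|k}, then every H-orbit in F is finite, F is a Galois extension of the fixed field F^H, and H = Aut(F|F^H). -/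
open Polynomial in
/-- If the orbit of `x` under a group `H` of automorphisms is finite, then `∏ (X - y)`, over the
`y` in the orbit, has coefficients in the fixed field of `H`. -/
theorem exists_map_eq_prod_X_sub_C_orbit {k F : Type*} [Field k] [Field F] [Algebra k F]
    (H : Subgroup (F ≃ₐ[k] F)) (x : F)
    (hx : ((fun σ : F ≃ₐ[k] F => σ x) '' (H : Set (F ≃ₐ[k] F))).Finite) :
    ∃ p : (IntermediateField.fixedField H)[X],
      p.map (algebraMap (IntermediateField.fixedField H) F) = ∏ y ∈ hx.toFinset, (X - C y) := by
  classical
  refine (Polynomial.mem_lifts _).1 ((Polynomial.lifts_iff_coeff_lifts _).2 fun n => ?_)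
  suffices h : (∏ y ∈ hx.toFinset, (X - C y)).coeff n ∈ IntermediateField.fixedField H from
    ⟨⟨_, h⟩, rfl⟩
  rw [IntermediateField.mem_fixedField_iff]
  intro σ hσ
  have hmap : (∏ y ∈ hx.toFinset, (X - C y)).map (σ : F →+* F) =
      ∏ y ∈ hx.toFinset, (X - C y) := by
    rw [Polynomial.map_prod]
    refine Finset.prod_bij (fun y _ => σ y) ?_ (fun _ _ _ _ h => σ.injective h) ?_ (by simp)
    · intro y hy
      rw [Set.Finite.mem_toFinset] at hy ⊢
      obtain ⟨ρ, hρ, rfl⟩ := hy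
      exact ⟨σ * ρ, H.mul_mem hσ hρ, rfl⟩
    · intro y hy
      rw [Set.Finite.mem_toFinset] at hy
      obtain ⟨ρ, hρ, rfl⟩ := hy
      refine ⟨σ⁻¹ (ρ x), ?_, σ.apply_symm_apply _⟩
      rw [Set.Finite.mem_toFinset]
      exact ⟨σ⁻¹ * ρ, H.mul_mem (H.inv_mem hσ) hρ, rfl⟩
  simpa using congrArg (fun q : F[X] => q.coeff n) hmap

/-- If all orbits of a group `H` of automorphisms of `F` are finite, then `F` is Galois over the
fixed field of `H`. -/
theorem isGalois_fixedField_of_finite_orbits {k F : Type*} [Field k] [Field F] [Algebra k F]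
    (H : Subgroup (F ≃ₐ[k] F))
    (hfin : ∀ x : F, ((fun σ : F ≃ₐ[k] F => σ x) '' (H : Set (F ≃ₐ[k] F))).Finite) :
    IsGalois (IntermediateField.fixedField H) F := by
  have key : ∀ x : F, IsIntegral (IntermediateField.fixedField H) x ∧
      (minpoly (IntermediateField.fixedField H) x).Separable ∧
      ((minpoly (IntermediateField.fixedField H) x).map
        (algebraMap (IntermediateField.fixedField H) F)).Splits := by
    intro x
    obtain ⟨p, hp⟩ := exists_map_eq_prod_X_sub_C_orbit H x (hfin x)
    have hmonic : p.Monic := Polynomial.monic_of_injective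
      (algebraMap (IntermediateField.fixedField H) F).injective
      (hp ▸ Polynomial.monic_prod_of_monic _ _ fun y _ => Polynomial.monic_X_sub_C y)
    have hroot : Polynomial.aeval x p = 0 := by
      rw [← Polynomial.eval_map_algebraMap, hp, Polynomial.eval_prod]
      exact Finset.prod_eq_zero ((hfin x).mem_toFinset.2 ⟨1, H.one_mem, rfl⟩) (by simp)
    have hsep : p.Separable := by
      rw [← Polynomial.separable_map (algebraMap (IntermediateField.fixedField H) F), hp]
      exact Polynomial.separable_prod_X_sub_C_iff'.2 fun _ _ _ _ h => h
    refine ⟨⟨p, hmonic, hroot⟩, hsep.of_dvd (minpoly.dvd _ _ hroot), ?_⟩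
    refine Polynomial.Splits.of_dvd (g := p.map (algebraMap _ F)) ?_ ?_
      (Polynomial.map_dvd _ (minpoly.dvd _ _ hroot))
    · rw [hp]
      exact Polynomial.Splits.prod fun y _ => Polynomial.Splits.X_sub_C y
    · exact (hmonic.map _).ne_zero
  have : Algebra.IsAlgebraic (IntermediateField.fixedField H) F :=
    ⟨fun x => (key x).1.isAlgebraic⟩
  have : Algebra.IsSeparable (IntermediateField.fixedField H) F := ⟨fun x => (key x).2.1⟩
  have : Normal (IntermediateField.fixedField H) F := { splits' := fun x => (key x).2.2 }
  exact ⟨⟩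

/-- If all orbits of `H` are finite, an automorphism fixing the fixed field of `H` agrees with
some element of `H` on any given finite set. -/
theorem exists_mem_eqOn_of_mem_fixingSubgroup {k F : Type*} [Field k] [Field F] [Algebra k F]
    (H : Subgroup (F ≃ₐ[k] F))
    (hfin : ∀ x : F, ((fun σ : F ≃ₐ[k] F => σ x) '' (H : Set (F ≃ₐ[k] F))).Finite)
    {τ : F ≃ₐ[k] F} (hτ : τ ∈ (IntermediateField.fixedField H).fixingSubgroup) (S : Finset F) :
    ∃ σ ∈ H, ∀ x ∈ S, σ x = τ x := by
  have := isGalois_fixedField_of_finite_orbits H hfin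
  let K := IntermediateField.fixedField H
  let L := IntermediateField.adjoin K (S : Set F)
  have hL : FiniteDimensional K L :=
    IntermediateField.finiteDimensional_adjoin fun x _ => Algebra.IsIntegral.isIntegral x
  obtain ⟨a, ha⟩ := Field.exists_primitive_element K L
  have hfix : ∀ ρ ∈ K.fixingSubgroup, ∀ c : K, ρ (algebraMap K F c) = algebraMap K F c :=
    fun ρ hρ c => (IntermediateField.mem_fixingSubgroup_iff K ρ).1 hρ _ c.2
  have hle : H ≤ K.fixingSubgroup := IntermediateField.le_iff_le H K |>.1 le_rfl
  obtain ⟨σ, hσ, hσa⟩ : ∃ σ ∈ H, σ (a : F) = τ a := by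
    obtain ⟨p, hp⟩ := exists_map_eq_prod_X_sub_C_orbit H (a : F) (hfin a)
    have hroot : (p.map (algebraMap K F)).eval (a : F) = 0 := by
      rw [hp, Polynomial.eval_prod]
      exact Finset.prod_eq_zero ((hfin a).mem_toFinset.2 ⟨1, H.one_mem, rfl⟩) (by simp)
    have hrootτ : (p.map (algebraMap K F)).eval (τ a) = 0 := by
      have hcomp : (τ : F →+* F).comp (algebraMap K F) = algebraMap K F :=
        RingHom.ext (hfix τ hτ)
      have h := Polynomial.eval_map_apply (p := p.map (algebraMap K F)) (τ : F →+* F) (a : F)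
      rw [Polynomial.map_map, hcomp, hroot, map_zero] at h
      exact h
    rw [hp, Polynomial.eval_prod, Finset.prod_eq_zero_iff] at hrootτ
    obtain ⟨y, hy, hy0⟩ := hrootτ
    obtain ⟨σ, hσ, rfl⟩ := (hfin a).mem_toFinset.1 hy
    exact ⟨σ, hσ, by
      rw [Polynomial.eval_sub, Polynomial.eval_X, Polynomial.eval_C] at hy0
      exact (sub_eq_zero.1 hy0).symm⟩
  let toHom (ρ : F ≃ₐ[k] F) (hρ : ρ ∈ K.fixingSubgroup) : F →ₐ[K] F :=
    { (ρ : F →+* F) with commutes' := hfix ρ hρ }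
  have heq : (toHom σ (hle hσ)).comp L.val = (toHom τ hτ).comp L.val := by
    ext y
    have hy : y ∈ IntermediateField.adjoin K {a} := ha ▸ IntermediateField.mem_top
    induction hy using IntermediateField.adjoin_induction with
    | mem z hz => exact Set.mem_singleton_iff.1 hz ▸ hσa
    | algebraMap c => simp only [AlgHom.commutes]
    | add z w _ _ hz hw => rw [map_add, map_add, hz, hw]
    | mul z w _ _ hz hw => rw [map_mul, map_mul, hz, hw]
    | inv z _ hz => rw [map_inv₀, map_inv₀, hz]
  exact ⟨σ, hσ, fun x hx => DFunLike.congr_fun heq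
    ⟨x, IntermediateField.subset_adjoin K (S : Set F) hx⟩⟩

/-- Let `F|k` be a field extension with `F` algebraically closed, and let
`H` be a compact subgroup of `G_{F|k} = Aut(F|k)` (pointwise-convergence topology).  Then
every `H`-orbit in `F` is finite, `F` is Galois over the fixed field `F^H`, and
`H = Aut(F|F^H)`. -/
theorem stmt7 {k F : Type*} [Field k] [Field F] [Algebra k F] [IsAlgClosed F]
    (H : Subgroup (F ≃ₐ[k] F))
    (hH : @IsCompact _ (autTop k F) (H : Set (F ≃ₐ[k] F))) :
    (∀ x : F, ((fun σ : F ≃ₐ[k] F => σ x) '' (H : Set (F ≃ₐ[k] F))).Finite) ∧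
    IsGalois (IntermediateField.fixedField H) F ∧
    H = (IntermediateField.fixedField H).fixingSubgroup := by
  let : TopologicalSpace F := ⊥
  have : DiscreteTopology F := ⟨rfl⟩
  let := autTop k F
  have hcont : ∀ x : F, Continuous fun σ : F ≃ₐ[k] F => σ x := fun x =>
    (continuous_apply x).comp (continuous_induced_dom (f := fun σ : F ≃ₐ[k] F => (σ : F → F)))
  have hfin : ∀ x : F, ((fun σ : F ≃ₐ[k] F => σ x) '' (H : Set (F ≃ₐ[k] F))).Finite :=
    fun x => (hH.image (hcont x)).finite_of_discrete
  refine ⟨hfin, isGalois_fixedField_of_finite_orbits H hfin,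
    le_antisymm ((IntermediateField.le_iff_le H _).1 le_rfl) fun τ hτ => ?_⟩
  obtain ⟨σ, hσ, hστ⟩ := hH.inter_iInter_nonempty (fun x : F => {σ : F ≃ₐ[k] F | σ x = τ x})
    (fun x => (isClosed_discrete {τ x}).preimage (hcont x)) fun S => by
      obtain ⟨σ, hσ, h⟩ := exists_mem_eqOn_of_mem_fixingSubgroup H hfin hτ S
      exact ⟨σ, hσ, Set.mem_iInter₂.2 h⟩
  have : σ = τ := AlgEquiv.ext fun x => Set.mem_iInter.1 hστ x
  exact this ▸ hσ
end

section
/- Let F|k be a field extension with F algebraically closed and let G_{F|k} = Aut(F|k) carry the topology of pointwise convergence. If H is a compact open subgroup of G_{F|k}, then there exists a subfield K with k ⊆ K ⊆ F such that K is finitely generated as a field extension of k, F is algebraic over K, and H = Aut(F|K). -/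
open Polynomial in
theorem IsTranscendenceBasis.pow {ι K F : Type*} [Field K] [Field F] [Algebra K F] {v : ι → F}
    (hv : IsTranscendenceBasis K v) {n : ℕ} (hn : n ≠ 0) :
    IsTranscendenceBasis K fun i => v i ^ n := by
  have ind : AlgebraicIndependent K fun i => v i ^ n := by
    simpa using hv.1.polynomial_aeval_of_transcendental (f := fun _ => (X : K[X]) ^ n)
      fun _ => (transcendental_X K).pow (Nat.pos_of_ne_zero hn)
  rw [ind.isTranscendenceBasis_iff_isAlgebraic, hv.isAlgebraic_iff]
  refine fun i => IsAlgebraic.of_pow (Nat.pos_of_ne_zero hn) ?_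
  exact isAlgebraic_algebraMap
    (⟨v i ^ n, Algebra.subset_adjoin ⟨i, rfl⟩⟩ : Algebra.adjoin K (Set.range fun i => v i ^ n))

theorem exists_algEquiv_of_isTranscendenceBasis {ι K F : Type*} [Field K] [Field F] [Algebra K F]
    [IsAlgClosed F] {v w : ι → F} (hv : IsTranscendenceBasis K v)
    (hw : IsTranscendenceBasis K w) : ∃ σ : F ≃ₐ[K] F, ∀ i, σ (v i) = w i := by
  let _ := IsAlgClosed.isAlgClosure_of_transcendence_basis v hv
  let _ := IsAlgClosed.isAlgClosure_of_transcendence_basis w hw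
  let e : Algebra.adjoin K (Set.range v) ≃ₐ[K] Algebra.adjoin K (Set.range w) :=
    hv.1.aevalEquiv.symm.trans hw.1.aevalEquiv
  have he : ∀ p, IsAlgClosure.equivOfEquiv F F e.toRingEquiv (algebraMap _ F p) =
      algebraMap _ F (e p) := IsAlgClosure.equivOfEquiv_algebraMap F F e.toRingEquiv
  refine ⟨AlgEquiv.ofRingEquiv (f := IsAlgClosure.equivOfEquiv F F e.toRingEquiv) fun x => ?_,
    fun i => ?_⟩
  · have := he (algebraMap K _ x)
    rw [e.commutes] at this
    simpa [← IsScalarTower.algebraMap_apply] using this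
  · have := he (hv.1.aevalEquiv (MvPolynomial.X i))
    simpa [e] using this

theorem isAlgebraic_of_finite_orbits {K F : Type*} [Field K] [Field F] [Algebra K F]
    [IsAlgClosed F] (h : ∀ x : F, (Set.range fun σ : F ≃ₐ[K] F => σ x).Finite) :
    Algebra.IsAlgebraic K F := by
  obtain ⟨s, hs⟩ := exists_isTranscendenceBasis K F
  rcases isEmpty_or_nonempty s with he | ⟨⟨i⟩⟩
  · exact hs.isEmpty_iff_isAlgebraic.mp he
  · have hinf : (Set.range fun n : ℕ => (i : F) ^ (n + 1)).Infinite := by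
      refine Set.infinite_range_of_injective fun a b hab => ?_
      have := transcendental_iff_injective.mp (hs.1.transcendental i)
        (a₁ := Polynomial.X ^ (a + 1)) (a₂ := Polynomial.X ^ (b + 1)) (by simpa using hab)
      simpa using congr_arg Polynomial.natDegree this
    refine absurd ((h i).subset ?_) hinf
    rintro _ ⟨n, rfl⟩
    obtain ⟨σ, hσ⟩ := exists_algEquiv_of_isTranscendenceBasis hs (hs.pow n.succ_ne_zero)
    exact ⟨σ, hσ i⟩

section autTop

variable {k F : Type*} [Field k] [Field F] [Algebra k F] {H : Subgroup (F ≃ₐ[k] F)}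

theorem finite_orbit_of_isCompact (hHc : @IsCompact _ (autTop k F) (H : Set (F ≃ₐ[k] F)))
    (x : F) : ((fun σ : F ≃ₐ[k] F => σ x) '' H).Finite := by
  let _ : TopologicalSpace F := ⊥
  have : DiscreteTopology F := ⟨rfl⟩
  let _ := autTop k F
  refine (hHc.image ?_).finite_of_discrete
  exact (continuous_apply x).comp continuous_induced_dom

theorem exists_finite_fixed_le_of_isOpen
    (hHo : @IsOpen _ (autTop k F) (H : Set (F ≃ₐ[k] F))) :
    ∃ S : Finset F, ∀ σ : F ≃ₐ[k] F, (∀ x ∈ S, σ x = x) → σ ∈ H := by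
  let _ : TopologicalSpace F := ⊥
  obtain ⟨U, hU, hUH⟩ := isOpen_induced_iff.mp hHo
  have h1 : ((1 : F ≃ₐ[k] F) : F → F) ∈ U := by
    change (1 : F ≃ₐ[k] F) ∈ (fun σ : F ≃ₐ[k] F => (σ : F → F)) ⁻¹' U
    rw [hUH]
    exact H.one_mem
  obtain ⟨S, u, hu, hSU⟩ := isOpen_pi_iff.mp hU _ h1
  refine ⟨S, fun σ hσ => ?_⟩
  rw [← SetLike.mem_coe, ← hUH]
  refine hSU fun x hx => ?_
  simpa [hσ x hx] using (hu x hx).2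

end autTop

open Polynomial in
/-- A group of automorphisms which contains the pointwise stabilizer of a finite set and has
finite orbits is the fixing subgroup of a finitely generated subfield. This subfield is generated
by the coefficients of `∏ (X - q')`, where `q'` ranges over the orbit of a polynomial `q` whose
coefficients enumerate the finite set. -/
theorem exists_fg_eq_fixingSubgroup {k F : Type*} [Field k] [Field F] [Algebra k F]
    {H : Subgroup (F ≃ₐ[k] F)} (hfin : ∀ x : F, ((fun σ : F ≃ₐ[k] F => σ x) '' H).Finite)
    {S : Finset F} (hS : ∀ σ : F ≃ₐ[k] F, (∀ x ∈ S, σ x = x) → σ ∈ H) :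
    ∃ K : IntermediateField k F, K.FG ∧ H = K.fixingSubgroup := by
  classical
  let s : Fin S.card → F := fun i => S.equivFin.symm i
  let φ : (F ≃ₐ[k] F) → F[X] →+* F[X] := fun σ => mapRingHom (σ : F →+* F)
  let q : F[X] := ofFn S.card s
  have hφ : ∀ σ, φ σ q = ofFn S.card (σ ∘ s) := fun σ => by
    ext n
    rcases lt_or_ge n S.card with hn | hn <;> simp [φ, q, hn]
  have hφmul : ∀ σ τ p, φ (σ * τ) p = φ σ (φ τ p) := fun σ τ p => by
    ext n
    simp [φ]
  have horb : ((fun σ => φ σ q) '' H).Finite := by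
    refine ((Set.Finite.pi' fun i => hfin (s i)).image (ofFn S.card)).subset ?_
    rintro _ ⟨σ, hσ, rfl⟩
    exact ⟨σ ∘ s, fun i => ⟨σ, hσ, rfl⟩, (hφ σ).symm⟩
  let P : F[X][X] := ∏ r ∈ horb.toFinset, (X - C r)
  have hP : ∀ r, P.IsRoot r ↔ ∃ σ ∈ H, φ σ q = r := fun r => by
    simp [P, IsRoot.def, eval_prod, Finset.prod_eq_zero_iff, sub_eq_zero]
  have hPH : ∀ σ ∈ H, P.map (φ σ) = P := fun σ hσ => by
    simp only [P, Polynomial.map_prod, Polynomial.map_sub, map_X, map_C]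
    refine Finset.prod_bij (fun r _ => φ σ r) ?_ ?_ ?_ fun _ _ => rfl
    · simp only [Set.Finite.mem_toFinset]
      rintro _ ⟨τ, hτ, rfl⟩
      exact ⟨σ * τ, H.mul_mem hσ hτ, hφmul ..⟩
    · exact fun _ _ _ _ h => map_injective _ σ.injective h
    · simp only [Set.Finite.mem_toFinset]
      rintro _ ⟨τ, hτ, rfl⟩
      refine ⟨_, ⟨σ⁻¹ * τ, H.mul_mem (H.inv_mem hσ) hτ, rfl⟩, ?_⟩
      rw [← hφmul, mul_inv_cancel_left]
  let T : Finset F := P.support.biUnion fun n => (P.coeff n).coeffs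
  refine ⟨IntermediateField.adjoin k T, IntermediateField.fg_adjoin_finset T,
    le_antisymm ?_ fun τ hτ => ?_⟩
  · rw [← IntermediateField.le_iff_le, IntermediateField.adjoin_le_iff]
    intro x hx
    simp only [T, Finset.coe_biUnion, Set.mem_iUnion, Finset.mem_coe, mem_coeffs_iff] at hx
    obtain ⟨n, -, m, -, rfl⟩ := hx
    rintro ⟨σ, hσ⟩
    have := congr_arg (fun p : F[X][X] => (p.coeff n).coeff m) (hPH σ hσ)
    simpa [φ] using this
  · have hPτ : P.map (φ τ) = P := by
      ext n m
      simp only [coeff_map, φ, coe_mapRingHom]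
      by_cases h : (P.coeff n).coeff m = 0
      · simp [h]
      refine (IntermediateField.mem_fixingSubgroup_iff _ _).mp hτ _
        (IntermediateField.subset_adjoin _ _ ?_)
      simp only [T, Finset.coe_biUnion, Set.mem_iUnion, Finset.mem_coe]
      refine ⟨n, ?_, coeff_mem_coeffs h⟩
      rw [mem_support_iff]
      rintro h0
      simp [h0] at h
    have hroot : P.IsRoot (φ τ q) := by
      rw [← hPτ]
      refine IsRoot.map ((hP q).mpr ⟨1, H.one_mem, ?_⟩)
      ext n
      simp [φ]
    obtain ⟨σ, hσ, hστ⟩ := (hP _).mp hroot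
    have hmem : σ⁻¹ * τ ∈ H := hS _ fun x hx => by
      have h := congr_arg (fun p : F[X] => p.coeff (S.equivFin ⟨x, hx⟩)) hστ
      simp only [hφ, ofFn_coeff_eq_val_of_lt _ (S.equivFin ⟨x, hx⟩).2] at h
      have h' : σ x = τ x := by simpa [s] using h
      rw [AlgEquiv.mul_apply, ← h', ← AlgEquiv.mul_apply, inv_mul_cancel, AlgEquiv.one_apply]
    simpa using H.mul_mem hσ hmem

/-- Let `F|k` be a field extension with `F` algebraically closed, and let
`H` be a compact open subgroup of `G_{F|k} = Aut(F|k)` (pointwise-convergence topology).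
Then there is an intermediate field `k ⊆ K ⊆ F` which is finitely generated as a field
extension of `k`, with `F` algebraic over `K`, such that `H = Aut(F|K)`. -/
theorem stmt8 {k F : Type*} [Field k] [Field F] [Algebra k F] [IsAlgClosed F]
    (H : Subgroup (F ≃ₐ[k] F))
    (hHc : @IsCompact _ (autTop k F) (H : Set (F ≃ₐ[k] F)))
    (hHo : @IsOpen _ (autTop k F) (H : Set (F ≃ₐ[k] F))) :
    ∃ K : IntermediateField k F, K.FG ∧ Algebra.IsAlgebraic K F ∧ H = K.fixingSubgroup := by
  obtain ⟨S, hS⟩ := exists_finite_fixed_le_of_isOpen hHo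
  obtain ⟨K, hK, rfl⟩ := exists_fg_eq_fixingSubgroup (finite_orbit_of_isCompact hHc) hS
  refine ⟨K, hK, isAlgebraic_of_finite_orbits fun x => ?_, rfl⟩
  refine (finite_orbit_of_isCompact hHc x).subset ?_
  rintro _ ⟨σ, rfl⟩
  exact ⟨σ.restrictScalars k, (IntermediateField.mem_fixingSubgroup_iff _ _).mpr
    fun y hy => σ.commutes ⟨y, hy⟩, rfl⟩
end

section
/- Let k be an algebraically closed field and ℓ a prime number different from the characteristic of k. Then the group GL(2,k) of invertible 2×2 matrices over k is ℓ-divisible: for every A ∈ GL(2,k) there exists B ∈ GL(2,k) with B^ℓ = A. -/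
open Matrix

open Polynomial in
/-- Modulo a product of two linear factors with nonzero roots, `X` is an `n`-th power. -/
theorem exists_mul_dvd_pow_sub_X {k : Type*} [Field k] [IsAlgClosed k] {n : ℕ} (hn : (n : k) ≠ 0)
    {a : k} (ha : a ≠ 0) (b : k) : ∃ p : k[X], (X - C a) * (X - C b) ∣ p ^ n - X := by
  have hn0 : 0 < n := Nat.pos_of_ne_zero (by rintro rfl; simp at hn)
  obtain ⟨α, hα⟩ := IsAlgClosed.exists_pow_nat_eq a hn0
  obtain ⟨β, hβ⟩ := IsAlgClosed.exists_pow_nat_eq b hn0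
  by_cases hab : a = b
  · subst hab
    have hα0 : α ≠ 0 := by rintro rfl; simp [hn0.ne'] at hα; exact ha hα.symm
    set c := ((n : k) * α ^ (n - 1))⁻¹
    have hc1 : (n : k) * α ^ (n - 1) * c = 1 := mul_inv_cancel₀ (mul_ne_zero hn (pow_ne_zero _ hα0))
    refine ⟨C α + C c * (X - C a), ?_⟩
    obtain ⟨q, hq⟩ := powAddExpansion (C α) (C c * (X - C a)) n
    refine ⟨q * C c ^ 2, ?_⟩
    have h1 : (n : k[X]) * C α ^ (n - 1) * C c = 1 := by
      rw [← C_pow, ← C_eq_natCast, ← C_mul, ← C_mul, hc1, C_1]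
    have h2 : C α ^ n = C a := by rw [← C_pow, hα]
    rw [hq, h2]
    linear_combination (X - C a) * h1
  · have hba : b - a ≠ 0 := sub_ne_zero.mpr (Ne.symm hab)
    refine ⟨C α + C ((β - α) / (b - a)) * (X - C a), ?_⟩
    refine (isCoprime_X_sub_C_of_isUnit_sub (sub_ne_zero.mpr hab).isUnit).mul_dvd ?_ ?_ <;>
      rw [dvd_iff_isRoot, IsRoot.def]
    · simp [hα]
    · simp [hba, hβ]

open Polynomial in
theorem Matrix.exists_charpoly_eq_mul {k : Type*} [Field k] [IsAlgClosed k]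
    (A : Matrix (Fin 2) (Fin 2) k) :
    ∃ a b : k, A.charpoly = (X - C a) * (X - C b) ∧ A.det = a * b := by
  obtain ⟨a, ha⟩ := IsAlgClosed.exists_root A.charpoly
    (by rw [charpoly_degree_eq_dim]; simp)
  rw [charpoly_fin_two, IsRoot.def] at ha
  simp only [eval_add, eval_sub, eval_mul, eval_pow, eval_X, eval_C] at ha
  have hdet : A.det = a * (A.trace - a) := by linear_combination ha
  refine ⟨a, A.trace - a, ?_, hdet⟩
  rw [charpoly_fin_two, hdet]
  simp only [C_mul, C_sub]
  ring

/-- Let `k` be an algebraically closed field and `ℓ` a prime different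
from the characteristic of `k`.  Then `GL(2,k)` is `ℓ`-divisible: every `A ∈ GL(2,k)` has
an `ℓ`-th root in `GL(2,k)`. -/
theorem stmt11 {k : Type*} [Field k] [IsAlgClosed k] (ℓ : ℕ) (hℓ : ℓ.Prime)
    (hchar : ringChar k ≠ ℓ) :
    ∀ A : GL (Fin 2) k, ∃ B : GL (Fin 2) k, B ^ ℓ = A := by
  intro A
  have hn : (ℓ : k) ≠ 0 := fun h ↦
    (hℓ.eq_one_or_self_of_dvd _ (ringChar.dvd h)).elim CharP.ringChar_ne_one hchar
  obtain ⟨a, b, hA, hdet⟩ := A.val.exists_charpoly_eq_mul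
  have ha : a ≠ 0 := by
    rintro rfl
    exact (A.isUnit.map detMonoidHom).ne_zero (by simpa using hdet)
  obtain ⟨p, hp⟩ := exists_mul_dvd_pow_sub_X hn ha b
  rw [← hA] at hp
  have hB : Polynomial.aeval A.val p ^ ℓ = A.val := by
    have := map_dvd (Polynomial.aeval A.val) hp
    rw [aeval_self_charpoly, zero_dvd_iff] at this
    simpa [sub_eq_zero] using this
  have hu : IsUnit (Polynomial.aeval A.val p) :=
    (isUnit_pow_iff hℓ.ne_zero).mp (by rw [hB]; exact A.isUnit)
  exact ⟨hu.unit, Units.ext (by simpa using hB)⟩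
end

section
/- Let k be an algebraically closed field of characteristic p > 0 and let u ∈ PGL(2,k) be the image of the unipotent matrix [[1,1],[0,1]]. Then u has no p-th root in PGL(2,k): there is no ψ ∈ PGL(2,k) with ψ^p = u. In particular, PGL(2,k) is not p-divisible. -/
open Matrix

/-- The unipotent matrix `[[1,1],[0,1]]` as an element of `GL(2,k)`. -/
def unip (k : Type*) [Field k] : GL (Fin 2) k :=
  ⟨!![1, 1; 0, 1], !![1, -1; 0, 1],
    by norm_num [Matrix.mul_fin_two, ← Matrix.one_fin_two],
    by norm_num [Matrix.mul_fin_two, ← Matrix.one_fin_two]⟩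

theorem commute_unip_iff {k : Type*} [Field k] (g : GL (Fin 2) k) :
    Commute g (unip k) ↔ g 1 0 = 0 ∧ g 1 1 = g 0 0 := by
  rw [commute_iff_eq, ← Units.val_inj]
  constructor
  · intro h
    have h00 := congrFun (congrFun h 0) 0
    have h01 := congrFun (congrFun h 0) 1
    simp [unip, Matrix.mul_apply, Fin.sum_univ_two] at h00 h01
    exact ⟨h00, by linear_combination -h01⟩
  · rintro ⟨h10, h11⟩
    ext i j
    fin_cases i <;> fin_cases j <;>
      simp [unip, Matrix.mul_apply, Fin.sum_univ_two, h10, h11, add_comm]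

/-- In characteristic `p`, the `p`-th power of any element of the centralizer of `unip k` is
scalar. -/
theorem pow_val_eq_scalar_of_commute_unip {k : Type*} [Field k] {p : ℕ} (hp : p.Prime) [CharP k p]
    {g : GL (Fin 2) k} (hg : Commute g (unip k)) :
    (g : Matrix (Fin 2) (Fin 2) k) ^ p = Matrix.scalar (Fin 2) (g 0 0 ^ p) := by
  obtain ⟨h10, h11⟩ := (commute_unip_iff g).1 hg
  have := Fact.mk hp
  set N : Matrix (Fin 2) (Fin 2) k := !![0, g 0 1; 0, 0] with hN
  have hdecomp : (g : Matrix (Fin 2) (Fin 2) k) = Matrix.scalar (Fin 2) (g 0 0) + N := by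
    ext i j
    fin_cases i <;> fin_cases j <;> simp [hN, h10, h11]
  have hN2 : N ^ 2 = 0 := by
    ext i j
    fin_cases i <;> fin_cases j <;> simp [hN, pow_two]
  have hNp : N ^ p = 0 := pow_eq_zero_of_le hp.two_le hN2
  rw [hdecomp, add_pow_char_of_commute p (Matrix.scalar_commute _ (Commute.all _) N), hNp,
    add_zero, ← map_pow, ← hdecomp]

theorem unip_notMem_center (k : Type*) [Field k] :
    unip k ∉ Subgroup.center (GL (Fin 2) k) := by
  rw [Matrix.GeneralLinearGroup.mem_center_iff_val_mem_range_scalar]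
  rintro ⟨c, hc⟩
  simpa [unip] using congrFun (congrFun hc 0) 1

/-- Let `k` be an algebraically closed field of characteristic `p > 0`
and let `u ∈ PGL(2,k)` be the image of the unipotent matrix `[[1,1],[0,1]]`.  Then `u`
has no `p`-th root in `PGL(2,k)`; in particular `PGL(2,k)` is not `p`-divisible. -/
theorem stmt13 {k : Type*} [Field k] [IsAlgClosed k] (p : ℕ) (hp : p.Prime) [CharP k p] :
    ¬ ∃ ψ : GL (Fin 2) k ⧸ Subgroup.center (GL (Fin 2) k),
      ψ ^ p = QuotientGroup.mk (unip k) := by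
  rintro ⟨ψ, hψ⟩
  obtain ⟨g, rfl⟩ := QuotientGroup.mk_surjective ψ
  have hz : (g ^ p)⁻¹ * unip k ∈ Subgroup.center (GL (Fin 2) k) := QuotientGroup.eq.1 hψ
  have hg : Commute g (unip k) := by
    have h := ((Commute.refl g).pow_right p).mul_right (Subgroup.mem_center_iff.1 hz g)
    rwa [mul_inv_cancel_left] at h
  have hgp : g ^ p ∈ Subgroup.center (GL (Fin 2) k) := by
    rw [Matrix.GeneralLinearGroup.mem_center_iff_val_mem_range_scalar]
    exact ⟨_, (pow_val_eq_scalar_of_commute_unip hp hg).symm⟩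
  exact unip_notMem_center k (by simpa using mul_mem hgp hz)
end
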